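/- arXiv:2010.00395 — 2 statements merged into one kernel-verified Lean document; each statement's English description precedes it below -/
import Mathlib

section
/- Let n ≥ 2, let μ be a finite even Borel measure on S^{n-1} that is not concentrated in any closed hemisphere, and let 0 < α < 1/n. Then there exists an origin-symmetric convex body K in ℝⁿ (containing the origin in its interior) such that μ(η) = γ_n(K)^{α−1} · S_{γ_n,K}(η) for every Borel set η ⊆ S^{n-1}. -/
open MeasureTheory Metric Set Filter
open scoped RealInnerProductSpace Topology Pointwise NNReal ENNReal

noncomputable section

/-- `ℝⁿ` as Euclidean space. -/
abbrev Eu (n : ℕ) := EuclideanSpace ℝ (Fin n)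

/-- The Gaussian measure `γₙ(A) = (2π)^{-n/2} ∫_A e^{-|x|²/2} dx`. -/
def gaussVol (n : ℕ) (A : Set (Eu n)) : ℝ :=
  (Real.sqrt (2 * Real.pi))⁻¹ ^ n * ∫ x in A, Real.exp (-‖x‖ ^ 2 / 2)

/-- A convex body: a compact convex set with nonempty interior. -/
def IsConvexBody {n : ℕ} (K : Set (Eu n)) : Prop :=
  Convex ℝ K ∧ IsCompact K ∧ (interior K).Nonempty

/-- The support function `h_K(v) = max_{y ∈ K} ⟪y, v⟫`. -/
def suppFun {n : ℕ} (K : Set (Eu n)) (v : Eu n) : ℝ :=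
  sSup ((fun y => ⟪y, v⟫) '' K)

/-- The Gaussian surface area measure of `K`, as a set function:
`S_{γₙ,K}(η) = (2π)^{-n/2} ∫_{ν_K⁻¹(η)} e^{-|x|²/2} dH^{n-1}(x)`, where
`ν_K⁻¹(η)` is the set of boundary points of `K` having an outer unit normal in `η`. -/
def gaussSurf (n : ℕ) (K : Set (Eu n)) (η : Set (Eu n)) : ℝ :=
  (Real.sqrt (2 * Real.pi))⁻¹ ^ n *
    ∫ x in {x | x ∈ frontier K ∧ ∃ v ∈ η, ⟪x, v⟫ = suppFun K v},
      Real.exp (-‖x‖ ^ 2 / 2) ∂μH[(n : ℝ) - 1]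

open Classical in
/-- (A choice of) Gauss map of `K`: to a boundary point `x` it assigns an outer unit
normal of `K` at `x` (for a convex body `K`, this is unique for `H^{n-1}`-a.e. `x ∈ ∂K`). -/
def gaussMap {n : ℕ} (K : Set (Eu n)) (x : Eu n) : Eu n :=
  if h : ∃ v : Eu n, ‖v‖ = 1 ∧ ⟪x, v⟫ = suppFun K v then h.choose else 0

/-- The Wulff shape `[g] = {x : x·v ≤ g v for all unit v}`. -/
def wulff {n : ℕ} (g : Eu n → ℝ) : Set (Eu n) :=
  {x | ∀ v : Eu n, ‖v‖ = 1 → ⟪x, v⟫ ≤ g v}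

/-- The radial function `ρ_K(u) = max {r : r • u ∈ K}`. -/
def radialFun {n : ℕ} (K : Set (Eu n)) (u : Eu n) : ℝ :=
  sSup {r : ℝ | r • u ∈ K}

/-- The standard Gaussian distribution function `Φ`. -/
def Phi (x : ℝ) : ℝ :=
  (Real.sqrt (2 * Real.pi))⁻¹ * ∫ t in Iic x, Real.exp (-t ^ 2 / 2)

/-- The inverse `Φ⁻¹` of the standard Gaussian distribution function. -/
def PhiInv : ℝ → ℝ := Function.invFun Phi

lemma exists_frame {m : ℕ} {v : Eu (m + 1)} (hv : ‖v‖ = 1) :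
    ∃ ι : Eu m →ₗᵢ[ℝ] Eu (m + 1), ∀ y, ⟪ι y, v⟫ = 0 := by
  have : Fact (Module.finrank ℝ (Eu (m + 1)) = m + 1) := ⟨by simp⟩
  have hv0 : v ≠ 0 := by rintro rfl; simp at hv
  have hf : Module.finrank ℝ (ℝ ∙ v)ᗮ = m := Submodule.finrank_orthogonal_span_singleton hv0
  let b : OrthonormalBasis (Fin m) ℝ (ℝ ∙ v)ᗮ := (stdOrthonormalBasis ℝ _).reindex (finCongr hf)
  refine ⟨(ℝ ∙ v)ᗮ.subtypeₗᵢ.comp b.repr.symm.toLinearIsometry, fun y => ?_⟩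
  have := (b.repr.symm y).2
  rw [Submodule.mem_orthogonal_singleton_iff_inner_left] at this
  exact this

/-- The projection onto the hyperplane parametrised by `ι`. -/
def prj {m : ℕ} (ι : Eu m →ₗᵢ[ℝ] Eu (m + 1)) : Eu (m + 1) →L[ℝ] Eu m :=
  ContinuousLinearMap.adjoint ι.toContinuousLinearMap

lemma prj_inner {m : ℕ} (ι : Eu m →ₗᵢ[ℝ] Eu (m + 1)) (z y) : ⟪prj ι z, y⟫ = ⟪z, ι y⟫ := by
  unfold prj
  rw [ContinuousLinearMap.adjoint_inner_left]; rfl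

lemma prj_inner' {m : ℕ} (ι : Eu m →ₗᵢ[ℝ] Eu (m + 1)) (z y) : ⟪y, prj ι z⟫ = ⟪ι y, z⟫ := by
  rw [real_inner_comm, prj_inner, real_inner_comm]

lemma prj_ι {m : ℕ} (ι : Eu m →ₗᵢ[ℝ] Eu (m + 1)) (y) : prj ι (ι y) = y := by
  refine ext_inner_right ℝ fun w => ?_
  rw [prj_inner, ι.inner_map_map]

lemma prj_v {m : ℕ} {v : Eu (m + 1)} {ι : Eu m →ₗᵢ[ℝ] Eu (m + 1)}
    (hι : ∀ y, ⟪ι y, v⟫ = 0) : prj ι v = 0 := by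
  refine ext_inner_right ℝ fun w => ?_
  rw [prj_inner, real_inner_comm, hι, inner_zero_left]

/-- The isometry `(y, s) ↦ ι y + s v`. -/
def frameIso {m : ℕ} {v : Eu (m + 1)} (hv : ‖v‖ = 1) {ι : Eu m →ₗᵢ[ℝ] Eu (m + 1)}
    (hι : ∀ y, ⟪ι y, v⟫ = 0) : WithLp 2 (Eu m × ℝ) →ₗᵢ[ℝ] Eu (m + 1) where
  toFun p := ι p.fst + p.snd • v
  map_add' p q := by simp [add_smul]; abel
  map_smul' c p := by simp [mul_smul]
  norm_map' p := by
    have h1 : ‖ι p.fst + p.snd • v‖ ^ 2 = ‖p‖ ^ 2 := by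
      rw [@norm_add_sq_real, inner_smul_right, hι, WithLp.prod_norm_sq_eq_of_L2, ι.norm_map,
        norm_smul, hv]
      simp
    exact (pow_left_inj₀ (norm_nonneg _) (norm_nonneg _) two_ne_zero).1 h1

lemma finrank_frame (m : ℕ) : Module.finrank ℝ (WithLp 2 (Eu m × ℝ)) = Module.finrank ℝ (Eu (m + 1)) := by
  rw [(WithLp.linearEquiv 2 ℝ (Eu m × ℝ)).finrank_eq]; simp

lemma frame_decomp {m : ℕ} {v : Eu (m + 1)} (hv : ‖v‖ = 1) {ι : Eu m →ₗᵢ[ℝ] Eu (m + 1)}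
    (hι : ∀ y, ⟪ι y, v⟫ = 0) (z : Eu (m + 1)) : ι (prj ι z) + ⟪z, v⟫ • v = z := by
  let e := (frameIso hv hι).toLinearIsometryEquiv (finrank_frame m)
  obtain ⟨p, rfl⟩ := e.surjective z
  have : e p = ι p.fst + p.snd • v := rfl
  rw [this]
  simp [prj_ι, prj_v hι, inner_add_left, hι, inner_smul_left, hv]

lemma norm_prj_le {m : ℕ} (ι : Eu m →ₗᵢ[ℝ] Eu (m + 1)) (z) : ‖prj ι z‖ ≤ ‖z‖ := by
  have h := prj_inner ι z (prj ι z)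
  rw [real_inner_self_eq_norm_sq] at h
  have h2 := real_inner_le_norm z (ι (prj ι z))
  rw [ι.norm_map, ← h] at h2
  by_contra hc
  push Not at hc
  nlinarith [norm_nonneg z]

lemma lipschitz_prj {m : ℕ} (ι : Eu m →ₗᵢ[ℝ] Eu (m + 1)) : LipschitzWith 1 (prj ι) :=
  LipschitzWith.of_dist_le_mul fun x y => by
    rw [dist_eq_norm, dist_eq_norm, ← map_sub]; simpa using norm_prj_le ι (x - y)

/-- Normalising constant between Hausdorff and Lebesgue measure. -/
def kap (m : ℕ) : ℝ≥0 :=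
  haveI : Measure.IsAddHaarMeasure (μH[(m : ℝ)] : Measure (Eu m)) := by
    have := isAddHaarMeasure_hausdorffMeasure (E := Eu m)
    simpa using this
  Measure.addHaarScalarFactor (μH[(m : ℝ)] : Measure (Eu m)) volume

instance haarH (m : ℕ) : Measure.IsAddHaarMeasure (μH[(m : ℝ)] : Measure (Eu m)) := by
  have := isAddHaarMeasure_hausdorffMeasure (E := Eu m)
  simpa using this

lemma kap_pos (m : ℕ) : 0 < kap m := Measure.addHaarScalarFactor_pos_of_isAddHaarMeasure _ _

lemma hausdorff_eq (m : ℕ) : (μH[(m : ℝ)] : Measure (Eu m)) = kap m • volume :=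
  Measure.isAddLeftInvariant_eq_smul _ _

lemma fubini_frame {m : ℕ} {v : Eu (m + 1)} (hv : ‖v‖ = 1) {ι : Eu m →ₗᵢ[ℝ] Eu (m + 1)}
    (hι : ∀ y, ⟪ι y, v⟫ = 0) {f : Eu (m + 1) → ℝ≥0∞} (hf : Measurable f) :
    (kap m : ℝ≥0∞) * ∫⁻ z, f z = ∫⁻ y, (∫⁻ s : ℝ, f (ι y + s • v)) ∂(μH[(m : ℝ)] : Measure (Eu m)) := by
  let e := (frameIso hv hι).toLinearIsometryEquiv (finrank_frame m)
  have h1 : MeasurePreserving (fun p : Eu m × ℝ => ι p.1 + p.2 • v) volume volume :=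
    e.measurePreserving.comp (WithLp.volume_preserving_toLp (Eu m) ℝ)
  rw [← h1.lintegral_comp hf, hausdorff_eq, lintegral_smul_measure]
  rw [Measure.volume_eq_prod, lintegral_prod]
  · rfl
  · exact (hf.comp h1.measurable).aemeasurable

section supp
variable {n : ℕ} {K : Set (Eu n)}

lemma le_suppFun (hK : IsCompact K) {x : Eu n} (hx : x ∈ K) (v : Eu n) : ⟪x, v⟫ ≤ suppFun K v := by
  refine le_csSup ?_ ⟨x, hx, rfl⟩
  exact (hK.image (by fun_prop)).bddAbove

lemma suppFun_le (hne : K.Nonempty) {v : Eu n} {b : ℝ} (h : ∀ x ∈ K, ⟪x, v⟫ ≤ b) :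
    suppFun K v ≤ b := by
  refine csSup_le (hne.image _) ?_
  rintro _ ⟨x, hx, rfl⟩
  exact h x hx

lemma suppFun_lip (hK : IsCompact K) (hne : K.Nonempty) {R : ℝ} (hR : K ⊆ closedBall 0 R)
    (v w : Eu n) : suppFun K v ≤ suppFun K w + R * ‖v - w‖ := by
  refine suppFun_le hne fun x hx => ?_
  have h1 := le_suppFun hK hx w
  have h2 : ⟪x, v⟫ = ⟪x, w⟫ + ⟪x, v - w⟫ := by rw [← inner_add_right]; simp
  have h3 := real_inner_le_norm x (v - w)
  have h4 : ‖x‖ ≤ R := by simpa using hR hx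
  have := mul_le_mul_of_nonneg_right h4 (norm_nonneg (v - w))
  linarith

lemma suppFun_continuous (hK : IsCompact K) (hne : K.Nonempty) : Continuous (suppFun K) := by
  obtain ⟨R, hR⟩ := hK.isBounded.subset_closedBall 0
  obtain ⟨x, hx⟩ := hne
  have hR0 : 0 ≤ R := by
    have : ‖x‖ ≤ R := by simpa using hR hx
    exact (norm_nonneg _).trans this
  refine (LipschitzWith.of_dist_le_mul (K := R.toNNReal) fun v w => ?_).continuous
  rw [Real.dist_eq, abs_le, dist_eq_norm]
  have h1 := suppFun_lip hK ⟨x, hx⟩ hR v w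
  have h2 := suppFun_lip hK ⟨x, hx⟩ hR w v
  rw [norm_sub_rev] at h2
  rw [Real.coe_toNNReal R hR0]
  constructor <;> linarith

end supp

/-- origin-symmetric convex bodies -/
structure SymBody {n : ℕ} (K : Set (Eu n)) : Prop where
  conv : Convex ℝ K
  cpt : IsCompact K
  sym : ∀ x ∈ K, -x ∈ K
  int : (0 : Eu n) ∈ interior K

namespace SymBody

lemma zero_mem {n : ℕ} {K : Set (Eu n)} (hK : SymBody K) : (0 : Eu n) ∈ K := interior_subset hK.int

lemma ne {n : ℕ} {K : Set (Eu n)} (hK : SymBody K) : K.Nonempty := ⟨0, hK.zero_mem⟩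

lemma exists_R {n : ℕ} {K : Set (Eu n)} (hK : SymBody K) : ∃ R : ℝ, 0 < R ∧ K ⊆ closedBall 0 R := by
  obtain ⟨R, hR⟩ := hK.cpt.isBounded.subset_closedBall 0
  exact ⟨max R 1, by positivity, hR.trans (closedBall_subset_closedBall (le_max_left _ _))⟩

lemma exists_r {n : ℕ} {K : Set (Eu n)} (hK : SymBody K) : ∃ r : ℝ, 0 < r ∧ closedBall 0 r ⊆ K := by
  have := mem_interior_iff_mem_nhds.1 hK.int
  exact Metric.nhds_basis_closedBall.mem_iff.1 this

lemma r_le {n : ℕ} {K : Set (Eu n)} (hK : SymBody K) {r : ℝ} (hr : 0 < r) (h : closedBall 0 r ⊆ K) {v : Eu n} (hv : ‖v‖ = 1) :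
    r ≤ suppFun K v := by
  have h1 : r • v ∈ K := h (by simp [norm_smul, hv, abs_of_pos hr])
  have := le_suppFun hK.cpt h1 v
  rwa [real_inner_smul_left, real_inner_self_eq_norm_sq, hv, one_pow, mul_one] at this

lemma frontier_sub {n : ℕ} {K : Set (Eu n)} (hK : SymBody K) : frontier K ⊆ K := hK.cpt.isClosed.frontier_subset

lemma mem_iff {n : ℕ} {K : Set (Eu n)} (hK : SymBody K) {x : Eu n} : x ∈ K ↔ ∀ v : Eu n, ‖v‖ = 1 → ⟪x, v⟫ ≤ suppFun K v := by
  refine ⟨fun hx v _ => le_suppFun hK.cpt hx v, fun h => ?_⟩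
  by_contra hx
  obtain ⟨f, u, h1, h2⟩ := geometric_hahn_banach_closed_point hK.conv hK.cpt.isClosed hx
  let w := (InnerProductSpace.toDual ℝ (Eu n)).symm f
  have hw : ∀ y, f y = ⟪y, w⟫ := fun y => by
    rw [real_inner_comm]; exact (InnerProductSpace.toDual_symm_apply).symm
  have hw0 : w ≠ 0 := by
    intro h0
    have a := h1 0 hK.zero_mem
    rw [hw, h0] at a
    rw [hw, h0] at h2
    simp at a h2
    linarith
  have hn : 0 < ‖w‖ := norm_pos_iff.2 hw0
  have h3 := h (‖w‖⁻¹ • w) (by rw [norm_smul]; simp; field_simp)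
  have h4 : suppFun K (‖w‖⁻¹ • w) ≤ ‖w‖⁻¹ * u := by
    refine suppFun_le hK.ne fun y hy => ?_
    rw [real_inner_smul_right]
    have := h1 y hy
    rw [hw] at this
    exact mul_le_mul_of_nonneg_left this.le (by positivity)
  rw [real_inner_smul_right] at h3
  have h5 := mul_lt_mul_of_pos_left h2 (inv_pos.2 hn)
  rw [hw] at h5
  linarith

lemma exists_normal {n : ℕ} {K : Set (Eu n)} (hK : SymBody K) {x : Eu n} (hx : x ∈ frontier K) :
    ∃ v : Eu n, ‖v‖ = 1 ∧ ⟪x, v⟫ = suppFun K v := by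
  have hxi : x ∉ interior K := fun h => hx.2 h
  obtain ⟨f, h1⟩ := geometric_hahn_banach_open_point hK.conv.interior isOpen_interior hxi
  let w := (InnerProductSpace.toDual ℝ (Eu n)).symm f
  have hw : ∀ y, f y = ⟪y, w⟫ := fun y => by
    rw [real_inner_comm]; exact (InnerProductSpace.toDual_symm_apply).symm
  have hw0 : w ≠ 0 := by
    intro h0
    have a := h1 0 hK.int
    rw [hw, hw, h0] at a
    simp at a
  have hn : 0 < ‖w‖ := norm_pos_iff.2 hw0
  refine ⟨‖w‖⁻¹ • w, by rw [norm_smul]; simp; field_simp, ?_⟩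
  refine le_antisymm (le_suppFun hK.cpt (hK.frontier_sub hx) _) ?_
  refine suppFun_le hK.ne fun y hy => ?_
  rw [real_inner_smul_right, real_inner_smul_right]
  refine mul_le_mul_of_nonneg_left ?_ (by positivity)
  have hcl : y ∈ closure (interior K) := by
    rw [hK.conv.closure_interior_eq_closure_of_nonempty_interior ⟨0, hK.int⟩]
    exact subset_closure hy
  have : closure (interior K) ⊆ {y | f y ≤ f x} :=
    closure_minimal (fun z hz => (h1 z hz).le) (isClosed_le f.continuous continuous_const)
  have := this hcl
  simpa [hw] using this

/-- a point of `K` with a unit normal lies on the boundary -/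
lemma not_mem_add {n : ℕ} {K : Set (Eu n)} (hK : SymBody K) {x v w : Eu n} {s : ℝ} (hs : 0 < s) (hv : ⟪x, v⟫ = suppFun K v)
    (hvw : 0 < ⟪w, v⟫) : x + s • w ∉ K := by
  intro h
  have := le_suppFun hK.cpt h v
  rw [inner_add_left, real_inner_smul_left, hv] at this
  nlinarith [mul_pos hs hvw]

lemma suppFun_neg {n : ℕ} {K : Set (Eu n)} (hK : SymBody K) (v : Eu n) : suppFun K (-v) = suppFun K v := by
  have key : ∀ v, suppFun K (-v) ≤ suppFun K v := fun v => suppFun_le hK.ne fun x hx => by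
    have := le_suppFun hK.cpt (hK.sym x hx) v
    simpa using this
  refine le_antisymm (key v) ?_
  simpa using key (-v)

lemma suppFun_pos {n : ℕ} {K : Set (Eu n)} (hK : SymBody K) {v : Eu n} (hv : ‖v‖ = 1) : 0 < suppFun K v := by
  obtain ⟨r, hr, h⟩ := hK.exists_r
  exact hr.trans_le (hK.r_le hr h hv)

/-- monotonicity of normals: the graph is Lipschitz -/
lemma normal_graph {n : ℕ} {K : Set (Eu n)} (hK : SymBody K) {x y ν : Eu n} (hy : y ∈ K) (hν : ⟪x, ν⟫ = suppFun K ν) :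
    ⟪y - x, ν⟫ ≤ 0 := by
  rw [inner_sub_left, hν]
  linarith [le_suppFun hK.cpt hy ν]

end SymBody

/-- inverse Gauss image -/
def NI {n : ℕ} (K η : Set (Eu n)) : Set (Eu n) :=
  {x | x ∈ frontier K ∧ ∃ v ∈ η, ⟪x, v⟫ = suppFun K v}

lemma SymBody.isClosed_NI {n : ℕ} {K : Set (Eu n)} (hK : SymBody K) {η : Set (Eu n)}
    (hη : IsCompact η) : IsClosed (NI K η) := by
  have hfc : IsCompact (frontier K) := hK.cpt.of_isClosed_subset isClosed_frontier hK.frontier_sub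
  have hc : IsClosed {p : Eu n × Eu n | ⟪p.1, p.2⟫ = suppFun K p.2} :=
    isClosed_eq (by fun_prop) ((suppFun_continuous hK.cpt hK.ne).comp continuous_snd)
  have : NI K η = Prod.fst '' ((frontier K ×ˢ η) ∩ {p : Eu n × Eu n | ⟪p.1, p.2⟫ = suppFun K p.2}) := by
    ext x
    simp only [NI, mem_ofPred_eq, mem_image, mem_inter_iff, mem_prod, Prod.exists]
    constructor
    · rintro ⟨h1, v, h2, h3⟩
      exact ⟨x, v, ⟨⟨h1, h2⟩, h3⟩, rfl⟩
    · rintro ⟨a, b, ⟨⟨h1, h2⟩, h3⟩, rfl⟩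
      exact ⟨h1, b, h2, h3⟩
  rw [this]
  exact (((hfc.prod hη).inter_right hc).image continuous_fst).isClosed

section geom
variable {m : ℕ} {K : Set (Eu (m + 1))} {v : Eu (m + 1)} {ι : Eu m →ₗᵢ[ℝ] Eu (m + 1)}

lemma inner_decomp (hv : ‖v‖ = 1) (hι : ∀ y, ⟪ι y, v⟫ = 0) (x ν : Eu (m + 1)) :
    ⟪x, ν⟫ = ⟪prj ι x, prj ι ν⟫ + ⟪x, v⟫ * ⟪ν, v⟫ := by
  conv_lhs => rw [← frame_decomp hv hι x]
  rw [inner_add_left, prj_inner', real_inner_smul_left, real_inner_comm ν v]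

lemma norm_le_decomp (hv : ‖v‖ = 1) (hι : ∀ y, ⟪ι y, v⟫ = 0) (x : Eu (m + 1)) :
    ‖x‖ ≤ ‖prj ι x‖ + |⟪x, v⟫| := by
  conv_lhs => rw [← frame_decomp hv hι x]
  refine (norm_add_le _ _).trans ?_
  rw [ι.norm_map, norm_smul, hv, mul_one, Real.norm_eq_abs]

/-- `x` has a (not nec. unit) normal close to direction `v` -/
def GoodN (K : Set (Eu (m + 1))) (v : Eu (m + 1)) (ι : Eu m →ₗᵢ[ℝ] Eu (m + 1)) (b c : ℝ)
    (x : Eu (m + 1)) : Prop :=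
  x ∈ K ∧ ∃ ν, ⟪x, ν⟫ = suppFun K ν ∧ c ≤ ⟪ν, v⟫ ∧ ‖prj ι ν‖ ≤ b

lemma goodN_le (hK : SymBody K) (hv : ‖v‖ = 1) (hι : ∀ y, ⟪ι y, v⟫ = 0) {b c : ℝ} (hc : 0 < c)
    {x y : Eu (m + 1)} (hx : GoodN K v ι b c x) (hy : y ∈ K) :
    ⟪y - x, v⟫ ≤ b / c * ‖prj ι (y - x)‖ := by
  obtain ⟨-, ν, h1, h2, h3⟩ := hx
  have h4 := hK.normal_graph hy h1
  rw [inner_decomp hv hι] at h4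
  have h5 := abs_le.1 (abs_real_inner_le_norm (prj ι (y - x)) (prj ι ν))
  have h6 : ‖prj ι (y - x)‖ * ‖prj ι ν‖ ≤ ‖prj ι (y - x)‖ * b :=
    mul_le_mul_of_nonneg_left h3 (norm_nonneg _)
  have hb : 0 ≤ b := (norm_nonneg _).trans h3
  rcases le_or_gt ⟪y - x, v⟫ 0 with h | h
  · exact h.trans (by positivity)
  · rw [div_mul_eq_mul_div, le_div_iff₀ hc]
    nlinarith [mul_le_mul_of_nonneg_left h2 h.le]

lemma goodN_abs (hK : SymBody K) (hv : ‖v‖ = 1) (hι : ∀ y, ⟪ι y, v⟫ = 0) {b c : ℝ} (hc : 0 < c)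
    {x y : Eu (m + 1)} (hx : GoodN K v ι b c x) (hy : GoodN K v ι b c y) :
    |⟪y - x, v⟫| ≤ b / c * ‖prj ι (y - x)‖ := by
  have h1 := goodN_le hK hv hι hc hx hy.1
  have h2 := goodN_le hK hv hι hc hy hx.1
  rw [← neg_sub y x, inner_neg_left, map_neg, norm_neg] at h2
  rw [abs_le]; constructor <;> linarith

lemma goodN_dist (hK : SymBody K) (hv : ‖v‖ = 1) (hι : ∀ y, ⟪ι y, v⟫ = 0) {b c : ℝ} (hc : 0 < c)
    {x y : Eu (m + 1)} (hx : GoodN K v ι b c x) (hy : GoodN K v ι b c y) :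
    dist x y ≤ (1 + b / c) * dist (prj ι x) (prj ι y) := by
  have h1 := goodN_abs hK hv hι hc hx hy
  have h2 := norm_le_decomp hv hι (y - x)
  rw [dist_comm, dist_comm (prj ι x), dist_eq_norm, dist_eq_norm, ← map_sub]
  linarith

lemma goodN_injOn (hK : SymBody K) (hv : ‖v‖ = 1) (hι : ∀ y, ⟪ι y, v⟫ = 0) {b c : ℝ} (hc : 0 < c) :
    InjOn (prj ι) {x | GoodN K v ι b c x} := by
  intro x hx y hy hxy
  have := goodN_dist hK hv hι hc hx hy
  rw [hxy, dist_self, mul_zero] at this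
  exact dist_le_zero.1 this

lemma haus_le (hK : SymBody K) (hv : ‖v‖ = 1) (hι : ∀ y, ⟪ι y, v⟫ = 0) {b c : ℝ} (hc : 0 < c)
    {s : Set (Eu (m + 1))} (hs : ∀ x ∈ s, GoodN K v ι b c x) :
    (μH[(m : ℝ)] : Measure (Eu (m + 1))) s ≤
      ENNReal.ofReal (1 + b / c) ^ m * (μH[(m : ℝ)] : Measure (Eu m)) (prj ι '' s) := by
  have hinj : InjOn (prj ι) s := (goodN_injOn hK hv hι hc).mono hs
  let g := Function.invFunOn (prj ι) s
  have hg : ∀ x ∈ s, g (prj ι x) = x := fun x hx => hinj.leftInvOn_invFunOn hx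
  have hgs : g '' (prj ι '' s) = s := by
    rw [image_image]
    ext x; constructor
    · rintro ⟨y, hy, rfl⟩; simpa only [hg y hy] using hy
    · intro hx; exact ⟨x, hx, hg x hx⟩
  have hlip : LipschitzOnWith (Real.toNNReal (1 + b / c)) g (prj ι '' s) := by
    refine LipschitzOnWith.of_dist_le_mul ?_
    rintro _ ⟨x, hx, rfl⟩ _ ⟨y, hy, rfl⟩
    rw [hg x hx, hg y hy]
    refine (goodN_dist hK hv hι hc (hs x hx) (hs y hy)).trans ?_
    exact mul_le_mul_of_nonneg_right (Real.le_coe_toNNReal _) dist_nonneg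
  have := hlip.hausdorffMeasure_image_le (d := (m : ℝ)) (by positivity)
  rw [hgs] at this
  rw [ENNReal.rpow_natCast] at this
  exact this

lemma uniq_aux (hK : SymBody K) (hv : ‖v‖ = 1) (hι : ∀ y, ⟪ι y, v⟫ = 0) {c : ℝ} (hc : 0 < c) :
    (μH[(m : ℝ)] : Measure (Eu (m + 1))) {x | x ∈ K ∧ ∃ ν₁ ν₂ : Eu (m + 1), ν₁ ≠ ν₂ ∧ ‖ν₁‖ = 1 ∧ ‖ν₂‖ = 1 ∧
      ⟪x, ν₁⟫ = suppFun K ν₁ ∧ ⟪x, ν₂⟫ = suppFun K ν₂ ∧ c ≤ ⟪ν₁, v⟫ ∧ c ≤ ⟪ν₂, v⟫} = 0 := by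
  let φ : Eu m → ℝ := fun y => sSup ((fun x => ⟪x, v⟫ - c⁻¹ * ‖y - prj ι x‖) '' K)
  have hle : ∀ y, ∀ x ∈ K, ⟪x, v⟫ - c⁻¹ * ‖y - prj ι x‖ ≤ φ y := fun y x hx =>
    le_csSup (hK.cpt.image (by fun_prop)).bddAbove ⟨x, hx, rfl⟩
  have hge : ∀ y b, (∀ x ∈ K, ⟪x, v⟫ - c⁻¹ * ‖y - prj ι x‖ ≤ b) → φ y ≤ b := fun y b h =>
    csSup_le (hK.ne.image _) (by rintro _ ⟨x, hx, rfl⟩; exact h x hx)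
  have hlip : LipschitzWith (Real.toNNReal c⁻¹) φ := by
    have key : ∀ y z, φ y ≤ φ z + c⁻¹ * ‖y - z‖ := by
      intro y z
      refine hge y _ fun x hx => ?_
      have h1 := hle z x hx
      have h2 : ‖z - prj ι x‖ ≤ ‖y - z‖ + ‖y - prj ι x‖ := by
        have := norm_add_le (z - y) (y - prj ι x)
        rw [sub_add_sub_cancel, norm_sub_rev z y] at this
        exact this
      have := mul_le_mul_of_nonneg_left h2 (inv_pos.2 hc).le
      linarith
    refine LipschitzWith.of_dist_le_mul fun y z => ?_
    rw [Real.dist_eq, abs_le, dist_eq_norm, Real.coe_toNNReal _ (inv_pos.2 hc).le]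
    have h1 := key y z
    have h2 := key z y
    rw [norm_sub_rev] at h2
    constructor <;> linarith
  have hae := hlip.ae_differentiableAt (μ := (μH[(m : ℝ)] : Measure (Eu m)))
  rw [ae_iff] at hae
  refine le_antisymm ?_ (zero_le)
  refine (haus_le hK hv hι (b := 1) (c := c) hc ?_).trans ?_
  · rintro x ⟨hx, ν, -, -, h1, -, h2, -, h3, -⟩
    exact ⟨hx, ν, h2, h3, (norm_prj_le ι ν).trans h1.le⟩
  · refine le_of_eq ?_
    refine mul_eq_zero_of_right _ (measure_mono_null ?_ hae)
    rintro _ ⟨x, ⟨hx, ν₁, ν₂, hne, hn1, hn2, h1, h2, h3, h4⟩, rfl⟩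
    show ¬ DifferentiableAt ℝ φ (prj ι x)
    intro hd
    have key : ∀ ν, ‖ν‖ = 1 → ⟪x, ν⟫ = suppFun K ν → c ≤ ⟪ν, v⟫ → ∀ w,
        fderiv ℝ φ (prj ι x) w = - (⟪ν, v⟫⁻¹ * ⟪prj ι ν, w⟫) := by
      intro ν hn h1 h3 w
      have hpos : 0 < ⟪ν, v⟫ := hc.trans_le h3
      let l : Eu m → ℝ := fun y => ⟪ν, v⟫⁻¹ * (suppFun K ν - ⟪prj ι ν, y⟫)
      have hl : HasFDerivAt l (⟪ν, v⟫⁻¹ • (0 - innerSL ℝ (prj ι ν))) (prj ι x) := by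
        refine HasFDerivAt.const_mul ?_ _
        exact (hasFDerivAt_const _ _).sub (innerSL ℝ (prj ι ν)).hasFDerivAt
      have hK' : ∀ x' ∈ K, ⟪x', v⟫ ≤ l (prj ι x') := by
        intro x' hx'
        have := le_suppFun hK.cpt hx' ν
        rw [inner_decomp hv hι] at this
        show _ ≤ ⟪ν, v⟫⁻¹ * _
        rw [le_inv_mul_iff₀ hpos, real_inner_comm (prj ι x') (prj ι ν)]
        linarith
      have hll : ∀ y, φ y ≤ l y := by
        intro y
        refine hge y _ fun x' hx' => ?_
        have h5 := hK' x' hx'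
        have h6 : l (prj ι x') - l y = ⟪ν, v⟫⁻¹ * ⟪prj ι ν, y - prj ι x'⟫ := by
          simp only [l, inner_sub_right]; ring
        have h7 : ⟪prj ι ν, y - prj ι x'⟫ ≤ ‖y - prj ι x'‖ := by
          refine (real_inner_le_norm _ _).trans ?_
          have := (norm_prj_le ι ν).trans hn.le
          nlinarith [norm_nonneg (y - prj ι x')]
        have h8 : ⟪ν, v⟫⁻¹ ≤ c⁻¹ := inv_anti₀ hc h3
        have h9 : ⟪ν, v⟫⁻¹ * ⟪prj ι ν, y - prj ι x'⟫ ≤ c⁻¹ * ‖y - prj ι x'‖ :=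
          (mul_le_mul_of_nonneg_left h7 (inv_pos.2 hpos).le).trans
            (mul_le_mul_of_nonneg_right h8 (norm_nonneg _))
        linarith
      have hlx : l (prj ι x) ≤ φ (prj ι x) := by
        have h5 := hle (prj ι x) x hx
        rw [sub_self, norm_zero, mul_zero, sub_zero] at h5
        refine le_trans ?_ h5
        show ⟪ν, v⟫⁻¹ * _ ≤ _
        rw [inv_mul_le_iff₀ hpos, ← h1, inner_decomp hv hι, real_inner_comm (prj ι x) (prj ι ν)]
        linarith
      have hmin : IsLocalMin (fun y => l y - φ y) (prj ι x) :=
        Eventually.of_forall fun y => by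
          have := hll y
          show l _ - φ _ ≤ l y - φ y
          linarith
      have h0 := hmin.hasFDerivAt_eq_zero (hl.sub hd.hasFDerivAt)
      have h0w := DFunLike.congr_fun h0 w
      simp at h0w
      linarith
    have e1 := key ν₁ hn1 h1 h3
    have e2 := key ν₂ hn2 h2 h4
    have p1 : 0 < ⟪ν₁, v⟫ := hc.trans_le h3
    have p2 : 0 < ⟪ν₂, v⟫ := hc.trans_le h4
    have e3 : ⟪ν₁, v⟫⁻¹ • prj ι ν₁ = ⟪ν₂, v⟫⁻¹ • prj ι ν₂ := by
      refine ext_inner_right ℝ fun w => ?_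
      rw [real_inner_smul_left, real_inner_smul_left]
      linarith [e1 w, e2 w]
    have e4 : ∀ ν, 0 < ⟪ν, v⟫ → ⟪ν, v⟫⁻¹ • ν = ι (⟪ν, v⟫⁻¹ • prj ι ν) + v := by
      intro ν hp
      conv_lhs => rw [← frame_decomp hv hι ν]
      rw [smul_add, smul_smul, map_smul]
      simp only [inner_add_left, hι, real_inner_smul_left, real_inner_self_eq_norm_sq, hv]
      simp [hp.ne']
    have e5 : ⟪ν₁, v⟫⁻¹ • ν₁ = ⟪ν₂, v⟫⁻¹ • ν₂ := by rw [e4 _ p1, e4 _ p2, e3]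
    have e6 := congrArg norm e5
    rw [norm_smul, norm_smul, hn1, hn2, mul_one, mul_one, Real.norm_of_nonneg (inv_pos.2 p1).le,
      Real.norm_of_nonneg (inv_pos.2 p2).le] at e6
    rw [e6] at e5
    exact hne (smul_right_injective _ (inv_pos.2 p2).ne' e5)

/-- singular boundary points -/
def Sing {n : ℕ} (K : Set (Eu n)) : Set (Eu n) :=
  {x | x ∈ K ∧ ∃ ν₁ ν₂ : Eu n, ν₁ ≠ ν₂ ∧ ‖ν₁‖ = 1 ∧ ‖ν₂‖ = 1 ∧
      ⟪x, ν₁⟫ = suppFun K ν₁ ∧ ⟪x, ν₂⟫ = suppFun K ν₂}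

lemma sing_null (hK : SymBody K) : (μH[(m : ℝ)] : Measure (Eu (m + 1))) (Sing K) = 0 := by
  have : Nonempty (sphere (0 : Eu (m + 1)) 1) := by
    refine ⟨⟨EuclideanSpace.single 0 1, by simp⟩⟩
  let d := TopologicalSpace.denseSeq (sphere (0 : Eu (m + 1)) 1)
  refine measure_mono_null (t := ⋃ (i : ℕ) (k : ℕ), {x | x ∈ K ∧ ∃ ν₁ ν₂ : Eu (m + 1), ν₁ ≠ ν₂ ∧ ‖ν₁‖ = 1 ∧ ‖ν₂‖ = 1 ∧
      ⟪x, ν₁⟫ = suppFun K ν₁ ∧ ⟪x, ν₂⟫ = suppFun K ν₂ ∧ 1 / ((k : ℝ) + 1) ≤ ⟪ν₁, (d i : Eu (m + 1))⟫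
        ∧ 1 / ((k : ℝ) + 1) ≤ ⟪ν₂, (d i : Eu (m + 1))⟫}) ?_ ?_
  · rintro x ⟨hx, ν₁, ν₂, hne, hn1, hn2, h1, h2⟩
    have hne' : ν₁ + ν₂ ≠ 0 := by
      intro h
      have : ν₂ = -ν₁ := eq_neg_of_add_eq_zero_right h
      rw [this, hK.suppFun_neg, inner_neg_right] at h2
      have := hK.suppFun_pos hn1
      linarith
    have hp : 0 < 1 + ⟪ν₁, ν₂⟫ := by
      have : 0 < ‖ν₁ + ν₂‖ ^ 2 := by have := norm_pos_iff.2 hne'; positivity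
      rw [@norm_add_sq_real, hn1, hn2] at this
      linarith
    have hN : 0 < ‖ν₁ + ν₂‖ := norm_pos_iff.2 hne'
    let O : Set (sphere (0 : Eu (m + 1)) 1) := {w | 0 < ⟪ν₁, (w : Eu (m + 1))⟫ ∧ 0 < ⟪ν₂, (w : Eu (m + 1))⟫}
    have hO : IsOpen O := by
      have c1 : ∀ ν : Eu (m + 1), Continuous fun w : sphere (0 : Eu (m + 1)) 1 => ⟪ν, (w : Eu (m + 1))⟫ :=
        fun ν => by fun_prop
      exact (isOpen_lt continuous_const (c1 ν₁)).inter (isOpen_lt continuous_const (c1 ν₂))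
    have hOne : O.Nonempty := by
      refine ⟨⟨‖ν₁ + ν₂‖⁻¹ • (ν₁ + ν₂), ?_⟩, ?_, ?_⟩
      · rw [mem_sphere_zero_iff_norm, norm_smul]; simp; field_simp
      · show 0 < ⟪ν₁, ‖ν₁ + ν₂‖⁻¹ • (ν₁ + ν₂)⟫
        rw [real_inner_smul_right, inner_add_right, real_inner_self_eq_norm_sq, hn1]
        have : 0 < (1:ℝ) ^ 2 + ⟪ν₁, ν₂⟫ := by linarith
        positivity
      · show 0 < ⟪ν₂, ‖ν₁ + ν₂‖⁻¹ • (ν₁ + ν₂)⟫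
        rw [real_inner_smul_right, inner_add_right, real_inner_self_eq_norm_sq, hn2, real_inner_comm]
        have : 0 < ⟪ν₁, ν₂⟫ + (1:ℝ) ^ 2 := by linarith
        positivity
    obtain ⟨i, hi1, hi2⟩ := (TopologicalSpace.denseRange_denseSeq _).exists_mem_open hO hOne
    obtain ⟨k, hk⟩ := exists_nat_one_div_lt (lt_min hi1 hi2)
    refine mem_iUnion₂.2 ⟨i, k, hx, ν₁, ν₂, hne, hn1, hn2, h1, h2, ?_, ?_⟩
    · exact (hk.trans_le (min_le_left _ _)).le
    · exact (hk.trans_le (min_le_right _ _)).le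
  · rw [measure_iUnion_null_iff]
    intro i
    rw [measure_iUnion_null_iff]
    intro k
    have hd : ‖(d i : Eu (m + 1))‖ = 1 := by simp
    obtain ⟨ι, hι⟩ := exists_frame hd
    exact uniq_aux hK hd hι (by positivity)

end geom

/-- Gaussian density -/
def rho (n : ℕ) (x : Eu n) : ℝ := (Real.sqrt (2 * Real.pi))⁻¹ ^ n * Real.exp (-‖x‖ ^ 2 / 2)

lemma rho_pos (n : ℕ) (x : Eu n) : 0 < rho n x := by unfold rho; positivity

lemma rho_cont (n : ℕ) : Continuous (rho n) := by unfold rho; fun_prop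

lemma rho_le (n : ℕ) (x : Eu n) : rho n x ≤ (Real.sqrt (2 * Real.pi))⁻¹ ^ n := by
  unfold rho
  have h : Real.exp (-‖x‖ ^ 2 / 2) ≤ 1 := by
    rw [Real.exp_le_one_iff]; have := sq_nonneg ‖x‖; linarith
  exact mul_le_of_le_one_right (by positivity) h

section geom
variable {m : ℕ} {K : Set (Eu (m + 1))} {v : Eu (m + 1)} {ι : Eu m →ₗᵢ[ℝ] Eu (m + 1)}

lemma goodN_of_close (hv : ‖v‖ = 1) (hι : ∀ y, ⟪ι y, v⟫ = 0) {x ν : Eu (m + 1)} {δ : ℝ}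
    (hx : x ∈ K) (hn : ⟪x, ν⟫ = suppFun K ν) (hd : ‖ν - v‖ ≤ δ) : GoodN K v ι δ (1 - δ) x := by
  refine ⟨hx, ν, hn, ?_, ?_⟩
  · have h1 := abs_le.1 (abs_real_inner_le_norm (ν - v) v)
    rw [inner_sub_left, real_inner_self_eq_norm_sq, hv] at h1
    linarith [h1.1]
  · have h : prj ι (ν - v) = prj ι ν := by rw [map_sub, prj_v hι, sub_zero]
    rw [← h]
    exact (norm_prj_le ι _).trans hd

lemma haus_finite (hK : SymBody K) : (μH[(m : ℝ)] : Measure (Eu (m + 1))) (frontier K) < ∞ := by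
  obtain ⟨t, ht, htf, hcov⟩ := finite_cover_balls_of_compact
    (isCompact_sphere (0 : Eu (m + 1)) 1) (show (0:ℝ) < 1 / 2 by norm_num)
  obtain ⟨R, hR0, hR⟩ := hK.exists_R
  have hsub : frontier K ⊆ ⋃ w ∈ t, NI K (closedBall w (1/2)) := by
    intro x hx
    obtain ⟨ν, h1, h2⟩ := hK.exists_normal hx
    obtain ⟨w, hw, hw2⟩ := mem_iUnion₂.1 (hcov (show ν ∈ sphere 0 1 by simpa using h1))
    exact mem_iUnion₂.2 ⟨w, hw, hx, ν, ball_subset_closedBall hw2, h2⟩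
  refine (measure_mono hsub).trans_lt (measure_biUnion_lt_top htf fun w hw => ?_)
  have hw1 : ‖w‖ = 1 := by simpa using ht hw
  obtain ⟨ι, hι⟩ := exists_frame hw1
  refine (haus_le hK hw1 hι (b := 1/2) (c := 1 - 1/2) (by norm_num) ?_).trans_lt ?_
  · rintro x ⟨hx, ν, h1, h2⟩
    exact goodN_of_close hw1 hι (hK.frontier_sub hx) h2 (by simpa [dist_eq_norm] using h1)
  · refine ENNReal.mul_lt_top (by simp) ?_
    have : prj ι '' NI K (closedBall w (1/2)) ⊆ closedBall 0 R := by
      rintro _ ⟨x, hx, rfl⟩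
      have h1 : ‖x‖ ≤ R := by simpa using hR (hK.frontier_sub hx.1)
      simpa using (norm_prj_le ι x).trans h1
    exact (measure_mono this).trans_lt (isCompact_closedBall _ _).measure_lt_top

/-- regular boundary points -/
def Reg (K : Set (Eu (m + 1))) : Set (Eu (m + 1)) :=
  frontier K \ toMeasurable (μH[(m : ℝ)] : Measure (Eu (m + 1))) (Sing K)

lemma measurableSet_Reg : MeasurableSet (Reg K) :=
  isClosed_frontier.measurableSet.diff (measurableSet_toMeasurable _ _)

/-- measurable Gauss map -/
def nu (K : Set (Eu (m + 1))) : Eu (m + 1) → Eu (m + 1) := (Reg K).indicator (gaussMap K)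

lemma nu_spec (hK : SymBody K) {x : Eu (m + 1)} (hx : x ∈ Reg K) :
    ‖nu K x‖ = 1 ∧ ⟪x, nu K x⟫ = suppFun K (nu K x) := by
  unfold nu
  rw [indicator_of_mem hx]
  have h := hK.exists_normal hx.1
  unfold gaussMap
  rw [dif_pos h]
  exact h.choose_spec

lemma nu_unique (hK : SymBody K) {x ν : Eu (m + 1)} (hx : x ∈ Reg K) (h1 : ‖ν‖ = 1)
    (h2 : ⟪x, ν⟫ = suppFun K ν) : ν = nu K x := by
  by_contra hne
  obtain ⟨h3, h4⟩ := nu_spec hK hx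
  exact hx.2 (subset_toMeasurable _ _ ⟨hK.frontier_sub hx.1, ν, nu K x, hne, h1, h3, h2, h4⟩)

lemma nu_preimage (hK : SymBody K) (η : Set (Eu (m + 1))) (hη : η ⊆ sphere 0 1) :
    nu K ⁻¹' η ∩ Reg K = NI K η ∩ Reg K := by
  ext x
  constructor
  · rintro ⟨h1, h2⟩
    exact ⟨⟨h2.1, nu K x, h1, (nu_spec hK h2).2⟩, h2⟩
  · rintro ⟨⟨h1, ν, h2, h3⟩, h4⟩
    have : ν = nu K x := nu_unique hK h4 (by simpa using hη h2) h3
    exact ⟨by rw [mem_preimage, ← this]; exact h2, h4⟩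

lemma measurable_nu (hK : SymBody K) : Measurable (nu K) := by
  refine measurable_of_isClosed fun η hη => ?_
  have h1 : nu K ⁻¹' η = (nu K ⁻¹' (η ∩ sphere 0 1) ∩ Reg K) ∪ (nu K ⁻¹' η ∩ (Reg K)ᶜ) := by
    ext x
    by_cases hx : x ∈ Reg K
    · have := (nu_spec hK hx).1
      simp [hx, this]
    · simp [hx]
  rw [h1, nu_preimage hK _ inter_subset_right]
  refine MeasurableSet.union ?_ ?_
  · exact (hK.isClosed_NI ((isCompact_sphere 0 1).inter_left hη)).measurableSet.inter measurableSet_Reg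
  · by_cases h0 : (0 : Eu (m + 1)) ∈ η
    · convert! measurableSet_Reg.compl (s := Reg K) using 1
      ext x
      simp only [mem_inter_iff, mem_preimage, mem_compl_iff, and_iff_right_iff_imp]
      intro hx
      rw [nu, indicator_of_notMem hx]; exact h0
    · convert! MeasurableSet.empty using 1
      ext x
      simp only [mem_inter_iff, mem_preimage, mem_compl_iff, mem_empty_iff_false, iff_false, not_and, not_not]
      intro h
      by_contra hx
      rw [nu, indicator_of_notMem hx] at h; exact h0 h

lemma reg_null (hK : SymBody K) :
    (μH[(m : ℝ)] : Measure (Eu (m + 1))) (frontier K \ Reg K) = 0 := by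
  refine measure_mono_null (t := toMeasurable (μH[(m : ℝ)] : Measure (Eu (m + 1))) (Sing K)) ?_ ?_
  · rintro x ⟨h1, h2⟩
    by_contra h
    exact h2 ⟨h1, h⟩
  · rw [measure_toMeasurable, sing_null hK]

/-- Hausdorff measure on the regular part of the boundary -/
def HK (K : Set (Eu (m + 1))) : Measure (Eu (m + 1)) :=
  (μH[(m : ℝ)] : Measure (Eu (m + 1))).restrict (Reg K)

lemma HK_finite (hK : SymBody K) : IsFiniteMeasure (HK K) := by
  refine ⟨?_⟩
  unfold HK
  rw [Measure.restrict_apply MeasurableSet.univ, univ_inter]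
  exact (measure_mono diff_subset).trans_lt (haus_finite hK)

/-- Gauss measure on the boundary -/
def sigK (K : Set (Eu (m + 1))) : Measure (Eu (m + 1)) :=
  (HK K).withDensity fun x => ENNReal.ofReal (rho (m + 1) x)

lemma sigK_finite (hK : SymBody K) : IsFiniteMeasure (sigK K) := by
  have := HK_finite hK
  refine isFiniteMeasure_withDensity ?_
  refine ((lintegral_mono fun x => ENNReal.ofReal_le_ofReal (rho_le _ x)).trans_lt ?_).ne
  rw [lintegral_const]
  exact ENNReal.mul_lt_top ENNReal.ofReal_lt_top (measure_lt_top _ _)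

/-- Gaussian surface area measure as a measure -/
def TK (K : Set (Eu (m + 1))) : Measure (Eu (m + 1)) := (sigK K).map (nu K)

lemma gaussSurf_eq (hK : SymBody K) {η : Set (Eu (m + 1))} (hη : η ⊆ sphere 0 1)
    (hm : MeasurableSet η) : gaussSurf (m + 1) K η = (TK K η).toReal := by
  have hfin := HK_finite hK
  unfold TK
  rw [Measure.map_apply (measurable_nu hK) hm]
  unfold sigK
  rw [withDensity_apply _ (measurable_nu hK hm)]
  unfold HK
  rw [Measure.restrict_restrict (measurable_nu hK hm), nu_preimage hK η hη]
  have hd : (((m + 1 : ℕ) : ℝ) - 1) = m := by push_cast; ring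
  have hs : (NI K η : Set _) =ᵐ[(μH[(m : ℝ)] : Measure (Eu (m + 1)))] (NI K η ∩ Reg K : Set _) := by
    refine Filter.EventuallyEq.symm ?_
    refine ae_eq_set.2 ⟨?_, ?_⟩
    · rw [diff_eq_empty.2 inter_subset_left, measure_empty]
    · refine measure_mono_null ?_ (reg_null hK)
      rintro x ⟨h1, h2⟩
      exact ⟨h1.1, fun h => h2 ⟨h1, h⟩⟩
  unfold gaussSurf
  rw [hd]
  change _ * ∫ x in NI K η, _ ∂_ = _
  rw [setIntegral_congr_set hs, ← integral_const_mul]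
  rw [integral_eq_lintegral_of_nonneg_ae]
  · rfl
  · exact Eventually.of_forall fun x => (rho_pos (m + 1) x).le
  · exact (rho_cont (m + 1)).aestronglyMeasurable

end geom

/-- Gaussian measure -/
def gam (n : ℕ) : Measure (Eu n) := volume.withDensity fun x => ENNReal.ofReal (rho n x)

lemma rho_integrable (n : ℕ) : Integrable (rho n) := by
  have h := GaussianFourier.integrable_cexp_neg_mul_sq_norm_add (V := Eu n) (b := (1/2 : ℂ))
    (by norm_num) 0 0
  have h2 := h.norm
  unfold rho
  refine Integrable.const_mul (h2.congr (ae_of_all _ fun x => ?_)) _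
  simp only [Complex.norm_exp]
  congr 1
  norm_num
  rw [← Complex.ofReal_pow, Complex.ofReal_re]; ring

instance gam_finite (n : ℕ) : IsFiniteMeasure (gam n) := by
  refine ⟨?_⟩
  rw [gam, withDensity_apply _ MeasurableSet.univ, Measure.restrict_univ]
  exact (rho_integrable n).lintegral_lt_top

lemma gaussVol_eq {n : ℕ} {A : Set (Eu n)} (hA : MeasurableSet A) :
    gaussVol n A = (gam n A).toReal := by
  rw [gam, withDensity_apply _ hA, ← integral_eq_lintegral_of_nonneg_ae
    (ae_of_all _ fun x => (rho_pos n x).le) (rho_cont n).aestronglyMeasurable]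
  unfold gaussVol rho
  rw [integral_const_mul]

section max
variable {n : ℕ} {μ : Measure (Eu n)}

lemma ae_sph (hsph : μ (sphere (0 : Eu n) 1)ᶜ = 0) : ∀ᵐ v ∂μ, ‖v‖ = 1 := by
  have : ∀ᵐ v ∂μ, v ∈ sphere (0 : Eu n) 1 := hsph
  filter_upwards [this] with v hv using by simpa using hv

lemma supp_abs_le {K : Set (Eu n)} (hK : IsCompact K) (hne : K.Nonempty) {R : ℝ}
    (hR : K ⊆ closedBall 0 R) (v : Eu n) : |suppFun K v| ≤ R * ‖v‖ := by
  obtain ⟨x, hx⟩ := hne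
  have hb : ∀ y ∈ K, |⟪y, v⟫| ≤ R * ‖v‖ := fun y hy =>
    (abs_real_inner_le_norm y v).trans
      (mul_le_mul_of_nonneg_right (by simpa using hR hy) (norm_nonneg _))
  rw [abs_le]
  refine ⟨(abs_le.1 (hb x hx)).1.trans (le_suppFun hK hx v), suppFun_le ⟨x, hx⟩ fun y hy =>
    (abs_le.1 (hb y hy)).2⟩

lemma int_supp [IsFiniteMeasure μ] (hsph : μ (sphere (0 : Eu n) 1)ᶜ = 0) {K : Set (Eu n)}
    (hK : IsCompact K) (hne : K.Nonempty) : Integrable (suppFun K) μ := by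
  obtain ⟨R, hR⟩ := hK.isBounded.subset_closedBall 0
  refine Integrable.of_bound (suppFun_continuous hK hne).aestronglyMeasurable R ?_
  filter_upwards [ae_sph hsph] with v hv
  have := supp_abs_le hK hne hR v
  rwa [hv, mul_one] at this

lemma exists_c0 [IsFiniteMeasure μ] (hsph : μ (sphere (0 : Eu n) 1)ᶜ = 0)
    (hhemi : ∀ u : Eu n, ‖u‖ = 1 → 0 < ∫ v, max ⟪u, v⟫ 0 ∂μ) :
    ∃ c : ℝ, 0 < c ∧ ∀ u : Eu n, c * ‖u‖ ≤ ∫ v, max ⟪u, v⟫ 0 ∂μ := by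
  have hcont : ContinuousOn (fun u : Eu n => ∫ v, max ⟪u, v⟫ 0 ∂μ) (sphere 0 1) := by
    refine continuousOn_of_dominated (bound := fun _ => 1) ?_ ?_ (integrable_const _) ?_
    · intro u _
      exact (by fun_prop : Continuous fun v : Eu n => max ⟪u, v⟫ 0).aestronglyMeasurable
    · intro u hu
      filter_upwards [ae_sph hsph] with v hv
      have hu1 : ‖u‖ = 1 := by simpa using hu
      have := real_inner_le_norm u v
      rw [hu1, hv] at this
      rw [Real.norm_of_nonneg (le_max_right _ _)]
      exact max_le (by linarith) zero_le_one
    · exact ae_of_all _ fun v => by fun_prop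
  have hsc : ∃ c : ℝ, 0 < c ∧ ∀ u : Eu n, ‖u‖ = 1 → c ≤ ∫ v, max ⟪u, v⟫ 0 ∂μ := by
    rcases (sphere (0 : Eu n) 1).eq_empty_or_nonempty with h | h
    · refine ⟨1, one_pos, fun u hu => ?_⟩
      have : u ∈ sphere (0 : Eu n) 1 := by simpa using hu
      rw [h] at this; exact this.elim
    · obtain ⟨u0, h0, hmin⟩ := (isCompact_sphere (0 : Eu n) 1).exists_isMinOn h hcont
      exact ⟨_, hhemi u0 (by simpa using h0), fun u hu => hmin (by simpa using hu)⟩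
  obtain ⟨c, hc, h⟩ := hsc
  refine ⟨c, hc, fun u => ?_⟩
  rcases eq_or_ne u 0 with rfl | hu
  · simp
  have hn := norm_pos_iff.2 hu
  have h1 := h (‖u‖⁻¹ • u) (by rw [norm_smul]; simp; field_simp)
  have h2 : ∀ v, max ⟪‖u‖⁻¹ • u, v⟫ 0 = ‖u‖⁻¹ * max ⟪u, v⟫ 0 := fun v => by
    rw [real_inner_smul_left, mul_max_of_nonneg _ _ (by positivity), mul_zero]
  simp_rw [h2] at h1
  rw [integral_const_mul] at h1
  rw [← div_eq_inv_mul, le_div_iff₀ hn] at h1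
  exact h1

/-- symmetrisation of a compact set in a ball -/
def SC {R : ℝ} (C : TopologicalSpace.NonemptyCompacts (closedBall (0 : Eu n) R)) : Set (Eu n) :=
  (Subtype.val '' (C : Set (closedBall (0 : Eu n) R))) ∪
    -(Subtype.val '' (C : Set (closedBall (0 : Eu n) R)))

variable {R : ℝ} (C D : TopologicalSpace.NonemptyCompacts (closedBall (0 : Eu n) R))

lemma SC_cpt : IsCompact (SC C) :=
  (C.isCompact.image continuous_subtype_val).union (C.isCompact.image continuous_subtype_val).neg

lemma SC_ne : (SC C).Nonempty := (C.nonempty.image _).inl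

lemma SC_sub : SC C ⊆ closedBall 0 R := by
  rintro x (⟨y, hy, rfl⟩ | ⟨y, hy, h⟩)
  · exact y.2
  · have : x = -(y : Eu n) := by rw [h]; simp
    have hy2 := y.2
    rw [mem_closedBall, dist_zero_right] at hy2 ⊢
    rw [this, norm_neg]; exact hy2

lemma SC_neg (v : Eu n) : suppFun (SC C) (-v) = suppFun (SC C) v := by
  have key : ∀ v, suppFun (SC C) (-v) ≤ suppFun (SC C) v := fun v =>
    suppFun_le (SC_ne C) fun x hx => by
      have h1 : -x ∈ SC C := by
        rcases hx with h | h
        · exact Or.inr (by simpa using h)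
        · exact Or.inl h
      simpa using le_suppFun (SC_cpt C) h1 v
  refine le_antisymm (key v) ?_
  simpa using key (-v)

lemma SC_dist {ε : ℝ} (h : dist C D < ε) (v : Eu n) :
    suppFun (SC C) v ≤ suppFun (SC D) v + ε * ‖v‖ := by
  have key : ∀ x ∈ C, ∃ y ∈ D, dist x y < ε := fun x hx =>
    Metric.exists_dist_lt_of_hausdorffDist_lt (s := (C : Set (closedBall (0 : Eu n) R)))
      (t := (D : Set (closedBall (0 : Eu n) R))) hx h
      (Metric.hausdorffEDist_ne_top_of_nonempty_of_bounded C.nonempty D.nonempty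
        C.isCompact.isBounded D.isCompact.isBounded)
  refine suppFun_le (SC_ne C) fun x hx => ?_
  have key2 : ∃ y ∈ SC D, ‖x - y‖ ≤ ε := by
    rcases hx with ⟨z, hz, rfl⟩ | ⟨z, hz, h⟩
    · obtain ⟨y, hy, hyd⟩ := key z hz
      exact ⟨y, Or.inl ⟨y, hy, rfl⟩, by rw [← dist_eq_norm]; exact hyd.le⟩
    · obtain ⟨y, hy, hyd⟩ := key z hz
      refine ⟨-y, Or.inr ⟨y, hy, by simp⟩, ?_⟩
      have : x = -(z : Eu n) := by rw [h]; simp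
      rw [this, ← dist_eq_norm, dist_neg_neg]; exact hyd.le
  obtain ⟨y, hy, hxy⟩ := key2
  have h1 := le_suppFun (SC_cpt D) hy v
  have h2 := real_inner_le_norm (x - y) v
  rw [inner_sub_left] at h2
  have := mul_le_mul_of_nonneg_right hxy (norm_nonneg v)
  linarith

/-- enlarged hull -/
def HatE (ε : ℝ) : Set (Eu n) := {x | ∀ v, ⟪x, v⟫ ≤ suppFun (SC C) v + ε * ‖v‖}

lemma HatE_closed (ε : ℝ) : IsClosed (HatE C ε) := by
  have : HatE C ε = ⋂ v, {x | ⟪x, v⟫ ≤ suppFun (SC C) v + ε * ‖v‖} := by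
    ext x; simp [HatE]
  rw [this]
  exact isClosed_iInter fun v => isClosed_le (by fun_prop) continuous_const

lemma HatE_convex (ε : ℝ) : Convex ℝ (HatE C ε) := by
  intro x hx y hy a b ha hb hab v
  rw [inner_add_left, real_inner_smul_left, real_inner_smul_left]
  have h1 := mul_le_mul_of_nonneg_left (hx v) ha
  have h2 := mul_le_mul_of_nonneg_left (hy v) hb
  calc _ ≤ a * (suppFun (SC C) v + ε * ‖v‖) + b * (suppFun (SC C) v + ε * ‖v‖) := add_le_add h1 h2
    _ = _ := by rw [← add_mul, hab, one_mul]

lemma HatE_sym (ε : ℝ) {x : Eu n} (hx : x ∈ HatE C ε) : -x ∈ HatE C ε := by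
  intro v
  have := hx (-v)
  rw [SC_neg] at this
  simpa using this

lemma Hat_sub : HatE C 0 ⊆ closedBall 0 R := by
  intro x hx
  have h1 := hx x
  rw [real_inner_self_eq_norm_sq, zero_mul, add_zero] at h1
  have h2 := (abs_le.1 (supp_abs_le (SC_cpt C) (SC_ne C) (SC_sub C) x)).2
  rw [mem_closedBall, dist_zero_right]
  by_contra hlt
  push Not at hlt
  have hR0 : 0 ≤ R := by
    obtain ⟨y, hy⟩ := SC_ne C
    have := SC_sub C hy
    rw [mem_closedBall, dist_zero_right] at this
    exact (norm_nonneg _).trans this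
  nlinarith

lemma SC_subset_Hat : SC C ⊆ HatE C 0 := fun x hx v => by
  simpa using le_suppFun (SC_cpt C) hx v

lemma Hat_cpt : IsCompact (HatE C 0) :=
  (isCompact_closedBall 0 R).of_isClosed_subset (HatE_closed C 0) (Hat_sub C)

lemma supp_Hat (v : Eu n) : suppFun (HatE C 0) v ≤ suppFun (SC C) v :=
  suppFun_le ((SC_ne C).mono (SC_subset_Hat C)) fun x hx => by simpa using hx v

lemma usc_gam : UpperSemicontinuous
    fun C : TopologicalSpace.NonemptyCompacts (closedBall (0 : Eu n) R) =>
      (gam n (HatE C 0)).toReal := by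
  intro C y hy
  have hanti : Antitone fun k : ℕ => HatE C (1 / ((k : ℝ) + 1)) := by
    intro a b hab x hx v
    refine (hx v).trans ?_
    have : 1 / ((b : ℝ) + 1) ≤ 1 / ((a : ℝ) + 1) := by gcongr
    have := mul_le_mul_of_nonneg_right this (norm_nonneg v)
    linarith
  have hintg : ⋂ k : ℕ, HatE C (1 / ((k : ℝ) + 1)) = HatE C 0 := by
    ext x
    simp only [mem_iInter]
    constructor
    · intro h v
      have ht : Tendsto (fun k : ℕ => suppFun (SC C) v + 1 / ((k : ℝ) + 1) * ‖v‖) atTop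
          (𝓝 (suppFun (SC C) v + 0 * ‖v‖)) :=
        (tendsto_one_div_add_atTop_nhds_zero_nat.mul_const _).const_add _
      exact ge_of_tendsto' ht fun k => h k v
    · intro h k v
      refine (h v).trans ?_
      have : 0 ≤ 1 / ((k : ℝ) + 1) * ‖v‖ := by positivity
      linarith
  have ht := tendsto_measure_iInter_atTop (μ := gam n)
    (fun k : ℕ => (HatE_closed C (1 / ((k : ℝ) + 1))).measurableSet.nullMeasurableSet) hanti
    ⟨0, measure_ne_top _ _⟩
  rw [hintg] at ht
  have ht2 := (ENNReal.tendsto_toReal (measure_ne_top (gam n) (HatE C 0))).comp ht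
  obtain ⟨k, hk⟩ := (ht2.eventually (gt_mem_nhds hy)).exists
  have hk0 : 0 < 1 / ((k : ℝ) + 1) := by positivity
  filter_upwards [Metric.ball_mem_nhds C hk0] with D hD
  refine lt_of_le_of_lt ?_ hk
  refine ENNReal.toReal_mono (measure_ne_top _ _) (measure_mono fun x hx v => ?_)
  have h1 := hx v
  rw [zero_mul, add_zero] at h1
  exact h1.trans (SC_dist D C hD v)

lemma cont_int [IsFiniteMeasure μ] (hsph : μ (sphere (0 : Eu n) 1)ᶜ = 0) : Continuous
    fun C : TopologicalSpace.NonemptyCompacts (closedBall (0 : Eu n) R) =>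
      ∫ v, suppFun (SC C) v ∂μ := by
  rw [Metric.continuous_iff]
  intro C ε hε
  set M := μ.real univ with hM
  have hM0 : 0 ≤ M := measureReal_nonneg
  refine ⟨ε / (M + 1), by positivity, fun D hD => ?_⟩
  rw [Real.dist_eq, ← integral_sub (int_supp hsph (SC_cpt D) (SC_ne D))
    (int_supp hsph (SC_cpt C) (SC_ne C)), ← Real.norm_eq_abs]
  have : ∀ᵐ v ∂μ, ‖suppFun (SC D) v - suppFun (SC C) v‖ ≤ ε / (M + 1) := by
    filter_upwards [ae_sph hsph] with v hv
    have h1 := SC_dist D C hD v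
    have h2 := SC_dist C D (by rwa [dist_comm]) v
    rw [hv] at h1 h2
    rw [Real.norm_eq_abs, abs_le]
    constructor <;> linarith
  refine (norm_integral_le_of_norm_le_const this).trans_lt ?_
  rw [div_mul_eq_mul_div, div_lt_iff₀ (by positivity)]
  nlinarith

end max

section max
variable {n : ℕ} {μ : Measure (Eu n)}

lemma gam_ball_lower (n : ℕ) : ∃ c : ℝ, 0 < c ∧ ∀ r : ℝ, 0 < r → r ≤ 1 →
    c * r ^ n ≤ (gam n (closedBall 0 r)).toReal := by
  set c1 : ℝ := (Real.sqrt (2 * Real.pi))⁻¹ ^ n * Real.exp (-1 / 2) with hc1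
  have hc1p : 0 < c1 := by positivity
  set w := (volume (ball (0 : Eu n) 1)).toReal with hw
  have hwp : 0 < w := ENNReal.toReal_pos (measure_ball_pos _ _ one_pos).ne' measure_ball_lt_top.ne
  refine ⟨c1 * w, by positivity, fun r hr hr1 => ?_⟩
  have h1 : ENNReal.ofReal c1 * volume (closedBall (0 : Eu n) r) ≤ gam n (closedBall 0 r) := by
    rw [gam, withDensity_apply _ isClosed_closedBall.measurableSet, ← setLIntegral_const]
    refine setLIntegral_mono ((rho_cont n).measurable.ennreal_ofReal) fun x hx => ?_
    refine ENNReal.ofReal_le_ofReal ?_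
    rw [mem_closedBall, dist_zero_right] at hx
    unfold rho
    rw [hc1]
    gcongr
    have := norm_nonneg x
    nlinarith
  have h2 := ENNReal.toReal_mono (measure_ne_top _ _) h1
  rw [ENNReal.toReal_mul, ENNReal.toReal_ofReal hc1p.le,
    Measure.addHaar_closedBall _ _ hr.le, ENNReal.toReal_mul,
    ENNReal.toReal_ofReal (by positivity)] at h2
  simp only [finrank_euclideanSpace, Fintype.card_fin] at h2
  calc c1 * w * r ^ n = c1 * (r ^ n * w) := by ring
    _ ≤ _ := h2

lemma exists_good_r {α κ c M : ℝ} (hn : 0 < n) (hα : 0 < α) (hαn : α < 1 / n) (hκ : 0 < κ) (hc : 0 < c)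
    (hM : 0 ≤ M) : ∃ r : ℝ, 0 < r ∧ r ≤ 1 ∧ r * M < κ / α * (c * r ^ n) ^ α := by
  have hn0 : (0:ℝ) < n := by exact_mod_cast hn
  have hs : 0 < 1 - n * α := by
    rw [lt_div_iff₀ hn0] at hαn; linarith
  have ht : Tendsto (fun r : ℝ => r ^ (1 - n * α)) (𝓝[>] 0) (𝓝 0) := by
    have := (Real.continuousAt_rpow_const 0 (1 - n * α) (Or.inr hs.le)).tendsto
    rw [Real.zero_rpow hs.ne'] at this
    exact this.mono_left nhdsWithin_le_nhds
  have hb : 0 < κ / α * c ^ α / (M + 1) := by positivity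
  have e1 := ht.eventually (gt_mem_nhds hb)
  have e2 : ∀ᶠ r : ℝ in 𝓝[>] 0, r < 1 := nhdsWithin_le_nhds (gt_mem_nhds one_pos)
  obtain ⟨r, ⟨h1, h2⟩, hr⟩ := ((e1.and e2).and self_mem_nhdsWithin).exists
  have hr0 : 0 < r := hr
  refine ⟨r, hr0, h2.le, ?_⟩
  rw [lt_div_iff₀ (by positivity)] at h1
  have h3 : (c * r ^ n) ^ α = c ^ α * r ^ ((n:ℝ) * α) := by
    rw [Real.mul_rpow hc.le (by positivity), Real.rpow_mul hr0.le, Real.rpow_natCast]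
  have h4 : r = r ^ (1 - n * α) * r ^ ((n:ℝ) * α) := by
    rw [← Real.rpow_add hr0]; simp
  have hp : 0 < r ^ ((n:ℝ) * α) := by positivity
  have hq : 0 < r ^ (1 - n * α) := by positivity
  rw [h3]
  calc r * M ≤ r * (M + 1) := by nlinarith
    _ = (r ^ (1 - n * α) * (M + 1)) * r ^ ((n:ℝ) * α) := by nth_rw 1 [h4]; ring
    _ < (κ / α * c ^ α) * r ^ ((n:ℝ) * α) := by gcongr
    _ = _ := by ring

lemma exists_max [IsFiniteMeasure μ] (hn : 0 < n) {α κ : ℝ} (hα : 0 < α) (hαn : α < 1 / n)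
    (hκ : 0 < κ) (hsph : μ (sphere (0 : Eu n) 1)ᶜ = 0)
    (hhemi : ∀ u : Eu n, ‖u‖ = 1 → 0 < ∫ v, max ⟪u, v⟫ 0 ∂μ) :
    ∃ K : Set (Eu n), SymBody K ∧ 0 < (gam n K).toReal ∧
      ∀ K' : Set (Eu n), IsCompact K' → (∀ x ∈ K', -x ∈ K') → K'.Nonempty →
      κ / α * (gam n K').toReal ^ α - ∫ v, suppFun K' v ∂μ ≤
      κ / α * (gam n K).toReal ^ α - ∫ v, suppFun K v ∂μ := by
  obtain ⟨c0, hc0, hc⟩ := exists_c0 hsph hhemi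
  set M := (gam n univ).toReal with hM
  set R := κ / α * M ^ α / c0 + 1 with hR
  have hM0 : 0 ≤ M := ENNReal.toReal_nonneg
  have hR1 : 1 ≤ R := by
    have : 0 ≤ κ / α * M ^ α / c0 := by positivity
    linarith
  have : CompactSpace (closedBall (0 : Eu n) R) := isCompact_iff_compactSpace.1 (isCompact_closedBall _ _)
  let G : TopologicalSpace.NonemptyCompacts (closedBall (0 : Eu n) R) → ℝ := fun C =>
    κ / α * (max (gam n (HatE C 0)).toReal 0) ^ α + -∫ v, suppFun (SC C) v ∂μ
  have hG : UpperSemicontinuous G := by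
    refine UpperSemicontinuous.add ?_ (cont_int hsph).neg.upperSemicontinuous
    refine Continuous.comp_upperSemicontinuous (g := fun x : ℝ => κ / α * (max x 0) ^ α) ?_ usc_gam ?_
    · exact continuous_const.mul
        ((Continuous.rpow_const (by fun_prop) fun _ => Or.inr hα.le))
    · intro a b hab
      dsimp only
      gcongr
  -- comparing
  have key : ∀ (K' : Set (Eu n)) (hc' : IsCompact K') (hs' : ∀ x ∈ K', -x ∈ K') (hne : K'.Nonempty)
      (hsub : K' ⊆ closedBall 0 R), ∃ C : TopologicalSpace.NonemptyCompacts (closedBall (0 : Eu n) R),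
      κ / α * (gam n K').toReal ^ α - ∫ v, suppFun K' v ∂μ ≤ G C := by
    intro K' hc' hs' hne hsub
    let C : TopologicalSpace.NonemptyCompacts (closedBall (0 : Eu n) R) :=
      ⟨⟨Subtype.val ⁻¹' K', (isClosed_closedBall.isClosedEmbedding_subtypeVal).isCompact_preimage hc'⟩,
        by obtain ⟨x, hx⟩ := hne; exact ⟨⟨x, hsub hx⟩, hx⟩⟩
    have hSC : SC C = K' := by
      have h1 : Subtype.val '' (C : Set (closedBall (0 : Eu n) R)) = K' := by
        change Subtype.val '' (Subtype.val ⁻¹' K') = K'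
        rw [Subtype.image_preimage_coe, inter_eq_right.2 hsub]
      unfold SC
      rw [h1, union_eq_left]
      intro x hx
      simpa using hs' _ hx
    refine ⟨C, ?_⟩
    simp only [G]
    rw [hSC, ← sub_eq_add_neg, max_eq_left ENNReal.toReal_nonneg]
    have : (gam n K').toReal ≤ (gam n (HatE C 0)).toReal :=
      ENNReal.toReal_mono (measure_ne_top _ _) (measure_mono (hSC ▸ SC_subset_Hat C))
    gcongr
  have hne : (univ : Set (TopologicalSpace.NonemptyCompacts (closedBall (0 : Eu n) R))).Nonempty := by
    obtain ⟨C, _⟩ := key {0} isCompact_singleton (by simp) (by simp) (by simp; linarith)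
    exact ⟨C, trivial⟩
  obtain ⟨C, -, hC⟩ := (hG.upperSemicontinuousOn univ).exists_isMaxOn hne isCompact_univ
  have hC : ∀ D, G D ≤ G C := fun D => hC (mem_univ D)
  have hGK : G C ≤ κ / α * (gam n (HatE C 0)).toReal ^ α - ∫ v, suppFun (HatE C 0) v ∂μ := by
    simp only [G]
    rw [← sub_eq_add_neg, max_eq_left ENNReal.toReal_nonneg]
    have := integral_mono (int_supp hsph (Hat_cpt C) ((SC_ne C).mono (SC_subset_Hat C)))
      (int_supp hsph (SC_cpt C) (SC_ne C)) (supp_Hat C)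
    linarith
  -- positivity
  obtain ⟨c, hcp, hcb⟩ := gam_ball_lower n
  obtain ⟨r, hr, hr1, hrM⟩ := exists_good_r hn hα hαn hκ hcp (M := μ.real univ) measureReal_nonneg
  have hGpos : 0 < G C := by
    obtain ⟨D, hD⟩ := key (closedBall 0 r) (isCompact_closedBall _ _) (by simp) ⟨0, by simp [hr.le]⟩
      (closedBall_subset_closedBall (by linarith))
    refine lt_of_lt_of_le ?_ (hD.trans (hC D))
    have h1 : ∫ v, suppFun (closedBall 0 r) v ∂μ ≤ r * μ.real univ := by
      refine (Real.le_norm_self _).trans (norm_integral_le_of_norm_le_const ?_)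
      filter_upwards [ae_sph hsph] with v hv
      have := supp_abs_le (isCompact_closedBall (0 : Eu n) r) ⟨0, by simp [hr.le]⟩ subset_rfl v
      rwa [hv, mul_one] at this
    have h2 : (c * r ^ n) ^ α ≤ (gam n (closedBall 0 r)).toReal ^ α := by
      gcongr
      exact hcb r hr hr1
    have h3 : κ / α * (c * r ^ n) ^ α ≤ κ / α * (gam n (closedBall 0 r)).toReal ^ α := by gcongr
    linarith
  have hsm : (0:Eu n) ∈ HatE C 0 := by
    obtain ⟨x, hx⟩ := (SC_ne C).mono (SC_subset_Hat C)
    have := HatE_convex C 0 hx (HatE_sym C 0 hx) (a := 1/2) (b := 1/2) (by norm_num) (by norm_num) (by norm_num)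
    simpa using this
  have hIpos : 0 ≤ ∫ v, suppFun (HatE C 0) v ∂μ := integral_nonneg fun v => by
    simpa using le_suppFun (Hat_cpt C) hsm v
  have hgpos : 0 < (gam n (HatE C 0)).toReal := by
    refine lt_of_le_of_ne ENNReal.toReal_nonneg fun h0 => ?_
    rw [← h0, Real.zero_rpow hα.ne'] at hGK
    linarith
  refine ⟨HatE C 0, ⟨HatE_convex C 0, Hat_cpt C, fun x hx => HatE_sym C 0 hx, ?_⟩, hgpos, ?_⟩
  · have hi : (interior (HatE C 0)).Nonempty := by
      by_contra hem
      rw [not_nonempty_iff_eq_empty] at hem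
      have h1 := (HatE_convex C 0).addHaar_frontier (volume : Measure (Eu n))
      rw [frontier, hem, sdiff_empty, (HatE_closed C 0).closure_eq] at h1
      have : gam n (HatE C 0) = 0 := withDensity_absolutelyContinuous _ _ h1
      rw [this] at hgpos
      simp at hgpos
    obtain ⟨x, hx⟩ := hi
    have h1 := (HatE_convex C 0).combo_interior_self_mem_interior hx
      (HatE_sym C 0 (interior_subset hx)) (a := 1/2) (b := 1/2) (by norm_num) (by norm_num) (by norm_num)
    simpa using h1
  · intro K' hc' hs' hne'
    by_cases hsub : K' ⊆ closedBall 0 R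
    · obtain ⟨D, hD⟩ := key K' hc' hs' hne' hsub
      exact (hD.trans (hC D)).trans hGK
    · rw [not_subset] at hsub
      obtain ⟨x, hx, hxR⟩ := hsub
      rw [mem_closedBall, dist_zero_right, not_le] at hxR
      have h1 : ∫ v, max ⟪x, v⟫ 0 ∂μ ≤ ∫ v, suppFun K' v ∂μ := by
        refine integral_mono_of_nonneg (ae_of_all _ fun v => le_max_right _ _)
          (int_supp hsph hc' hne') (ae_of_all _ fun v => ?_)
        have e1 := le_suppFun hc' hx v
        have e2 := le_suppFun hc' (hs' x hx) v
        rw [inner_neg_left] at e2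
        exact max_le e1 (by linarith)
      have h2 := hc x
      have h3 : (gam n K').toReal ^ α ≤ M ^ α := by
        have h3' : (gam n K').toReal ≤ M :=
          ENNReal.toReal_mono (measure_ne_top (gam n) _) (measure_mono (subset_univ _))
        gcongr
      have h4 : κ / α * (gam n K').toReal ^ α ≤ κ / α * M ^ α := by gcongr
      have h5 : c0 * R = κ / α * M ^ α + c0 := by rw [hR]; field_simp
      have h6 : c0 * R ≤ c0 * ‖x‖ := by gcongr
      linarith

end max

lemma gam_neg {n : ℕ} {A : Set (Eu n)} (hA : MeasurableSet A) : gam n (-A) = gam n A := by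
  rw [gam, withDensity_apply _ hA, withDensity_apply _ hA.neg]
  have h := (Measure.measurePreserving_neg (volume : Measure (Eu n))).setLIntegral_comp_preimage hA
    ((rho_cont n).measurable.ennreal_ofReal)
  rw [← h]
  have : ∀ x : Eu n, rho n (-x) = rho n x := fun x => by simp [rho]
  simp_rw [this]
  rfl

section lower
variable {m : ℕ} {K : Set (Eu (m + 1))} {v : Eu (m + 1)} {ι : Eu m →ₗᵢ[ℝ] Eu (m + 1)}

lemma map_prj_le (hK : SymBody K) (hv : ‖v‖ = 1) (hι : ∀ y, ⟪ι y, v⟫ = 0) {b c : ℝ} (hc : 0 < c)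
    {C : Set (Eu (m + 1))} (hC : IsCompact C) (hs : ∀ x ∈ C, GoodN K v ι b c x)
    {f : Eu m → ℝ≥0∞} (hf : Measurable f) :
    ∫⁻ x in C, f (prj ι x) ∂(μH[(m : ℝ)] : Measure (Eu (m + 1))) ≤
      ENNReal.ofReal (1 + b / c) ^ m * ∫⁻ y, f y ∂(μH[(m : ℝ)] : Measure (Eu m)) := by
  have hle : (((μH[(m : ℝ)] : Measure (Eu (m + 1))).restrict C).map (prj ι)) ≤
      (ENNReal.ofReal (1 + b / c) ^ m) • (μH[(m : ℝ)] : Measure (Eu m)) := by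
    refine Measure.le_iff.2 fun S hS => ?_
    rw [Measure.map_apply (prj ι).continuous.measurable hS,
      Measure.restrict_apply ((prj ι).continuous.measurable hS), Measure.smul_apply, smul_eq_mul]
    refine (haus_le hK hv hι hc fun x hx => hs x hx.2).trans ?_
    gcongr
    rintro _ ⟨x, hx, rfl⟩
    exact hx.1
  rw [← lintegral_map hf (prj ι).continuous.measurable]
  refine (lintegral_mono' hle le_rfl).trans ?_
  rw [lintegral_smul_measure, smul_eq_mul]

lemma rho_shift (hv : ‖v‖ = 1) {x : Eu (m + 1)} {R s t : ℝ} (hx : ‖x‖ ≤ R) (hs : 0 ≤ s) (hst : s ≤ t)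
    (ht : t ≤ 1) : rho (m + 1) x * Real.exp (-(R + 1) * t) ≤ rho (m + 1) (x + s • v) := by
  unfold rho
  rw [mul_assoc, ← Real.exp_add]
  gcongr
  rw [norm_add_sq_real, norm_smul, hv, real_inner_smul_right, Real.norm_of_nonneg hs]
  have h1 := real_inner_le_norm x v
  rw [hv, mul_one] at h1
  have hR : 0 ≤ R := (norm_nonneg x).trans hx
  have h2 : s * ⟪x, v⟫ ≤ t * R := by
    calc s * ⟪x, v⟫ ≤ s * R := by gcongr; linarith
      _ ≤ t * R := by gcongr
  nlinarith

lemma lower_geom (hK : SymBody K) (hv : ‖v‖ = 1) (hι : ∀ y, ⟪ι y, v⟫ = 0) {δ : ℝ} (hδ : δ < 1)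
    {C : Set (Eu (m + 1))} (hC : IsCompact C)
    (hs : ∀ x ∈ C, x ∈ K ∧ 0 < ⟪x, v⟫ ∧ ∃ ν, ⟪x, ν⟫ = suppFun K ν ∧ ‖ν - v‖ ≤ δ) {R t : ℝ}
    (hR : K ⊆ closedBall 0 R) (ht : 0 < t) (ht1 : t ≤ 1) {K' : Set (Eu (m + 1))}
    (hK' : IsClosed K') (hsym : ∀ x ∈ K', -x ∈ K')
    (hCK : ∀ x ∈ C, ∀ s, 0 ≤ s → s ≤ t → x + s • v ∈ K') :
    2 * (ENNReal.ofReal (t * Real.exp (-(R + 1) * t)) *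
      ∫⁻ x in C, ENNReal.ofReal (rho (m + 1) x) ∂(μH[(m : ℝ)] : Measure (Eu (m + 1)))) ≤
    ENNReal.ofReal (1 + δ / (1 - δ)) ^ m * (kap m * gam (m + 1) (K' \ K)) := by
  set A := (K' \ K) ∩ {z | 0 < ⟪z, v⟫} with hA
  have hAm : MeasurableSet A :=
    (hK'.measurableSet.diff hK.cpt.isClosed.measurableSet).inter
      (isOpen_lt continuous_const (by fun_prop)).measurableSet
  have h2 : 2 * gam (m + 1) A ≤ gam (m + 1) (K' \ K) := by
    have hdisj : Disjoint A (-A) := by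
      rw [Set.disjoint_left]
      rintro z ⟨-, h1⟩ ⟨-, h2⟩
      simp only [mem_ofPred_eq, inner_neg_left] at h1 h2
      linarith
    calc 2 * gam (m + 1) A = gam (m + 1) A + gam (m + 1) (-A) := by rw [gam_neg hAm, two_mul]
      _ = gam (m + 1) (A ∪ -A) := (measure_union hdisj hAm.neg).symm
      _ ≤ _ := by
        refine measure_mono (union_subset inter_subset_left ?_)
        rintro z ⟨⟨h1, h2⟩, -⟩
        refine ⟨by simpa using hsym _ h1, fun h => h2 (hK.sym z h)⟩
  let f : Eu (m + 1) → ℝ≥0∞ := A.indicator fun x => ENNReal.ofReal (rho (m + 1) x)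
  have hf : Measurable f := ((rho_cont (m + 1)).measurable.ennreal_ofReal).indicator hAm
  have hfub := fubini_frame hv hι hf
  have hgA : ∫⁻ z, f z = gam (m + 1) A := by
    rw [gam, withDensity_apply _ hAm, lintegral_indicator hAm]
  rw [hgA] at hfub
  let g : Eu m → ℝ≥0∞ := fun y => ∫⁻ s : ℝ, f (ι y + s • v)
  have hg : Measurable g := by
    refine Measurable.lintegral_prod_right' (f := fun p : Eu m × ℝ => f (ι p.1 + p.2 • v)) ?_
    refine hf.comp (Continuous.measurable ?_)
    have := ι.continuous
    fun_prop
  have hgC : ∀ x ∈ C, ENNReal.ofReal (t * Real.exp (-(R + 1) * t)) * ENNReal.ofReal (rho (m + 1) x)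
      ≤ g (prj ι x) := by
    intro x hx
    obtain ⟨hxK, hxv, ν, hn, hd⟩ := hs x hx
    have hνv : 0 < ⟪v, ν⟫ := by
      have h1 := abs_le.1 (abs_real_inner_le_norm (ν - v) v)
      rw [inner_sub_left, real_inner_self_eq_norm_sq, hv] at h1
      rw [real_inner_comm]; linarith [h1.1]
    have e1 : g (prj ι x) = ∫⁻ s : ℝ, f (x + s • v) := by
      change ∫⁻ s : ℝ, f (ι (prj ι x) + s • v) = _
      rw [← lintegral_add_left_eq_self (fun s : ℝ => f (ι (prj ι x) + s • v)) ⟪x, v⟫]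
      refine lintegral_congr fun s => ?_
      conv_rhs => rw [← frame_decomp hv hι x]
      rw [add_smul, add_assoc]
    rw [e1]
    have e2 : ∀ s ∈ Ioc 0 t, ENNReal.ofReal (rho (m + 1) x * Real.exp (-(R + 1) * t)) ≤ f (x + s • v) := by
      intro s hs
      have hmem : x + s • v ∈ A := by
        refine ⟨⟨hCK x hx s hs.1.le hs.2, hK.not_mem_add hs.1 hn hνv⟩, ?_⟩
        rw [mem_ofPred_eq, inner_add_left, real_inner_smul_left, real_inner_self_eq_norm_sq, hv]
        have := hs.1
        linarith
      simp only [f]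
      rw [indicator_of_mem hmem]
      exact ENNReal.ofReal_le_ofReal (rho_shift hv (by simpa using hR hxK) hs.1.le hs.2 ht1)
    calc _ = ∫⁻ s in Ioc 0 t, ENNReal.ofReal (rho (m + 1) x * Real.exp (-(R + 1) * t)) := by
          rw [setLIntegral_const, Real.volume_Ioc, sub_zero,
            ← ENNReal.ofReal_mul (by positivity),
            ← ENNReal.ofReal_mul (mul_pos (rho_pos _ _) (Real.exp_pos _)).le]
          congr 1; ring
      _ ≤ ∫⁻ s in Ioc 0 t, f (x + s • v) := setLIntegral_mono' measurableSet_Ioc e2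
      _ ≤ _ := setLIntegral_le_lintegral _ _
  have hmain : ENNReal.ofReal (t * Real.exp (-(R + 1) * t)) *
      ∫⁻ x in C, ENNReal.ofReal (rho (m + 1) x) ∂(μH[(m : ℝ)] : Measure (Eu (m + 1))) ≤
      ENNReal.ofReal (1 + δ / (1 - δ)) ^ m * (kap m * gam (m + 1) A) := by
    rw [← lintegral_const_mul _ ((rho_cont (m + 1)).measurable.ennreal_ofReal), hfub]
    refine (setLIntegral_mono' hC.isClosed.measurableSet hgC).trans ?_
    refine map_prj_le hK hv hι (sub_pos.2 hδ) hC (fun x hx => ?_) hg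
    obtain ⟨hxK, hxv, ν, hn, hd⟩ := hs x hx
    exact goodN_of_close hv hι hxK hn hd
  calc _ ≤ 2 * (ENNReal.ofReal (1 + δ / (1 - δ)) ^ m * (kap m * gam (m + 1) A)) := by gcongr
    _ = ENNReal.ofReal (1 + δ / (1 - δ)) ^ m * (kap m * (2 * gam (m + 1) A)) := by ring
    _ ≤ _ := by gcongr

end lower

/-- maximality -/
def IsMaxB {n : ℕ} (μ : Measure (Eu n)) (α κ : ℝ) (K : Set (Eu n)) : Prop :=
  ∀ K' : Set (Eu n), IsCompact K' → (∀ x ∈ K', -x ∈ K') → K'.Nonempty →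
      κ / α * (gam n K').toReal ^ α - ∫ v, suppFun K' v ∂μ ≤
      κ / α * (gam n K).toReal ^ α - ∫ v, suppFun K v ∂μ

lemma rpow_tangent {a b α : ℝ} (ha : 0 ≤ a) (hb : 0 < b) (hα : 0 < α) (hα1 : α ≤ 1) :
    a ^ α ≤ b ^ α + α * b ^ (α - 1) * (a - b) := by
  have h := rpow_one_add_le_one_add_mul_self (s := (a - b) / b) (p := α)
    (by rw [le_div_iff₀ hb]; linarith) hα.le hα1
  have e : 1 + (a - b) / b = a / b := by field_simp; ring
  rw [e, Real.div_rpow ha hb.le, div_le_iff₀ (by positivity)] at h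
  refine h.trans (le_of_eq ?_)
  rw [Real.rpow_sub_one hb.ne']
  field_simp

section lowervar
variable {m : ℕ} {K : Set (Eu (m + 1))}

open Classical in
/-- enlarged body -/
def KU (K U : Set (Eu (m + 1))) (t : ℝ) : Set (Eu (m + 1)) :=
  {x | ∀ w : Eu (m + 1), ‖w‖ = 1 → ⟪x, w⟫ ≤ suppFun K w + t * U.indicator (fun _ => (1:ℝ)) w}

lemma KU_closed (U : Set (Eu (m + 1))) (t : ℝ) : IsClosed (KU K U t) := by
  have : KU K U t = ⋂ (w : Eu (m + 1)) (_ : ‖w‖ = 1),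
      {x | ⟪x, w⟫ ≤ suppFun K w + t * U.indicator (fun _ => (1:ℝ)) w} := by
    ext x; simp [KU]
  rw [this]
  exact isClosed_iInter fun w => isClosed_iInter fun _ => isClosed_le (by fun_prop) continuous_const

lemma ind_nonneg (U : Set (Eu (m + 1))) (w) : 0 ≤ U.indicator (fun _ => (1:ℝ)) w :=
  indicator_nonneg (fun _ _ => zero_le_one) _

lemma ind_le (U : Set (Eu (m + 1))) (w) : U.indicator (fun _ => (1:ℝ)) w ≤ 1 := by
  by_cases h : w ∈ U <;> simp [h]

lemma KU_cpt (hK : SymBody K) (U : Set (Eu (m + 1))) {t : ℝ} (ht : 0 ≤ t) : IsCompact (KU K U t) := by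
  obtain ⟨R, hR0, hR⟩ := hK.exists_R
  refine (isCompact_closedBall (0 : Eu (m + 1)) (R + t)).of_isClosed_subset (KU_closed U t) fun x hx => ?_
  rw [mem_closedBall, dist_zero_right]
  rcases eq_or_ne x 0 with rfl | h0
  · simp; linarith
  have hn := norm_pos_iff.2 h0
  have hu : ‖‖x‖⁻¹ • x‖ = 1 := by rw [norm_smul]; simp; field_simp
  have h1 := hx (‖x‖⁻¹ • x) hu
  rw [real_inner_smul_right, real_inner_self_eq_norm_sq] at h1
  have h2 := (abs_le.1 (supp_abs_le hK.cpt hK.ne hR (‖x‖⁻¹ • x))).2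
  rw [hu, mul_one] at h2
  have h3 := mul_le_mul_of_nonneg_left (ind_le U (‖x‖⁻¹ • x)) ht
  have h4 : ‖x‖⁻¹ * ‖x‖ ^ 2 = ‖x‖ := by field_simp
  linarith

lemma KU_sub (hK : SymBody K) (U : Set (Eu (m + 1))) {t : ℝ} (ht : 0 ≤ t) : K ⊆ KU K U t :=
  fun x hx w _ => (le_suppFun hK.cpt hx w).trans
    (le_add_of_nonneg_right (mul_nonneg ht (ind_nonneg U w)))

lemma KU_sym (hK : SymBody K) {U : Set (Eu (m + 1))} (hU : ∀ x ∈ U, -x ∈ U) {t : ℝ} :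
    ∀ x ∈ KU K U t, -x ∈ KU K U t := by
  intro x hx w hw
  have h := hx (-w) (by simpa using hw)
  have : U.indicator (fun _ => (1:ℝ)) (-w) = U.indicator (fun _ => (1:ℝ)) w := by
    by_cases h : w ∈ U
    · rw [indicator_of_mem h, indicator_of_mem (hU w h)]
    · rw [indicator_of_notMem h, indicator_of_notMem fun h' => h (by simpa using hU _ h')]
  rw [this, hK.suppFun_neg] at h
  simpa using h

lemma exists_t0 (hK : SymBody K) {C W : Set (Eu (m + 1))} (hC : IsCompact C) (hW : IsOpen W)
    (hCR : C ⊆ Reg K) (hCW : ∀ x ∈ C, nu K x ∈ W) :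
    ∃ t0 : ℝ, 0 < t0 ∧ ∀ x ∈ C, ∀ w : Eu (m + 1), ‖w‖ = 1 → w ∉ W → ⟪x, w⟫ + t0 ≤ suppFun K w := by
  have hS : IsCompact (C ×ˢ (sphere (0 : Eu (m + 1)) 1 \ W)) :=
    hC.prod ((isCompact_sphere _ _).diff hW)
  rcases (C ×ˢ (sphere (0 : Eu (m + 1)) 1 \ W)).eq_empty_or_nonempty with he | hne
  · refine ⟨1, one_pos, fun x hx w hw hwW => ?_⟩
    have : (x, w) ∈ C ×ˢ (sphere (0 : Eu (m + 1)) 1 \ W) := ⟨hx, by simpa using hw, hwW⟩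
    rw [he] at this
    exact this.elim
  · have hcont : Continuous fun p : Eu (m + 1) × Eu (m + 1) => suppFun K p.2 - ⟪p.1, p.2⟫ :=
      ((suppFun_continuous hK.cpt hK.ne).comp continuous_snd).sub (by fun_prop)
    obtain ⟨p, hp, hmin⟩ := hS.exists_isMinOn hne hcont.continuousOn
    refine ⟨suppFun K p.2 - ⟪p.1, p.2⟫, ?_, fun x hx w hw hwW => ?_⟩
    · have h1 := le_suppFun hK.cpt (hK.frontier_sub (hCR hp.1).1) p.2
      refine lt_of_le_of_ne (by linarith) fun h => ?_
      have h2 : ⟪p.1, p.2⟫ = suppFun K p.2 := by linarith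
      have h3 := nu_unique hK (hCR hp.1) (by simpa using hp.2.1) h2
      exact hp.2.2 (h3 ▸ hCW _ hp.1)
    · have := hmin (show (x, w) ∈ C ×ˢ (sphere (0 : Eu (m + 1)) 1 \ W) from ⟨hx, by simpa using hw, hwW⟩)
      simp only [mem_ofPred_eq] at this
      linarith

lemma lower_var {μ : Measure (Eu (m + 1))} [IsFiniteMeasure μ] {α : ℝ} (hα : 0 < α) (hα1 : α < 1)
    (hsph : μ (sphere (0 : Eu (m + 1)) 1)ᶜ = 0)
    (heven : ∀ η : Set (Eu (m + 1)), MeasurableSet η → μ (-η) = μ η)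
    (hK : SymBody K) (hpos : 0 < (gam (m + 1) K).toReal) (hmax : IsMaxB μ α (kap m) K)
    {R r δ : ℝ} (hR0 : 0 < R) (hR : K ⊆ closedBall 0 R) (hr : 0 < r) (hrK : closedBall 0 r ⊆ K)
    (hδ0 : 0 < δ) (hδ1 : δ < 1) (hδ : R * δ < r) {v : Eu (m + 1)} (hv : ‖v‖ = 1)
    {C W : Set (Eu (m + 1))} (hC : IsCompact C) (hW : IsOpen W) (hCR : C ⊆ Reg K)
    (hCW : ∀ x ∈ C, nu K x ∈ W) (hCv : ∀ x ∈ C, ‖nu K x - v‖ ≤ δ) :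
    (∫⁻ x in C, ENNReal.ofReal (rho (m + 1) x) ∂(μH[(m : ℝ)] : Measure (Eu (m + 1)))).toReal ≤
      (1 + δ / (1 - δ)) ^ m * (gam (m + 1) K).toReal ^ (1 - α) * μ.real W := by
  obtain ⟨ι, hι⟩ := exists_frame hv
  obtain ⟨t0, ht0, ht0W⟩ := exists_t0 hK hC hW hCR hCW
  set U := W ∪ -W with hU
  have hUs : ∀ x ∈ U, -x ∈ U := by
    rintro x (h | h)
    · exact Or.inr (by simpa using h)
    · exact Or.inl h
  have hUm : MeasurableSet U := hW.measurableSet.union hW.measurableSet.neg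
  set κ : ℝ := (kap m : ℝ) with hκ
  have hκp : 0 < κ := by exact_mod_cast kap_pos m
  set a := (gam (m + 1) K).toReal with ha
  set σ := (∫⁻ x in C, ENNReal.ofReal (rho (m + 1) x) ∂(μH[(m : ℝ)] : Measure (Eu (m + 1)))).toReal with hσ
  set L := (1 + δ / (1 - δ)) with hL
  have hLp : 0 < L := by
    have : 0 < 1 - δ := by linarith
    positivity
  set w := μ.real W with hw
  have hw0 : 0 ≤ w := measureReal_nonneg
  have hUw : μ.real U ≤ 2 * w := by
    refine (measureReal_union_le _ _).trans (le_of_eq ?_)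
    have : μ.real (-W) = w := by rw [hw, Measure.real, heven W hW.measurableSet, Measure.real]
    rw [this]; ring
  -- the basic inequality
  have main : ∀ t : ℝ, 0 < t → t ≤ 1 → t ≤ t0 → Real.exp (-(R + 1) * t) * σ ≤
      L ^ m * (a ^ α + 2 * α / κ * w * t) ^ ((1 - α) / α) * w := by
    intro t ht ht1 htt
    set Kt := KU K U t with hKt
    have hKtc : IsCompact Kt := KU_cpt hK U ht.le
    have hsub : K ⊆ Kt := KU_sub hK U ht.le
    set b := (gam (m + 1) Kt).toReal with hb
    have hab : a ≤ b := ENNReal.toReal_mono (measure_ne_top _ _) (measure_mono hsub)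
    have hbp : 0 < b := hpos.trans_le hab
    have hvar : κ / α * (b ^ α - a ^ α) ≤ 2 * w * t := by
      have h1 := hmax Kt hKtc (KU_sym hK hUs) (hK.ne.mono hsub)
      have h2 : ∫ v, suppFun Kt v ∂μ ≤ ∫ v, (suppFun K v + t * U.indicator (fun _ => (1:ℝ)) v) ∂μ := by
        refine integral_mono_ae (int_supp hsph hKtc (hK.ne.mono hsub))
          ((int_supp hsph hK.cpt hK.ne).add (((integrable_const (1:ℝ)).indicator hUm).const_mul t)) ?_
        filter_upwards [ae_sph hsph] with u hu
        exact suppFun_le (hK.ne.mono hsub) fun x hx => hx u hu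
      rw [integral_add (int_supp hsph hK.cpt hK.ne)
        (((integrable_const (1:ℝ)).indicator hUm).const_mul t), integral_const_mul,
        integral_indicator_const _ hUm, smul_eq_mul, mul_one] at h2
      have h3 : t * μ.real U ≤ t * (2 * w) := by gcongr
      have h4 : κ / α * (b ^ α - a ^ α) = κ / α * b ^ α - κ / α * a ^ α := by ring
      linarith
    have hgeo : 2 * (t * Real.exp (-(R + 1) * t) * σ) ≤ L ^ m * (κ * (b - a)) := by
      have h := lower_geom (ι := ι) (t := t) hK hv hι hδ1 hC (fun x hx => ?_) hR ht ht1 hKtc.isClosed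
        (KU_sym hK hUs) ?_
      · have hfin : ENNReal.ofReal (1 + δ / (1 - δ)) ^ m * (kap m * gam (m + 1) (Kt \ K)) ≠ ∞ :=
          ENNReal.mul_ne_top (by simp) (ENNReal.mul_ne_top (by simp) (measure_ne_top _ _))
        have h' := ENNReal.toReal_mono hfin h
        have hd : (gam (m + 1) (Kt \ K)).toReal = b - a := by
          rw [measure_diff hsub hK.cpt.isClosed.measurableSet.nullMeasurableSet (measure_ne_top _ _),
            ENNReal.toReal_sub_of_le (measure_mono hsub) (measure_ne_top _ _)]
        simp only [ENNReal.toReal_mul, ENNReal.toReal_pow, hd] at h'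
        rw [ENNReal.toReal_ofReal hLp.le, ENNReal.toReal_ofReal (by positivity)] at h'
        simpa using h'
      · obtain ⟨h1, h2⟩ := nu_spec hK (hCR hx)
        have hxK := hK.frontier_sub (hCR hx).1
        refine ⟨hxK, ?_, nu K x, h2, hCv x hx⟩
        have h3 := hK.r_le hr hrK h1
        have h4 := real_inner_le_norm x (nu K x - v)
        rw [inner_sub_right] at h4
        have h5 : ‖x‖ * ‖nu K x - v‖ ≤ R * δ := by
          gcongr
          · simpa using hR hxK
          · exact hCv x hx
        linarith
      · intro x hx s hs0 hst u hu
        rw [inner_add_left, real_inner_smul_left]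
        have hvu : ⟪v, u⟫ ≤ 1 := by
          have := real_inner_le_norm v u
          rwa [hv, hu, one_mul] at this
        have hsu : s * ⟪v, u⟫ ≤ t := by nlinarith
        by_cases huU : u ∈ U
        · rw [indicator_of_mem huU]
          have := le_suppFun hK.cpt (hK.frontier_sub (hCR hx).1) u
          linarith
        · rw [indicator_of_notMem huU]
          have := ht0W x hx u hu fun h => huU (Or.inl h)
          linarith
    have hconc : b ^ (α - 1) * (b - a) ≤ (b ^ α - a ^ α) / α := by
      have := rpow_tangent hpos.le hbp hα hα1.le
      rw [le_div_iff₀ hα]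
      linarith
    have hconc2 : b - a ≤ b ^ (1 - α) * ((b ^ α - a ^ α) / α) := by
      have h1 := mul_le_mul_of_nonneg_left hconc (Real.rpow_nonneg hbp.le (1 - α))
      rw [← mul_assoc, ← Real.rpow_add hbp] at h1
      simpa using h1
    have hbb : b ^ (1 - α) ≤ (a ^ α + 2 * α / κ * w * t) ^ ((1 - α) / α) := by
      have h1 : b ^ (1 - α) = (b ^ α) ^ ((1 - α) / α) := by
        rw [← Real.rpow_mul hbp.le]; congr 1; field_simp
      rw [h1]
      refine Real.rpow_le_rpow (by positivity) ?_ (div_nonneg (by linarith) hα.le)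
      have h2 : b ^ α - a ^ α = α / κ * (κ / α * (b ^ α - a ^ α)) := by field_simp
      have h3 : α / κ * (κ / α * (b ^ α - a ^ α)) ≤ α / κ * (2 * w * t) := by gcongr
      have h4 : α / κ * (2 * w * t) = 2 * α / κ * w * t := by ring
      linarith
    have hfin : 2 * t * (Real.exp (-(R + 1) * t) * σ) ≤
        2 * t * (L ^ m * (a ^ α + 2 * α / κ * w * t) ^ ((1 - α) / α) * w) := by
      calc _ = 2 * (t * Real.exp (-(R + 1) * t) * σ) := by ring
        _ ≤ L ^ m * (κ * (b - a)) := hgeo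
        _ ≤ L ^ m * (κ * (b ^ (1 - α) * ((b ^ α - a ^ α) / α))) := by gcongr
        _ = L ^ m * b ^ (1 - α) * (κ / α * (b ^ α - a ^ α)) := by ring
        _ ≤ L ^ m * b ^ (1 - α) * (2 * w * t) := by gcongr
        _ ≤ L ^ m * (a ^ α + 2 * α / κ * w * t) ^ ((1 - α) / α) * (2 * w * t) := by gcongr
        _ = _ := by ring
    exact le_of_mul_le_mul_left hfin (by positivity)
  -- limit
  have hl1 : Tendsto (fun t : ℝ => Real.exp (-(R + 1) * t) * σ) (𝓝[>] 0) (𝓝 σ) := by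
    have : Continuous fun t : ℝ => Real.exp (-(R + 1) * t) * σ := by fun_prop
    have := this.tendsto 0
    simp only [mul_zero, Real.exp_zero, one_mul] at this
    exact this.mono_left nhdsWithin_le_nhds
  have hl2 : Tendsto (fun t : ℝ => L ^ m * (a ^ α + 2 * α / κ * w * t) ^ ((1 - α) / α) * w) (𝓝[>] 0)
      (𝓝 (L ^ m * a ^ (1 - α) * w)) := by
    have : Continuous fun t : ℝ => L ^ m * (a ^ α + 2 * α / κ * w * t) ^ ((1 - α) / α) * w := by
      refine Continuous.mul (continuous_const.mul (Continuous.rpow_const (by fun_prop) fun _ =>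
        Or.inr (div_nonneg (by linarith) hα.le))) continuous_const
    have := this.tendsto 0
    simp only [mul_zero, add_zero] at this
    have e : (a ^ α) ^ ((1 - α) / α) = a ^ (1 - α) := by
      rw [← Real.rpow_mul hpos.le]; congr 1; field_simp
    rw [e] at this
    exact this.mono_left nhdsWithin_le_nhds
  refine le_of_tendsto_of_tendsto hl1 hl2 ?_
  have e1 : ∀ᶠ t : ℝ in 𝓝[>] 0, t < 1 := nhdsWithin_le_nhds (gt_mem_nhds one_pos)
  have e2 : ∀ᶠ t : ℝ in 𝓝[>] 0, t < t0 := nhdsWithin_le_nhds (gt_mem_nhds ht0)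
  filter_upwards [e1, e2, self_mem_nhdsWithin] with t h1 h2 h3
  exact main t h3 h1.le h2.le

end lowervar

lemma measure_le_of_cover {X : Type*} [MeasurableSpace X] {τ τ' : Measure X} {A : ℕ → Set X}
    (hA : ∀ i, MeasurableSet (A i)) (h0 : τ (⋃ i, A i)ᶜ = 0)
    (h : ∀ i, ∀ B ⊆ A i, MeasurableSet B → τ B ≤ τ' B) : τ ≤ τ' := by
  refine Measure.le_iff.2 fun B hB => ?_
  have hD : ∀ i, MeasurableSet (disjointed A i) := fun i => MeasurableSet.disjointed hA i
  have hsub : B ⊆ (⋃ i, B ∩ disjointed A i) ∪ (⋃ i, A i)ᶜ := by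
    intro x hx
    rw [← inter_iUnion, iUnion_disjointed]
    by_cases h : x ∈ ⋃ i, A i
    · exact Or.inl ⟨hx, h⟩
    · exact Or.inr h
  calc τ B ≤ τ (⋃ i, B ∩ disjointed A i) + τ (⋃ i, A i)ᶜ :=
        (measure_mono hsub).trans (measure_union_le _ _)
    _ = τ (⋃ i, B ∩ disjointed A i) := by rw [h0, add_zero]
    _ ≤ ∑' i, τ (B ∩ disjointed A i) := measure_iUnion_le _
    _ ≤ ∑' i, τ' (B ∩ disjointed A i) := ENNReal.tsum_le_tsum fun i =>
        h i _ (inter_subset_right.trans (disjointed_subset A i)) (hB.inter (hD i))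
    _ = τ' (⋃ i, B ∩ disjointed A i) := by
        refine (measure_iUnion (fun i j hij => ?_) fun i => hB.inter (hD i)).symm
        exact (disjoint_disjointed A hij).mono inter_subset_right inter_subset_right
    _ ≤ τ' B := measure_mono (iUnion_subset fun i => inter_subset_left)

lemma exists_dense_sphere (m : ℕ) : ∃ d : ℕ → Eu (m + 1), (∀ i, ‖d i‖ = 1) ∧
    ∀ δ > 0, ∀ v : Eu (m + 1), ‖v‖ = 1 → ∃ i, ‖v - d i‖ < δ := by
  have : Nonempty (sphere (0 : Eu (m + 1)) 1) := ⟨⟨EuclideanSpace.single 0 1, by simp⟩⟩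
  let d := TopologicalSpace.denseSeq (sphere (0 : Eu (m + 1)) 1)
  have hd : DenseRange d := TopologicalSpace.denseRange_denseSeq _
  refine ⟨fun i => d i, fun i => by simpa using (d i).2, fun δ hδ v hv => ?_⟩
  obtain ⟨i, hi⟩ := hd.exists_dist_lt ⟨v, by simpa using hv⟩ hδ
  exact ⟨i, by rw [← dist_eq_norm]; exact hi⟩

section lowerfin
variable {m : ℕ} {K : Set (Eu (m + 1))}

lemma lower_final {μ : Measure (Eu (m + 1))} [IsFiniteMeasure μ] {α : ℝ} (hα : 0 < α) (hα1 : α < 1)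
    (hsph : μ (sphere (0 : Eu (m + 1)) 1)ᶜ = 0)
    (heven : ∀ η : Set (Eu (m + 1)), MeasurableSet η → μ (-η) = μ η)
    (hK : SymBody K) (hpos : 0 < (gam (m + 1) K).toReal) (hmax : IsMaxB μ α (kap m) K) :
    TK K ≤ ENNReal.ofReal ((gam (m + 1) K).toReal ^ (1 - α)) • μ := by
  obtain ⟨R, hR0, hR⟩ := hK.exists_R
  obtain ⟨r, hr, hrK⟩ := hK.exists_r
  obtain ⟨d, hd1, hd⟩ := exists_dense_sphere m
  have := sigK_finite hK
  have hnu := measurable_nu hK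
  set a := (gam (m + 1) K).toReal with ha
  have hregc : sigK K (Reg K)ᶜ = 0 := by
    refine withDensity_absolutelyContinuous _ _ ?_
    rw [HK, Measure.restrict_apply measurableSet_Reg.compl, compl_inter_self, measure_empty]
  have hsC : ∀ C : Set (Eu (m + 1)), MeasurableSet C → C ⊆ Reg K → sigK K C =
      ∫⁻ x in C, ENNReal.ofReal (rho (m + 1) x) ∂(μH[(m : ℝ)] : Measure (Eu (m + 1))) := by
    intro C hC hCR
    rw [sigK, withDensity_apply _ hC, HK, Measure.restrict_restrict hC, inter_eq_left.2 hCR]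
  have step : ∀ δ : ℝ, 0 < δ → δ < 1 → R * δ < r →
      TK K ≤ ENNReal.ofReal ((1 + δ / (1 - δ)) ^ m * a ^ (1 - α)) • μ := by
    intro δ hδ0 hδ1 hδ
    have hd0 : 0 < 1 - δ := by linarith
    refine measure_le_of_cover (A := fun i => ball (d i) δ) (fun i => measurableSet_ball) ?_ ?_
    · rw [TK, Measure.map_apply hnu (MeasurableSet.iUnion fun i => measurableSet_ball).compl]
      refine measure_mono_null (fun x hx => ?_) hregc
      intro hxR
      obtain ⟨i, hi⟩ := hd δ hδ0 _ (nu_spec hK hxR).1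
      exact hx (mem_iUnion.2 ⟨i, by simpa [dist_eq_norm] using hi⟩)
    · intro i B hBi hB
      rw [TK, Measure.map_apply hnu hB, Measure.smul_apply, smul_eq_mul]
      have hB' : sigK K (nu K ⁻¹' B) ≤ sigK K (nu K ⁻¹' B ∩ Reg K) := by
        refine (measure_mono (t := (nu K ⁻¹' B ∩ Reg K) ∪ (Reg K)ᶜ) fun x hx => ?_).trans
          ((measure_union_le _ _).trans (by rw [hregc, add_zero]))
        by_cases h : x ∈ Reg K
        · exact Or.inl ⟨hx, h⟩
        · exact Or.inr h
      refine hB'.trans ?_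
      rw [((hnu hB).inter measurableSet_Reg).measure_eq_iSup_isCompact]
      refine iSup_le fun C => iSup_le fun hCs => iSup_le fun hC => ?_
      set c := (1 + δ / (1 - δ)) ^ m * a ^ (1 - α) with hc
      have hcp : 0 < c := by positivity
      rw [B.measure_eq_iInf_isOpen, ENNReal.mul_iInf_of_ne (by simpa using hcp) (by simp)]
      refine le_iInf fun W => ?_
      rw [ENNReal.mul_iInf_of_ne (by simpa using hcp) (by simp)]
      refine le_iInf fun hBW => ?_
      rw [ENNReal.mul_iInf_of_ne (by simpa using hcp) (by simp)]
      refine le_iInf fun hW => ?_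
      have h := lower_var hα hα1 hsph heven hK hpos hmax hR0 hR hr hrK hδ0 hδ1 hδ (hd1 i) hC hW
        (fun x hx => (hCs hx).2) (fun x hx => hBW (hCs hx).1) (fun x hx => by
          have := hBi (hCs hx).1
          rw [mem_ball, dist_eq_norm] at this
          exact this.le)
      rw [← hsC C hC.isClosed.measurableSet fun x hx => (hCs hx).2] at h
      have h2 := ENNReal.ofReal_le_ofReal h
      rwa [ENNReal.ofReal_toReal (measure_ne_top _ _), ENNReal.ofReal_mul (by positivity),
        ofReal_measureReal] at h2
  refine Measure.le_iff.2 fun B hB => ?_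
  have hl : Tendsto (fun δ : ℝ => ENNReal.ofReal ((1 + δ / (1 - δ)) ^ m * a ^ (1 - α)) * μ B) (𝓝[>] 0)
      (𝓝 (ENNReal.ofReal (a ^ (1 - α)) * μ B)) := by
    refine ENNReal.Tendsto.mul_const ?_ (Or.inr (measure_ne_top _ _))
    refine ENNReal.tendsto_ofReal ?_
    have : ContinuousAt (fun δ : ℝ => (1 + δ / (1 - δ)) ^ m * a ^ (1 - α)) 0 := by
      refine ContinuousAt.mul (ContinuousAt.pow (continuousAt_const.add
        (continuousAt_id.div (by fun_prop) (by norm_num))) m) continuousAt_const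
    have := this.tendsto
    simp only [zero_div, add_zero, one_pow, one_mul] at this
    exact this.mono_left nhdsWithin_le_nhds
  refine ge_of_tendsto hl ?_
  have e1 : ∀ᶠ t : ℝ in 𝓝[>] 0, t < 1 := nhdsWithin_le_nhds (gt_mem_nhds one_pos)
  have e2 : ∀ᶠ t : ℝ in 𝓝[>] 0, t < r / R := nhdsWithin_le_nhds (gt_mem_nhds (by positivity))
  filter_upwards [e1, e2, self_mem_nhdsWithin] with δ h1 h2 h3
  rw [lt_div_iff₀ hR0] at h2
  exact step δ h3 h1 (by linarith) B

end lowerfin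

section cone
variable {m : ℕ} {K : Set (Eu (m + 1))} {v : Eu (m + 1)} {ι : Eu m →ₗᵢ[ℝ] Eu (m + 1)}

/-- radial projection -/
def radp (K : Set (Eu (m + 1))) (z : Eu (m + 1)) : Eu (m + 1) := (gauge K z)⁻¹ • z

/-- shell -/
def Shell (K : Set (Eu (m + 1))) (t : ℝ) : Set (Eu (m + 1)) := {z | 1 - t < gauge K z ∧ gauge K z ≤ 1}

lemma gauge_cont (hK : SymBody K) : Continuous (gauge K) :=
  continuous_gauge hK.conv (mem_interior_iff_mem_nhds.1 hK.int)

lemma radp_meas (hK : SymBody K) : Measurable (radp K) :=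
  ((gauge_cont hK).measurable.inv).smul measurable_id

lemma shell_meas (hK : SymBody K) (t : ℝ) : MeasurableSet (Shell K t) :=
  (measurableSet_lt measurable_const (gauge_cont hK).measurable).inter
    (measurableSet_le (gauge_cont hK).measurable measurable_const)

lemma radp_frontier (hK : SymBody K) {t : ℝ} (ht : t < 1) {z : Eu (m + 1)} (hz : z ∈ Shell K t) :
    radp K z ∈ frontier K := by
  have hg : 0 < gauge K z := by have := hz.1; linarith
  rw [← gauge_eq_one_iff_mem_frontier hK.conv (mem_interior_iff_mem_nhds.1 hK.int), radp,
    gauge_smul_of_nonneg (by positivity), smul_eq_mul, inv_mul_cancel₀ hg.ne']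

lemma slice_le (hK : SymBody K) (hv : ‖v‖ = 1) (hι : ∀ y, ⟪ι y, v⟫ = 0) {b c R : ℝ} (hb : 0 ≤ b)
    (hc : 0 < c) (hR0 : 0 < R) (hR : K ⊆ closedBall 0 R) {A : Set (Eu (m + 1))}
    (hA : ∀ x ∈ A, GoodN K v ι b c x) {N : Set (Eu m)} (hN : prj ι '' A ⊆ N)
    {t : ℝ} (ht1 : t < 1) (p : Eu m) :
    volume {s : ℝ | ι p + s • v ∈ Shell K t ∩ radp K ⁻¹' A} ≤
      ENNReal.ofReal (suppFun K v + b / c * R) * volume {τ : ℝ | τ ∈ Ioc (1 - t) 1 ∧ τ⁻¹ • p ∈ N} := by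
  set Λ := suppFun K v + b / c * R with hΛ
  have hh := hK.suppFun_pos hv
  have hΛ0 : 0 ≤ Λ := by positivity
  set T : Set ℝ := {τ : ℝ | τ ∈ Ioc (1 - t) 1 ∧ τ⁻¹ • p ∈ prj ι '' A} with hT
  let inv : Eu m → Eu (m + 1) := Function.invFunOn (prj ι) A
  have hi1 : ∀ y ∈ prj ι '' A, inv y ∈ A := fun y hy => Function.invFunOn_mem hy
  have hi2 : ∀ y ∈ prj ι '' A, prj ι (inv y) = y := fun y hy => Function.invFunOn_eq hy
  let g : ℝ → ℝ := fun τ => τ * ⟪inv (τ⁻¹ • p), v⟫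
  have hlip : LipschitzOnWith Λ.toNNReal g T := by
    refine LipschitzOnWith.of_dist_le_mul fun τ₁ h1 τ₂ h2 => ?_
    rw [Real.coe_toNNReal _ hΛ0, Real.dist_eq, Real.dist_eq]
    have p1 : 0 < τ₁ := by have := h1.1.1; linarith
    have p2 : 0 < τ₂ := by have := h2.1.1; linarith
    simp only [g]
    set x1 := inv (τ₁⁻¹ • p) with hx1
    set x2 := inv (τ₂⁻¹ • p) with hx2
    have m1 : x1 ∈ A := hi1 _ h1.2
    have m2 : x2 ∈ A := hi1 _ h2.2
    have q1 : prj ι x1 = τ₁⁻¹ • p := hi2 _ h1.2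
    have q2 : prj ι x2 = τ₂⁻¹ • p := hi2 _ h2.2
    have e1 : |⟪x1, v⟫| ≤ suppFun K v := by
      have a1 := le_suppFun hK.cpt (hA x1 m1).1 v
      have a2 := le_suppFun hK.cpt (hK.sym _ (hA x1 m1).1) v
      rw [inner_neg_left] at a2
      rw [abs_le]; constructor <;> linarith
    have e2 := goodN_abs hK hv hι hc (hA x2 m2) (hA x1 m1)
    have e3 : τ₂ * ‖prj ι (x1 - x2)‖ ≤ |τ₁ - τ₂| * R := by
      have : τ₂ • prj ι (x1 - x2) = (τ₂ - τ₁) • prj ι x1 := by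
        rw [map_sub, smul_sub, sub_smul]
        congr 1
        rw [q1, q2, smul_inv_smul₀ p1.ne', smul_inv_smul₀ p2.ne']
      have h3 : τ₂ * ‖prj ι (x1 - x2)‖ = ‖τ₂ • prj ι (x1 - x2)‖ := by
        rw [norm_smul, Real.norm_of_nonneg p2.le]
      rw [h3, this, norm_smul, Real.norm_eq_abs, abs_sub_comm]
      gcongr
      exact (norm_prj_le ι _).trans (by simpa using hR (hA x1 m1).1)
    have e4 : τ₁ * ⟪x1, v⟫ - τ₂ * ⟪x2, v⟫ = (τ₁ - τ₂) * ⟪x1, v⟫ + τ₂ * ⟪x1 - x2, v⟫ := by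
      rw [inner_sub_left]; ring
    rw [e4]
    calc |(τ₁ - τ₂) * ⟪x1, v⟫ + τ₂ * ⟪x1 - x2, v⟫|
        ≤ |(τ₁ - τ₂) * ⟪x1, v⟫| + |τ₂ * ⟪x1 - x2, v⟫| := abs_add_le _ _
      _ = |τ₁ - τ₂| * |⟪x1, v⟫| + τ₂ * |⟪x1 - x2, v⟫| := by
          rw [abs_mul, abs_mul, abs_of_pos p2]
      _ ≤ |τ₁ - τ₂| * suppFun K v + τ₂ * (b / c * ‖prj ι (x1 - x2)‖) := by gcongr
      _ = |τ₁ - τ₂| * suppFun K v + b / c * (τ₂ * ‖prj ι (x1 - x2)‖) := by ring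
      _ ≤ |τ₁ - τ₂| * suppFun K v + b / c * (|τ₁ - τ₂| * R) := by gcongr
      _ = Λ * |τ₁ - τ₂| := by rw [hΛ]; ring
  have hsub : {s : ℝ | ι p + s • v ∈ Shell K t ∩ radp K ⁻¹' A} ⊆ g '' T := by
    rintro s ⟨⟨h1, h2⟩, h3⟩
    set z := ι p + s • v with hz
    set τ := gauge K z with hτ
    have hτ0 : 0 < τ := by linarith
    have hPz : prj ι z = p := by rw [hz, map_add, map_smul, prj_ι, prj_v hι, smul_zero, add_zero]
    have hPx : prj ι (radp K z) = τ⁻¹ • p := by rw [radp, map_smul, hPz]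
    have hmem : τ⁻¹ • p ∈ prj ι '' A := ⟨_, h3, hPx⟩
    refine ⟨τ, ⟨⟨h1, h2⟩, hmem⟩, ?_⟩
    have hx : inv (τ⁻¹ • p) = radp K z := by
      refine goodN_injOn hK hv hι hc (hA _ (hi1 _ hmem)) (hA _ h3) ?_
      rw [hi2 _ hmem, hPx]
    simp only [g]
    rw [hx, radp, real_inner_smul_left, ← hτ, ← mul_assoc, mul_inv_cancel₀ hτ0.ne', one_mul, hz,
      inner_add_left, hι, real_inner_smul_left, real_inner_self_eq_norm_sq, hv]
    ring
  have hvol := hlip.hausdorffMeasure_image_le (d := 1) zero_le_one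
  rw [hausdorffMeasure_real, ENNReal.rpow_one] at hvol
  refine (measure_mono hsub).trans (hvol.trans ?_)
  refine mul_le_mul' le_rfl (measure_mono ?_)
  rintro τ ⟨h1, h2⟩
  exact ⟨h1, hN h2⟩

lemma cone_le (hK : SymBody K) (hv : ‖v‖ = 1) {δ R : ℝ} (hδ0 : 0 ≤ δ)
    (hδ1 : δ < 1) (hR0 : 0 < R) (hR : K ⊆ closedBall 0 R) {A : Set (Eu (m + 1))}
    (hAm : MeasurableSet A) (hA : ∀ x ∈ A, x ∈ K ∧ ∃ ν, ⟪x, ν⟫ = suppFun K ν ∧ ‖ν - v‖ ≤ δ)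
    {t : ℝ} (ht0 : 0 < t) (ht1 : t < 1) :
    kap m * volume (Shell K t ∩ radp K ⁻¹' A) ≤
      ENNReal.ofReal t * (ENNReal.ofReal (suppFun K v + δ / (1 - δ) * R) *
        (μH[(m : ℝ)] : Measure (Eu (m + 1))) A) := by
  obtain ⟨ι, hι⟩ := exists_frame hv
  set S := Shell K t ∩ radp K ⁻¹' A with hS
  have hSm : MeasurableSet S := (shell_meas hK t).inter (radp_meas hK hAm)
  have hG : ∀ x ∈ A, GoodN K v ι δ (1 - δ) x := fun x hx => by
    obtain ⟨h1, ν, h2, h3⟩ := hA x hx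
    exact goodN_of_close hv hι h1 h2 h3
  set N := toMeasurable (μH[(m : ℝ)] : Measure (Eu m)) (prj ι '' A) with hN
  have hNm : MeasurableSet N := measurableSet_toMeasurable _ _
  have hNA : (μH[(m : ℝ)] : Measure (Eu m)) N ≤ (μH[(m : ℝ)] : Measure (Eu (m + 1))) A := by
    rw [hN, measure_toMeasurable]
    have := (lipschitz_prj ι).hausdorffMeasure_image_le (d := m) (Nat.cast_nonneg m) A
    simpa using this
  have hfub := fubini_frame hv hι (f := S.indicator 1) (measurable_one.indicator hSm)
  rw [lintegral_indicator_one hSm] at hfub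
  rw [hfub]
  have h1 : ∀ p : Eu m, ∫⁻ s : ℝ, S.indicator (1 : Eu (m + 1) → ℝ≥0∞) (ι p + s • v) =
      volume {s : ℝ | ι p + s • v ∈ S} := fun p => by
    have hm : MeasurableSet {s : ℝ | ι p + s • v ∈ S} :=
      (by fun_prop : Measurable fun s : ℝ => ι p + s • v) hSm
    rw [← lintegral_indicator_one hm]
    rfl
  simp_rw [h1]
  set Λ := ENNReal.ofReal (suppFun K v + δ / (1 - δ) * R) with hΛ
  have hQ : MeasurableSet {q : Eu m × ℝ | q.2⁻¹ • q.1 ∈ N} :=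
    (measurable_snd.inv.smul measurable_fst) hNm
  have h2 : ∀ p : Eu m, volume {τ : ℝ | τ ∈ Ioc (1 - t) 1 ∧ τ⁻¹ • p ∈ N} =
      ∫⁻ τ in Ioc (1 - t) 1, {q : Eu m × ℝ | q.2⁻¹ • q.1 ∈ N}.indicator 1 (p, τ) := fun p => by
    have hm : MeasurableSet {τ : ℝ | τ⁻¹ • p ∈ N} :=
      (measurable_inv.smul_const p) hNm
    rw [show {τ : ℝ | τ ∈ Ioc (1 - t) 1 ∧ τ⁻¹ • p ∈ N} = {τ : ℝ | τ⁻¹ • p ∈ N} ∩ Ioc (1 - t) 1 by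
      ext τ; simp only [mem_ofPred_eq, mem_inter_iff, and_comm]]
    rw [← Measure.restrict_apply hm, ← lintegral_indicator_one hm]
    rfl
  calc ∫⁻ p, volume {s : ℝ | ι p + s • v ∈ S} ∂(μH[(m : ℝ)] : Measure (Eu m))
      ≤ ∫⁻ p, Λ * (∫⁻ τ in Ioc (1 - t) 1, {q : Eu m × ℝ | q.2⁻¹ • q.1 ∈ N}.indicator 1 (p, τ))
          ∂(μH[(m : ℝ)] : Measure (Eu m)) := by
        refine lintegral_mono fun p => ?_
        rw [← h2 p]
        exact slice_le hK hv hι hδ0 (sub_pos.2 hδ1) hR0 hR hG (subset_toMeasurable _ _) ht1 p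
    _ = Λ * ∫⁻ p, (∫⁻ τ in Ioc (1 - t) 1, {q : Eu m × ℝ | q.2⁻¹ • q.1 ∈ N}.indicator 1 (p, τ))
          ∂(μH[(m : ℝ)] : Measure (Eu m)) := by
        refine lintegral_const_mul _ ?_
        exact Measurable.lintegral_prod_right' (measurable_one.indicator hQ)
    _ = Λ * ∫⁻ τ in Ioc (1 - t) 1, (∫⁻ p, {q : Eu m × ℝ | q.2⁻¹ • q.1 ∈ N}.indicator 1 (p, τ)
          ∂(μH[(m : ℝ)] : Measure (Eu m))) := by
        rw [lintegral_lintegral_swap]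
        exact (measurable_one.indicator hQ).aemeasurable
    _ ≤ Λ * ∫⁻ τ in Ioc (1 - t) 1, (μH[(m : ℝ)] : Measure (Eu m)) N := by
        refine mul_le_mul' le_rfl (setLIntegral_mono' measurableSet_Ioc fun τ hτ => ?_)
        have hτ0 : 0 < τ := by have := hτ.1; linarith
        have hm : MeasurableSet ((fun p : Eu m => τ⁻¹ • p) ⁻¹' N) := (measurable_const_smul τ⁻¹) hNm
        have : ∫⁻ p, {q : Eu m × ℝ | q.2⁻¹ • q.1 ∈ N}.indicator 1 (p, τ)
          ∂(μH[(m : ℝ)] : Measure (Eu m)) = (μH[(m : ℝ)] : Measure (Eu m)) ((τ⁻¹ • ·) ⁻¹' N) := by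
          rw [← lintegral_indicator_one hm]; rfl
        rw [this, Measure.addHaar_preimage_smul _ (inv_ne_zero hτ0.ne')]
        refine mul_le_of_le_one_left zero_le ?_
        rw [← ENNReal.ofReal_one]
        refine ENNReal.ofReal_le_ofReal ?_
        rw [inv_pow, inv_inv, abs_of_nonneg (by positivity)]
        exact pow_le_one₀ hτ0.le hτ.2
    _ = ENNReal.ofReal t * (Λ * (μH[(m : ℝ)] : Measure (Eu m)) N) := by
        rw [setLIntegral_const, Real.volume_Ioc, show 1 - (1 - t) = t by ring]; ring
    _ ≤ _ := by gcongr

end cone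

section upper
variable {m : ℕ} {K : Set (Eu (m + 1))}

lemma shell_le (hK : SymBody K) {t : ℝ} (ht0 : 0 < t) (ht1 : t < 1) :
    kap m • (((volume : Measure (Eu (m + 1))).restrict (Shell K t)).map (radp K)) ≤
      ENNReal.ofReal t • (HK K).withDensity fun x => ENNReal.ofReal (suppFun K (nu K x)) := by
  obtain ⟨R, hR0, hR⟩ := hK.exists_R
  obtain ⟨d, hd1, hd⟩ := exists_dense_sphere m
  have := HK_finite hK
  have hnu := measurable_nu hK
  have hhm : Measurable fun x => suppFun K (nu K x) :=
    (suppFun_continuous hK.cpt hK.ne).measurable.comp hnu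
  have hrm := radp_meas hK
  have hsm := shell_meas hK t
  have happ : ∀ B : Set (Eu (m + 1)), MeasurableSet B →
      (kap m • (((volume : Measure (Eu (m + 1))).restrict (Shell K t)).map (radp K))) B =
      kap m * volume (Shell K t ∩ radp K ⁻¹' B) := by
    intro B hB
    rw [Measure.smul_apply, Measure.map_apply hrm hB, Measure.restrict_apply (hrm hB), inter_comm]
    rfl
  have step : ∀ δ : ℝ, 0 < δ → δ < 1 →
      kap m • (((volume : Measure (Eu (m + 1))).restrict (Shell K t)).map (radp K)) ≤
      ENNReal.ofReal t • (HK K).withDensity fun x =>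
        ENNReal.ofReal (suppFun K (nu K x) + (R * δ + δ / (1 - δ) * R)) := by
    intro δ hδ0 hδ1
    have hNm : ∀ i, MeasurableSet (NI K (closedBall (d i) δ ∩ sphere 0 1)) := fun i =>
      (hK.isClosed_NI ((isCompact_closedBall _ _).inter_right isClosed_sphere)).measurableSet
    refine measure_le_of_cover (A := fun i => NI K (closedBall (d i) δ ∩ sphere 0 1)) hNm ?_ ?_
    · rw [happ _ (MeasurableSet.iUnion hNm).compl]
      have : Shell K t ∩ radp K ⁻¹' (⋃ i, NI K (closedBall (d i) δ ∩ sphere 0 1))ᶜ = ∅ := by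
        rw [eq_empty_iff_forall_notMem]
        rintro z ⟨h1, h2⟩
        have h3 := radp_frontier hK ht1 h1
        obtain ⟨ν, h4, h5⟩ := hK.exists_normal h3
        obtain ⟨i, hi⟩ := hd δ hδ0 ν h4
        refine h2 (mem_iUnion.2 ⟨i, h3, ν, ⟨?_, by simpa using h4⟩, h5⟩)
        rw [mem_closedBall, dist_eq_norm]; exact hi.le
      rw [this, measure_empty, mul_zero]
    · intro i B hBi hB
      rw [happ B hB, Measure.smul_apply, smul_eq_mul]
      refine (cone_le hK (hd1 i) hδ0.le hδ1 hR0 hR hB (fun x hx => ?_) ht0 ht1).trans ?_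
      · obtain ⟨h1, ν, h2, h3⟩ := hBi hx
        refine ⟨hK.frontier_sub h1, ν, h3, ?_⟩
        simpa [dist_eq_norm] using h2.1
      · refine mul_le_mul' le_rfl ?_
        have hHB : (μH[(m : ℝ)] : Measure (Eu (m + 1))) B ≤ HK K B := by
          rw [HK, Measure.restrict_apply hB]
          refine (measure_mono (t := (B ∩ Reg K) ∪ (frontier K \ Reg K)) fun x hx => ?_).trans
            ((measure_union_le _ _).trans (by rw [reg_null hK, add_zero]))
          by_cases h : x ∈ Reg K
          · exact Or.inl ⟨hx, h⟩
          · exact Or.inr ⟨(hBi hx).1, h⟩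
        refine (mul_le_mul' le_rfl hHB).trans ?_
        rw [withDensity_apply _ hB, ← setLIntegral_const]
        refine setLIntegral_mono_ae' hB ?_
        have hreg : ∀ᵐ x ∂(HK K), x ∈ Reg K := ae_restrict_mem measurableSet_Reg
        filter_upwards [hreg] with x hx hxB
        refine ENNReal.ofReal_le_ofReal ?_
        obtain ⟨h1, ν, h2, h3⟩ := hBi hxB
        have hν := nu_unique hK hx (by simpa using h2.2) h3
        have h4 := suppFun_lip hK.cpt hK.ne hR (d i) ν
        have h5 : ‖d i - ν‖ ≤ δ := by
          have := h2.1
          rw [mem_closedBall, dist_eq_norm] at this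
          rwa [norm_sub_rev]
        have h6 : R * ‖d i - ν‖ ≤ R * δ := by gcongr
        rw [← hν]
        linarith
  refine Measure.le_iff.2 fun B hB => ?_
  have hl : Tendsto (fun δ : ℝ => ENNReal.ofReal t * ((∫⁻ x in B, ENNReal.ofReal (suppFun K (nu K x)) ∂(HK K)) +
      ENNReal.ofReal (R * δ + δ / (1 - δ) * R) * HK K B)) (𝓝[>] 0)
      (𝓝 (ENNReal.ofReal t * ((∫⁻ x in B, ENNReal.ofReal (suppFun K (nu K x)) ∂(HK K)) +
      ENNReal.ofReal 0 * HK K B))) := by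
    refine ENNReal.Tendsto.const_mul (Tendsto.add tendsto_const_nhds
      (ENNReal.Tendsto.mul_const (ENNReal.tendsto_ofReal ?_) (Or.inr (measure_ne_top _ _))))
      (Or.inr ENNReal.ofReal_ne_top)
    have : ContinuousAt (fun δ : ℝ => R * δ + δ / (1 - δ) * R) 0 := by
      refine ContinuousAt.add (by fun_prop) (ContinuousAt.mul
        (continuousAt_id.div (by fun_prop) (by norm_num)) continuousAt_const)
    have := this.tendsto
    simp only [zero_div, mul_zero, zero_mul, add_zero] at this
    exact this.mono_left nhdsWithin_le_nhds
  rw [ENNReal.ofReal_zero, zero_mul, add_zero] at hl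
  rw [Measure.smul_apply (ENNReal.ofReal t), withDensity_apply _ hB, smul_eq_mul]
  refine ge_of_tendsto hl ?_
  have e1 : ∀ᶠ t : ℝ in 𝓝[>] 0, t < 1 := nhdsWithin_le_nhds (gt_mem_nhds one_pos)
  filter_upwards [e1, self_mem_nhdsWithin] with δ h1 h3
  refine (step δ h3 h1 B).trans ?_
  rw [Measure.smul_apply, withDensity_apply _ hB, smul_eq_mul]
  refine mul_le_mul' le_rfl ?_
  refine (lintegral_mono fun x => ENNReal.ofReal_add_le).trans ?_
  rw [lintegral_add_right _ measurable_const, setLIntegral_const]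

lemma rho_radp (hK : SymBody K) {R t : ℝ} (hR0 : 0 < R) (hR : K ⊆ closedBall 0 R) (ht1 : t < 1)
    {z : Eu (m + 1)} (hz : z ∈ Shell K t) :
    rho (m + 1) z ≤ Real.exp (R ^ 2 * t) * rho (m + 1) (radp K z) := by
  have hx : ‖radp K z‖ ≤ R := by
    simpa using hR (hK.frontier_sub (radp_frontier hK ht1 hz))
  obtain ⟨h1, h2⟩ := hz
  have hg : 0 < gauge K z := by linarith
  have hzx : z = gauge K z • radp K z := by rw [radp, smul_inv_smul₀ hg.ne']
  have hn : ‖z‖ = gauge K z * ‖radp K z‖ := by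
    conv_lhs => rw [hzx]
    rw [norm_smul, Real.norm_of_nonneg hg.le]
  unfold rho
  rw [mul_left_comm, ← Real.exp_add]
  gcongr
  rw [hn]
  set g := gauge K z
  set q := ‖radp K z‖
  have hq0 : 0 ≤ q := norm_nonneg _
  have e1 : 1 - g ^ 2 ≤ 2 * t := by nlinarith
  have e2 : q ^ 2 ≤ R ^ 2 := by gcongr
  have e3 : 0 ≤ 1 - g ^ 2 := by nlinarith
  have e4 : q ^ 2 * (1 - g ^ 2) ≤ R ^ 2 * (2 * t) := by gcongr
  nlinarith

lemma shell_gam (hK : SymBody K) {R t : ℝ} (hR0 : 0 < R) (hR : K ⊆ closedBall 0 R) (ht0 : 0 < t)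
    (ht1 : t < 1) : kap m * gam (m + 1) (Shell K t) ≤
      ENNReal.ofReal (t * Real.exp (R ^ 2 * t)) * ∫⁻ v, ENNReal.ofReal (suppFun K v) ∂(TK K) := by
  have hnu := measurable_nu hK
  have hcm : Measurable fun v => ENNReal.ofReal (suppFun K v) :=
    (suppFun_continuous hK.cpt hK.ne).measurable.ennreal_ofReal
  have hrho : Measurable fun x => ENNReal.ofReal (rho (m + 1) x) :=
    (rho_cont (m + 1)).measurable.ennreal_ofReal
  have hrm := radp_meas hK
  have hsm := shell_meas hK t
  have hrr : Measurable fun z => ENNReal.ofReal (rho (m + 1) (radp K z)) := hrho.comp hrm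
  have hcn : Measurable fun x => ENNReal.ofReal (suppFun K (nu K x)) := hcm.comp hnu
  have h1 : gam (m + 1) (Shell K t) ≤ ENNReal.ofReal (Real.exp (R ^ 2 * t)) *
      ∫⁻ x, ENNReal.ofReal (rho (m + 1) x) ∂(((volume : Measure (Eu (m + 1))).restrict (Shell K t)).map (radp K)) := by
    rw [gam, withDensity_apply _ hsm, lintegral_map hrho hrm, ← lintegral_const_mul _ hrr]
    refine setLIntegral_mono' hsm fun z hz => ?_
    rw [← ENNReal.ofReal_mul (Real.exp_pos _).le]
    exact ENNReal.ofReal_le_ofReal (rho_radp hK hR0 hR ht1 hz)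
  have h2 : ∫⁻ v, ENNReal.ofReal (suppFun K v) ∂(TK K) =
      ∫⁻ x, ENNReal.ofReal (rho (m + 1) x) ∂((HK K).withDensity fun x => ENNReal.ofReal (suppFun K (nu K x))) := by
    rw [TK, lintegral_map hcm hnu, sigK, lintegral_withDensity_eq_lintegral_mul _ hrho hcn,
      lintegral_withDensity_eq_lintegral_mul _ hcn hrho]
    simp only [Pi.mul_apply, mul_comm]
  have h3 := lintegral_mono' (shell_le hK ht0 ht1) (le_refl fun x => ENNReal.ofReal (rho (m + 1) x))
  rw [lintegral_smul_measure, lintegral_smul_measure, ← h2] at h3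
  calc kap m * gam (m + 1) (Shell K t) ≤ kap m * (ENNReal.ofReal (Real.exp (R ^ 2 * t)) *
      ∫⁻ x, ENNReal.ofReal (rho (m + 1) x) ∂(((volume : Measure (Eu (m + 1))).restrict (Shell K t)).map (radp K))) := by
        gcongr
    _ = ENNReal.ofReal (Real.exp (R ^ 2 * t)) * (kap m •
      ∫⁻ x, ENNReal.ofReal (rho (m + 1) x) ∂(((volume : Measure (Eu (m + 1))).restrict (Shell K t)).map (radp K))) := by
        rw [ENNReal.smul_def, smul_eq_mul]; ring
    _ ≤ _ := mul_le_mul' le_rfl h3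
    _ = _ := by rw [ENNReal.ofReal_mul ht0.le, smul_eq_mul]; ring

lemma K_sub_shell (hK : SymBody K) {t : ℝ} (ht1 : t < 1) : K ⊆ ((1 - t) • K) ∪ Shell K t := by
  intro z hz
  have hp : 0 < 1 - t := by linarith
  by_cases h : 1 - t < gauge K z
  · exact Or.inr ⟨h, gauge_le_one_of_mem hz⟩
  · left
    push Not at h
    rw [mem_smul_set_iff_inv_smul_mem₀ hp.ne']
    rw [← hK.cpt.isClosed.closure_eq,
      ← gauge_le_one_iff_mem_closure hK.conv (mem_interior_iff_mem_nhds.1 hK.int),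
      gauge_smul_of_nonneg (by positivity), smul_eq_mul, inv_mul_le_iff₀ hp]
    simpa using h

lemma suppFun_smul (hK : SymBody K) {c : ℝ} (hc : 0 ≤ c) (v : Eu (m + 1)) :
    suppFun (c • K) v ≤ c * suppFun K v := by
  refine suppFun_le (hK.ne.smul_set) ?_
  rintro _ ⟨x, hx, rfl⟩
  simp only
  rw [real_inner_smul_left]
  exact mul_le_mul_of_nonneg_left (le_suppFun hK.cpt hx v) hc

lemma upper_final {μ : Measure (Eu (m + 1))} [IsFiniteMeasure μ] {α : ℝ} (hα : 0 < α) (hα1 : α < 1)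
    (hsph : μ (sphere (0 : Eu (m + 1)) 1)ᶜ = 0)
    (hK : SymBody K) (hpos : 0 < (gam (m + 1) K).toReal) (hmax : IsMaxB μ α (kap m) K) :
    ∫⁻ v, ENNReal.ofReal (suppFun K v) ∂(TK K) ≠ ∞ ∧
    ∫ v, suppFun K v ∂μ ≤ (gam (m + 1) K).toReal ^ (α - 1) *
      (∫⁻ v, ENNReal.ofReal (suppFun K v) ∂(TK K)).toReal := by
  obtain ⟨R, hR0, hR⟩ := hK.exists_R
  have := sigK_finite hK
  have hnu := measurable_nu hK
  have hcm : Measurable fun v => ENNReal.ofReal (suppFun K v) :=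
    (suppFun_continuous hK.cpt hK.ne).measurable.ennreal_ofReal
  have hfin : ∫⁻ v, ENNReal.ofReal (suppFun K v) ∂(TK K) ≠ ∞ := by
    rw [TK, lintegral_map hcm hnu]
    refine ne_top_of_le_ne_top (b := ∫⁻ x, ENNReal.ofReal R ∂(sigK K)) ?_ ?_
    · rw [lintegral_const]; exact ENNReal.mul_ne_top ENNReal.ofReal_ne_top (measure_ne_top _ _)
    · refine lintegral_mono fun x => ENNReal.ofReal_le_ofReal ?_
      refine (abs_le.1 (supp_abs_le hK.cpt hK.ne hR (nu K x))).2.trans ?_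
      have : ‖nu K x‖ ≤ 1 := by
        by_cases hx : x ∈ Reg K
        · exact (nu_spec hK hx).1.le
        · rw [nu, indicator_of_notMem hx]; simp
      nlinarith
  refine ⟨hfin, ?_⟩
  set I := (∫⁻ v, ENNReal.ofReal (suppFun K v) ∂(TK K)).toReal with hI
  have hI0 : 0 ≤ I := ENNReal.toReal_nonneg
  set a := (gam (m + 1) K).toReal with ha
  set κ : ℝ := (kap m : ℝ) with hκ
  have hκp : 0 < κ := by exact_mod_cast kap_pos m
  set H := ∫ v, suppFun K v ∂μ with hH
  have main : ∀ t : ℝ, 0 < t → t < 1 → 0 < a - t * (Real.exp (R ^ 2 * t) * I / κ) →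
      H ≤ (a - t * (Real.exp (R ^ 2 * t) * I / κ)) ^ (α - 1) * (Real.exp (R ^ 2 * t) * I) := by
    intro t ht0 ht1 hlow
    set b := (gam (m + 1) ((1 - t) • K)).toReal with hb
    have hsh : κ * (a - b) ≤ t * Real.exp (R ^ 2 * t) * I := by
      have h1 : gam (m + 1) K ≤ gam (m + 1) ((1 - t) • K) + gam (m + 1) (Shell K t) :=
        (measure_mono (K_sub_shell hK ht1)).trans (measure_union_le _ _)
      have h2 := ENNReal.toReal_mono
        (ENNReal.add_ne_top.2 ⟨measure_ne_top _ _, measure_ne_top _ _⟩) h1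
      rw [ENNReal.toReal_add (measure_ne_top _ _) (measure_ne_top _ _)] at h2
      have h3 := ENNReal.toReal_mono (ENNReal.mul_ne_top ENNReal.ofReal_ne_top hfin)
        (shell_gam hK hR0 hR ht0 ht1)
      rw [ENNReal.toReal_mul, ENNReal.toReal_mul, ENNReal.toReal_ofReal (by positivity)] at h3
      have h4 : κ * (gam (m + 1) (Shell K t)).toReal ≤ t * Real.exp (R ^ 2 * t) * I := h3
      have h5 : κ * (a - b) ≤ κ * (gam (m + 1) (Shell K t)).toReal := by
        gcongr; linarith
      linarith
    have hbl : a - t * (Real.exp (R ^ 2 * t) * I / κ) ≤ b := by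
      have : a - b ≤ t * (Real.exp (R ^ 2 * t) * I / κ) := by
        rw [mul_div_assoc', le_div_iff₀ hκp]; linarith
      linarith
    have hbp : 0 < b := hlow.trans_le hbl
    have hct : IsCompact ((1 - t) • K) := hK.cpt.smul _
    have hJ := hmax ((1 - t) • K) hct ?_ hK.ne.smul_set
    · have hs : ∫ v, suppFun ((1 - t) • K) v ∂μ ≤ (1 - t) * H := by
        rw [hH, ← integral_const_mul]
        exact integral_mono (int_supp hsph hct hK.ne.smul_set)
          ((int_supp hsph hK.cpt hK.ne).const_mul _) (suppFun_smul hK (by linarith))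
      have htan := rpow_tangent hpos.le hbp hα hα1.le
      have h1 : t * H ≤ κ / α * (a ^ α - b ^ α) := by
        have : κ / α * (a ^ α - b ^ α) = κ / α * a ^ α - κ / α * b ^ α := by ring
        linarith
      have h2 : κ / α * (a ^ α - b ^ α) ≤ κ / α * (α * b ^ (α - 1) * (a - b)) := by
        gcongr; linarith
      have h3 : κ / α * (α * b ^ (α - 1) * (a - b)) = b ^ (α - 1) * (κ * (a - b)) := by
        field_simp
      have h4 : b ^ (α - 1) * (κ * (a - b)) ≤ b ^ (α - 1) * (t * Real.exp (R ^ 2 * t) * I) := by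
        gcongr
      have h5 : b ^ (α - 1) ≤ (a - t * (Real.exp (R ^ 2 * t) * I / κ)) ^ (α - 1) :=
        Real.rpow_le_rpow_of_nonpos hlow hbl (by linarith)
      have h6 : b ^ (α - 1) * (t * Real.exp (R ^ 2 * t) * I) ≤
        (a - t * (Real.exp (R ^ 2 * t) * I / κ)) ^ (α - 1) * (t * Real.exp (R ^ 2 * t) * I) := by
        gcongr
      have h7 : t * H ≤ t * ((a - t * (Real.exp (R ^ 2 * t) * I / κ)) ^ (α - 1) *
          (Real.exp (R ^ 2 * t) * I)) := by
        calc t * H ≤ (a - t * (Real.exp (R ^ 2 * t) * I / κ)) ^ (α - 1) * (t * Real.exp (R ^ 2 * t) * I) := by linarith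
          _ = _ := by ring
      exact le_of_mul_le_mul_left h7 ht0
    · rintro _ ⟨x, hx, rfl⟩
      exact ⟨-x, hK.sym x hx, by simp⟩
  have hlow : Tendsto (fun t : ℝ => a - t * (Real.exp (R ^ 2 * t) * I / κ)) (𝓝[>] 0) (𝓝 a) := by
    have : Continuous fun t : ℝ => a - t * (Real.exp (R ^ 2 * t) * I / κ) := by fun_prop
    have := this.tendsto 0
    simp only [zero_mul, sub_zero] at this
    exact this.mono_left nhdsWithin_le_nhds
  have hl2 : Tendsto (fun t : ℝ => Real.exp (R ^ 2 * t) * I) (𝓝[>] 0) (𝓝 I) := by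
    have : Continuous fun t : ℝ => Real.exp (R ^ 2 * t) * I := by fun_prop
    have := this.tendsto 0
    simp only [mul_zero, Real.exp_zero, one_mul] at this
    exact this.mono_left nhdsWithin_le_nhds
  have hl := (hlow.rpow_const (p := α - 1) (Or.inl hpos.ne')).mul hl2
  refine ge_of_tendsto hl ?_
  have e1 : ∀ᶠ t : ℝ in 𝓝[>] 0, t < 1 := nhdsWithin_le_nhds (gt_mem_nhds one_pos)
  filter_upwards [e1, self_mem_nhdsWithin, hlow.eventually (lt_mem_nhds hpos)] with t h1 h2 h3
  exact main t h2 h1 h3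

end upper

/-- Normalized even Gaussian Minkowski problem: for a finite even Borel measure `μ` on the
sphere not concentrated in any closed hemisphere and `0 < α < 1/n`, there is an
origin-symmetric convex body `K` with `μ = γₙ(K)^{α-1} S_{γₙ,K}`. -/
theorem normalized_gaussian_minkowski_existence
    (n : ℕ) (hn : 2 ≤ n) (α : ℝ) (hα : 0 < α) (hαn : α < 1 / n)
    (μ : Measure (Eu n)) [IsFiniteMeasure μ]
    (hsph : μ (sphere (0 : Eu n) 1)ᶜ = 0)
    (heven : ∀ η : Set (Eu n), MeasurableSet η → μ (-η) = μ η)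
    (hhemi : ∀ u : Eu n, ‖u‖ = 1 → 0 < ∫ v, max ⟪u, v⟫ 0 ∂μ) :
    ∃ K : Set (Eu n), IsConvexBody K ∧ K = -K ∧ (0 : Eu n) ∈ interior K ∧
      ∀ η ⊆ sphere (0 : Eu n) 1, MeasurableSet η →
        (μ η).toReal = gaussVol n K ^ (α - 1) * gaussSurf n K η := by
  obtain ⟨m, rfl⟩ : ∃ m, n = m + 1 := ⟨n - 1, by omega⟩
  have hα1 : α < 1 := by
    refine hαn.trans_le ?_
    rw [div_le_one (by positivity)]
    push_cast
    have : (0 : ℝ) ≤ m := Nat.cast_nonneg m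
    linarith
  have hkap : (0 : ℝ) < (kap m : ℝ) := kap_pos m
  obtain ⟨K, hK, hpos, hmax⟩ := exists_max (by omega) hα hαn hkap hsph hhemi
  have hlow := lower_final hα hα1 hsph heven hK hpos hmax
  obtain ⟨hfin, hup⟩ := upper_final hα hα1 hsph hK hpos hmax
  set a := (gam (m + 1) K).toReal with ha
  have hc : ENNReal.ofReal (a ^ (α - 1)) * ENNReal.ofReal (a ^ (1 - α)) = 1 := by
    rw [← ENNReal.ofReal_mul (by positivity), ← Real.rpow_add hpos]
    simp
  have hc0 : 0 ≤ a ^ (α - 1) := by positivity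
  set T : Measure (Eu (m + 1)) := ENNReal.ofReal (a ^ (α - 1)) • TK K with hT
  have hTle : T ≤ μ := by
    intro s
    have := hlow s
    rw [Measure.smul_apply, smul_eq_mul] at this
    calc T s = ENNReal.ofReal (a ^ (α - 1)) * TK K s := by rw [hT, Measure.smul_apply, smul_eq_mul]
      _ ≤ ENNReal.ofReal (a ^ (α - 1)) * (ENNReal.ofReal (a ^ (1 - α)) * μ s) := by gcongr
      _ = μ s := by rw [← mul_assoc, hc, one_mul]
  have : IsFiniteMeasure T := isFiniteMeasure_of_le μ hTle
  have hae := ae_sph hsph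
  have hcont := suppFun_continuous hK.cpt hK.ne
  have hcm : Measurable fun v => ENNReal.ofReal (suppFun K v) := hcont.measurable.ennreal_ofReal
  have hintg : ∫⁻ v, ENNReal.ofReal (suppFun K v) ∂μ ≤ ∫⁻ v, ENNReal.ofReal (suppFun K v) ∂T := by
    rw [← ofReal_integral_eq_lintegral_ofReal (int_supp hsph hK.cpt hK.ne)
      (by filter_upwards [hae] with v hv using (hK.suppFun_pos hv).le), hT, lintegral_smul_measure,
      smul_eq_mul]
    refine (ENNReal.ofReal_le_ofReal hup).trans ?_
    rw [ENNReal.ofReal_mul hc0, ENNReal.ofReal_toReal hfin]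
  have hfT : ∫⁻ v, ENNReal.ofReal (suppFun K v) ∂T ≠ ∞ := by
    rw [hT, lintegral_smul_measure, smul_eq_mul]
    exact ENNReal.mul_ne_top ENNReal.ofReal_ne_top hfin
  have hadd := Measure.sub_add_cancel_of_le hTle
  have hD0 : ∫⁻ v, ENNReal.ofReal (suppFun K v) ∂(μ - T) = 0 := by
    have h := hintg
    rw [← hadd, lintegral_add_measure] at h
    by_contra hne
    have h2 := ENNReal.lt_add_right hfT hne
    exact absurd (h2.trans_le ((add_comm _ _).trans_le h)) (lt_irrefl _)
  have hDz : μ - T = 0 := by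
    rw [lintegral_eq_zero_iff hcm] at hD0
    have hae2 : ∀ᵐ v ∂(μ - T), ‖v‖ = 1 := (Measure.absolutelyContinuous_of_le Measure.sub_le) hae
    rw [← ae_eq_bot, ← Filter.eventually_false_iff_eq_bot]
    filter_upwards [hD0, hae2] with v h1 h2
    have := hK.suppFun_pos h2
    simp only [Pi.zero_apply, ENNReal.ofReal_eq_zero] at h1
    linarith
  have hTe : T = μ := by rw [← hadd, hDz, zero_add]
  refine ⟨K, ⟨hK.conv, hK.cpt, ⟨0, hK.int⟩⟩, ?_, hK.int, fun η hη hm => ?_⟩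
  · ext x
    rw [Set.mem_neg]
    exact ⟨hK.sym x, fun h => by simpa using hK.sym _ h⟩
  · rw [gaussVol_eq hK.cpt.measurableSet, gaussSurf_eq hK hη hm, ← ha, ← hTe, hT,
      Measure.smul_apply, smul_eq_mul, ENNReal.toReal_mul, ENNReal.toReal_ofReal hc0]
end
end

section
/- Let n ≥ 2 and let K_i be a sequence of convex bodies in ℝⁿ containing the origin in their interiors that converges in the Hausdorff metric to a convex body K_0 containing the origin in its interior. Then S_{γ_n,K_i} converges weakly to S_{γ_n,K_0}: for every continuous g : S^{n-1} → ℝ, ∫_{S^{n-1}} g dS_{γ_n,K_i} → ∫_{S^{n-1}} g dS_{γ_n,K_0}. -/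
open MeasureTheory Metric Set Filter
open scoped RealInnerProductSpace Topology Pointwise NNReal ENNReal

noncomputable section

namespace GSW

variable {n : ℕ}

theorem le_supp {K : Set (Eu n)} (hK : IsCompact K) {y : Eu n} (hy : y ∈ K) (v : Eu n) :
    ⟪y, v⟫ ≤ suppFun K v := by
  refine le_csSup ?_ ⟨y, hy, rfl⟩
  exact (hK.image (by fun_prop)).bddAbove

theorem supp_le {K : Set (Eu n)} (hK : K.Nonempty) {v : Eu n} {c : ℝ}
    (h : ∀ y ∈ K, ⟪y, v⟫ ≤ c) : suppFun K v ≤ c := by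
  refine csSup_le (hK.image _) ?_
  rintro _ ⟨y, hy, rfl⟩
  exact h y hy

/-- A functional as a unit vector. -/
theorem exists_unit (f : StrongDual ℝ (Eu n)) (hf : f ≠ 0) :
    ∃ (v : Eu n) (c : ℝ), 0 < c ∧ ‖v‖ = 1 ∧ ∀ x, f x = c * ⟪x, v⟫ := by
  set w := (InnerProductSpace.toDual ℝ (Eu n)).symm f with hw
  have hfw : ∀ x, f x = ⟪w, x⟫ := fun x => by simp [hw]
  have hw0 : w ≠ 0 := by
    intro h
    apply hf
    ext x
    simp [hfw, h]
  have hpos : 0 < ‖w‖ := norm_pos_iff.2 hw0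
  refine ⟨‖w‖⁻¹ • w, ‖w‖, hpos, ?_, fun x => ?_⟩
  · rw [norm_smul, norm_inv, norm_norm, inv_mul_cancel₀ hpos.ne']
  · rw [hfw, inner_smul_right, ← mul_assoc, mul_inv_cancel₀ hpos.ne', one_mul, real_inner_comm]

theorem exists_normal {K : Set (Eu n)} (hc : Convex ℝ K) (hK : IsCompact K)
    (h0 : (0 : Eu n) ∈ interior K) {x : Eu n} (hx : x ∈ frontier K) :
    ∃ v : Eu n, ‖v‖ = 1 ∧ ⟪x, v⟫ = suppFun K v := by
  obtain ⟨f, hf⟩ := geometric_hahn_banach_open_point hc.interior isOpen_interior hx.2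
  have hf0 : f ≠ 0 := by
    rintro rfl
    simpa using hf 0 h0
  obtain ⟨v, c, hcpos, hv, hfv⟩ := exists_unit f hf0
  refine ⟨v, hv, le_antisymm (le_supp hK (hK.isClosed.frontier_subset hx) v) ?_⟩
  refine supp_le ⟨0, interior_subset h0⟩ fun y hy => ?_
  have hy' : y ∈ closure (interior K) := by
    rw [hc.closure_interior_eq_closure_of_nonempty_interior ⟨0, h0⟩]
    exact subset_closure hy
  have hcl : IsClosed {y : Eu n | f y ≤ f x} := isClosed_le f.continuous continuous_const
  have := closure_minimal (fun a ha => (hf a ha).le) hcl hy'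
  simp only [hfv] at this
  exact le_of_mul_le_mul_left this hcpos

theorem mem_of_supp {K : Set (Eu n)} (hc : Convex ℝ K) (hK : IsCompact K)
    (h0 : K.Nonempty) {x : Eu n} (hx : ∀ v : Eu n, ‖v‖ = 1 → ⟪x, v⟫ ≤ suppFun K v) :
    x ∈ K := by
  by_contra hxK
  obtain ⟨f, u, hfu, hux⟩ := geometric_hahn_banach_closed_point hc hK.isClosed hxK
  have hf0 : f ≠ 0 := by
    rintro rfl
    obtain ⟨y, hy⟩ := h0
    have := hfu y hy
    simp at this hux
    linarith
  obtain ⟨v, c, hcpos, hv, hfv⟩ := exists_unit f hf0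
  have h1 : suppFun K v ≤ u / c := supp_le h0 fun y hy => by
    rw [le_div_iff₀ hcpos, mul_comm, ← hfv]
    exact (hfu y hy).le
  have h2 := hx v hv
  rw [hfv] at hux
  have : ⟪x, v⟫ ≤ u / c := h2.trans h1
  rw [le_div_iff₀ hcpos] at this
  linarith

theorem gaussMap_spec {K : Set (Eu n)} (hc : Convex ℝ K) (hK : IsCompact K)
    (h0 : (0 : Eu n) ∈ interior K) {x : Eu n} (hx : x ∈ frontier K) :
    ‖gaussMap K x‖ = 1 ∧ ⟪x, gaussMap K x⟫ = suppFun K (gaussMap K x) := by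
  have h := exists_normal hc hK h0 hx
  rw [gaussMap, dif_pos h]
  exact h.choose_spec

theorem inner_le_of_normal {K : Set (Eu n)} (hK : IsCompact K) {x v : Eu n}
    (h : ⟪x, v⟫ = suppFun K v) {z : Eu n} (hz : z ∈ K) : ⟪v, z - x⟫ ≤ 0 := by
  have := le_supp hK hz v
  rw [inner_sub_right, real_inner_comm, real_inner_comm x v]
  linarith

/-- Nearest point projection. -/
theorem exists_proj {K : Set (Eu n)} (hc : Convex ℝ K) (hK : IsCompact K) (hne : K.Nonempty) :
    ∃ p : Eu n → Eu n, LipschitzWith 1 p ∧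
      ∀ x y, y ∈ K → (∀ z ∈ K, ⟪x - y, z - y⟫ ≤ 0) → p x = y := by
  have hex : ∀ x : Eu n, ∃ y ∈ K, ∀ z ∈ K, ⟪x - y, z - y⟫ ≤ 0 := fun x => by
    obtain ⟨y, hy, h⟩ := exists_norm_eq_iInf_of_complete_convex hne hK.isComplete hc x
    exact ⟨y, hy, (norm_eq_iInf_iff_real_inner_le_zero hc hy).1 h⟩
  have key : ∀ x x' y y' : Eu n, y ∈ K → y' ∈ K → (∀ z ∈ K, ⟪x - y, z - y⟫ ≤ 0) →
      (∀ z ∈ K, ⟪x' - y', z - y'⟫ ≤ 0) → ‖y - y'‖ ≤ ‖x - x'‖ := by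
    intro x x' y y' hy hy' h h'
    have h1 := h y' hy'
    have h2 := h' y hy
    have h3 : ⟪x - x', y - y'⟫ = ‖y - y'‖ ^ 2 - ⟪x - y, y' - y⟫ - ⟪x' - y', y - y'⟫ := by
      rw [← real_inner_self_eq_norm_sq]
      simp only [inner_sub_left, inner_sub_right]
      ring
    have h4 := real_inner_le_norm (x - x') (y - y')
    by_contra! hlt
    have : 0 < ‖y - y'‖ := (norm_nonneg _).trans_lt hlt
    nlinarith
  choose p hp hp' using hex
  refine ⟨p, ?_, ?_⟩
  · refine LipschitzWith.of_dist_le_mul fun x x' => ?_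
    simpa [dist_eq_norm] using key x x' _ _ (hp x) (hp x') (hp' x) (hp' x')
  · intro x y hy h
    have := key x x _ _ (hp x) hy (hp' x) h
    simpa [sub_eq_zero] using this

theorem exists_exit {B : Set (Eu n)} (hB : IsCompact B) {x v : Eu n} (hx : x ∈ B)
    (hv : ‖v‖ = 1) : ∃ t : ℝ, 0 ≤ t ∧ x + t • v ∈ frontier B := by
  set T : Set ℝ := {t | 0 ≤ t ∧ x + t • v ∈ B} with hT
  have hcl : IsClosed T := by
    refine (isClosed_Ici (a := (0 : ℝ))).inter (hB.isClosed.preimage (f := fun t : ℝ => x + t • v) ?_)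
    fun_prop
  obtain ⟨R, hR⟩ := hB.isBounded.exists_norm_le
  have hbd : BddAbove T := by
    refine ⟨R + ‖x‖, ?_⟩
    rintro t ⟨ht, htB⟩
    have h1 := hR _ htB
    have h2 : ‖t • v‖ = t := by rw [norm_smul, hv, mul_one, Real.norm_of_nonneg ht]
    have h3 := norm_sub_le (x + t • v) x
    rw [add_sub_cancel_left, h2] at h3
    linarith
  have hne : T.Nonempty := ⟨0, le_rfl, by simpa using hx⟩
  have hmem := hcl.csSup_mem hne hbd
  refine ⟨sSup T, hmem.1, subset_closure hmem.2, fun hint => ?_⟩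
  have hcont : Tendsto (fun t : ℝ => x + t • v) (𝓝[>] (sSup T)) (𝓝 (x + (sSup T) • v)) := by
    refine Tendsto.mono_left ?_ nhdsWithin_le_nhds
    exact Continuous.tendsto (by fun_prop) _
  have hev := hcont.eventually (isOpen_interior.mem_nhds hint)
  obtain ⟨t, ht1, ht2⟩ := (hev.and self_mem_nhdsWithin).exists
  have ht2' : sSup T < t := ht2
  have : t ∈ T := ⟨hmem.1.trans ht2'.le, interior_subset ht1⟩
  exact absurd (le_csSup hbd this) (not_le.2 ht2')

theorem surf_mono {A B : Set (Eu n)} {d : ℝ} (hd : 0 ≤ d) (hc : Convex ℝ A) (hA : IsCompact A)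
    (h0 : (0 : Eu n) ∈ interior A) (hB : IsCompact B) (hAB : A ⊆ B) {δ : ℝ}
    (hδ : ∀ b ∈ B, ∃ a ∈ A, ‖b - a‖ ≤ δ) (F : Set (Eu n)) :
    μH[d] (frontier A ∩ F) ≤ μH[d] (frontier B ∩ {y | ∃ f ∈ F, ‖y - f‖ ≤ δ}) := by
  obtain ⟨p, hp, hpu⟩ := exists_proj hc hA ⟨0, interior_subset h0⟩
  have hsub : frontier A ∩ F ⊆ p '' (frontier B ∩ {y | ∃ f ∈ F, ‖y - f‖ ≤ δ}) := by
    rintro x ⟨hx, hxF⟩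
    have hxA := hA.isClosed.frontier_subset hx
    obtain ⟨v, hv, hxv⟩ := exists_normal hc hA h0 hx
    obtain ⟨t, ht, hy⟩ := exists_exit hB (hAB hxA) hv
    have hin : ∀ z ∈ A, ⟪x + t • v - x, z - x⟫ ≤ 0 := fun z hz => by
      rw [add_sub_cancel_left, inner_smul_left]
      exact mul_nonpos_of_nonneg_of_nonpos ht (inner_le_of_normal hA hxv hz)
    refine ⟨x + t • v, ⟨hy, x, hxF, ?_⟩, hpu _ _ hxA hin⟩
    obtain ⟨a, ha, hle⟩ := hδ _ (hB.isClosed.frontier_subset hy)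
    refine le_trans ?_ hle
    have h1 := hin a ha
    set y := x + t • v
    have h2 : ‖y - a‖ ^ 2 = ‖y - x‖ ^ 2 - 2 * ⟪y - x, a - x⟫ + ‖a - x‖ ^ 2 := by
      rw [← norm_sub_sq_real, sub_sub_sub_cancel_right]
    have h3 := sq_nonneg ‖a - x‖
    exact (sq_le_sq₀ (norm_nonneg _) (norm_nonneg _)).1 (by linarith)
  calc μH[d] (frontier A ∩ F) ≤ _ := measure_mono hsub
    _ ≤ _ := hp.hausdorffMeasure_image_le hd _
    _ = _ := by simp

/-- Extension of a partial coordinate vector by constants. -/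
def extMap (P : Fin n → Prop) [DecidablePred P] (c : Fin n → ℝ) (z : {i // P i} → ℝ) : Eu n :=
  WithLp.toLp 2 (fun i => if h : P i then z ⟨i, h⟩ else c i)

theorem extMap_lip (P : Fin n → Prop) [DecidablePred P] (c : Fin n → ℝ) :
    ∃ C : ℝ≥0, LipschitzWith C (extMap P c) := by
  have h1 : LipschitzWith 1 (fun (z : {i // P i} → ℝ) (i : Fin n) =>
      if h : P i then z ⟨i, h⟩ else c i) := by
    refine LipschitzWith.of_dist_le_mul fun z z' => ?_
    rw [NNReal.coe_one, one_mul, dist_pi_le_iff dist_nonneg]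
    intro i
    by_cases h : P i
    · simp only [h, dite_true]
      exact dist_le_pi_dist z z' ⟨i, h⟩
    · simp [h]
  exact ⟨_, (PiLp.lipschitzWith_toLp 2 (fun _ : Fin n => ℝ)).comp h1⟩

theorem extMap_mem (P : Fin n → Prop) [DecidablePred P] (c : Fin n → ℝ) {x : Eu n}
    (h : ∀ i, ¬ P i → x i = c i) : extMap P c (fun i => x i) = x := by
  ext i
  by_cases hi : P i
  · simp [extMap, hi]
  · simp [extMap, hi, h i hi]

theorem face_finite (hn : 2 ≤ n) (j : Fin n) (c R : ℝ) :
    μH[(n : ℝ) - 1] {x : Eu n | x j = c ∧ ∀ i, |x i| ≤ R} < ∞ := by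
  obtain ⟨C, hC⟩ := extMap_lip (n := n) (fun i => i ≠ j) (fun _ => c)
  have hcard : ((Fintype.card {i : Fin n // i ≠ j} : ℕ) : ℝ) = (n : ℝ) - 1 := by
    rw [Fintype.card_subtype_compl, Fintype.card_fin, Fintype.card_unique, Nat.cast_sub (by lia)]
    simp
  have hsub : {x : Eu n | x j = c ∧ ∀ i, |x i| ≤ R} ⊆
      extMap (n := n) (fun i => i ≠ j) (fun _ => c) '' Icc (fun _ => -R) (fun _ => R) := by
    rintro x ⟨hx, hR⟩
    refine ⟨fun i => x i, ⟨fun i => (abs_le.1 (hR i)).1, fun i => (abs_le.1 (hR i)).2⟩, ?_⟩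
    refine extMap_mem _ _ fun i hi => ?_
    rw [not_not.1 hi, hx]
  have hd : (0 : ℝ) ≤ (n : ℝ) - 1 := by
    have : (2 : ℝ) ≤ n := by exact_mod_cast hn
    linarith
  refine (measure_mono hsub).trans_lt ((hC.hausdorffMeasure_image_le hd _).trans_lt ?_)
  rw [← hcard, hausdorffMeasure_pi_real]
  refine ENNReal.mul_lt_top (ENNReal.rpow_lt_top_of_nonneg (by positivity) ENNReal.coe_ne_top) ?_
  exact isCompact_Icc.measure_lt_top

theorem flat_null (hn : 2 ≤ n) {j k : Fin n} (hjk : j ≠ k) (a b : ℝ) :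
    μH[(n : ℝ) - 1] {x : Eu n | x j = a ∧ x k = b} = 0 := by
  obtain ⟨C, hC⟩ := extMap_lip (n := n) (fun i => i ≠ j ∧ i ≠ k) (fun i => if i = j then a else b)
  have hcard : Fintype.card {i : Fin n // i ≠ j ∧ i ≠ k} < n - 1 := by
    have h1 : Fintype.card {i : Fin n // i ≠ j ∧ i ≠ k} = (({j, k} : Finset (Fin n))ᶜ).card := by
      rw [Fintype.card_subtype]
      congr 1
      ext i
      simp
    rw [h1, Finset.card_compl, Finset.card_pair hjk, Fintype.card_fin]
    lia
  have hsub : {x : Eu n | x j = a ∧ x k = b} ⊆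
      range (extMap (n := n) (fun i => i ≠ j ∧ i ≠ k) (fun i => if i = j then a else b)) := by
    rintro x ⟨hx, hx'⟩
    refine ⟨fun i => x i, extMap_mem _ _ fun i hi => ?_⟩
    by_cases h : i = j
    · subst h
      simp [hx]
    · have : i = k := by tauto
      subst this
      simp [h, hx']
  have hd : (n : ℝ) - 1 = (((n - 1 : ℕ) : ℝ≥0) : ℝ) := by
    rw [NNReal.coe_natCast, Nat.cast_sub (by lia)]
    simp
  refine measure_mono_null hsub ?_
  rw [hd]
  refine hausdorffMeasure_of_dimH_lt (hC.dimH_range_le.trans_lt ?_)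
  rw [Real.dimH_univ_pi]
  exact_mod_cast hcard

theorem surf_finite (hn : 2 ≤ n) {A : Set (Eu n)} (hc : Convex ℝ A) (hA : IsCompact A)
    (h0 : (0 : Eu n) ∈ interior A) : μH[(n : ℝ) - 1] (frontier A) < ∞ := by
  obtain ⟨R, hR⟩ := hA.isBounded.exists_norm_le
  set B : Set (Eu n) := {x | ∀ i, |x i| ≤ R} with hBdef
  have hBcl : IsClosed B := by
    have : B = ⋂ i, {x : Eu n | |x i| ≤ R} := by ext; simp [hBdef]
    rw [this]
    exact isClosed_iInter fun i => isClosed_le (by fun_prop) continuous_const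
  have hBbd : Bornology.IsBounded B := by
    refine isBounded_iff_forall_norm_le.2 ⟨Real.sqrt (∑ _i : Fin n, R ^ 2), fun x hx => ?_⟩
    rw [EuclideanSpace.norm_eq]
    refine Real.sqrt_le_sqrt (Finset.sum_le_sum fun i _ => ?_)
    have := hx i
    rw [Real.norm_eq_abs]
    exact pow_le_pow_left₀ (abs_nonneg _) this 2
  have hB : IsCompact B := isCompact_of_isClosed_isBounded hBcl hBbd
  have hAB : A ⊆ B := fun x hx i => (PiLp.norm_apply_le x i).trans (hR x hx)
  obtain ⟨D, hD⟩ := hBbd.exists_norm_le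
  have hd : (0 : ℝ) ≤ (n : ℝ) - 1 := by
    have : (2 : ℝ) ≤ n := by exact_mod_cast hn
    linarith
  have h1 := surf_mono hd hc hA h0 hB hAB (δ := D)
    (fun b hb => ⟨0, interior_subset h0, by simpa using hD b hb⟩) univ
  rw [inter_univ] at h1
  refine h1.trans_lt ?_
  have hsub : frontier B ∩ {y | ∃ f ∈ (univ : Set (Eu n)), ‖y - f‖ ≤ D} ⊆
      ⋃ j : Fin n, ({x : Eu n | x j = R ∧ ∀ i, |x i| ≤ R} ∪
        {x : Eu n | x j = -R ∧ ∀ i, |x i| ≤ R}) := by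
    rintro x ⟨hx, -⟩
    have hxB : ∀ i, |x i| ≤ R := hBcl.frontier_subset hx
    by_contra hcon
    simp only [mem_iUnion, not_exists, mem_union, not_or] at hcon
    apply hx.2
    rw [mem_interior]
    refine ⟨⋂ i, {x : Eu n | |x i| < R}, ?_, ?_, ?_⟩
    · intro y hy i
      exact (mem_iInter.1 hy i).le
    · exact isOpen_iInter_of_finite fun i => isOpen_lt (by fun_prop) continuous_const
    · refine mem_iInter.2 fun i => lt_of_le_of_ne (hxB i) fun h => ?_
      rcases eq_or_eq_neg_of_abs_eq h with h | h
      · exact (hcon i).1 ⟨h, hxB⟩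
      · exact (hcon i).2 ⟨h, hxB⟩
  refine (measure_mono hsub).trans_lt ((measure_iUnion_le _).trans_lt ?_)
  rw [tsum_fintype]
  refine ENNReal.sum_lt_top.2 fun j _ => ?_
  refine (measure_union_le _ _).trans_lt (ENNReal.add_lt_top.2 ⟨face_finite hn _ _ _, face_finite hn _ _ _⟩)

/-- Boundary points with more than one outer unit normal. -/
def Nsm (K : Set (Eu n)) : Set (Eu n) :=
  {x | x ∈ frontier K ∧ ∃ v w : Eu n, ‖v‖ = 1 ∧ ‖w‖ = 1 ∧ v ≠ w ∧
    ⟪x, v⟫ = suppFun K v ∧ ⟪x, w⟫ = suppFun K w}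

theorem supp_pos {K : Set (Eu n)} (hK : IsCompact K) (h0 : (0 : Eu n) ∈ interior K) :
    ∃ r > 0, ∀ v : Eu n, ‖v‖ = 1 → r ≤ suppFun K v := by
  obtain ⟨r, hr, hrK⟩ := Metric.isOpen_iff.1 isOpen_interior 0 h0
  refine ⟨r / 2, by positivity, fun v hv => ?_⟩
  have hm : (r / 2) • v ∈ K := by
    refine interior_subset (hrK ?_)
    rw [mem_ball_zero_iff, norm_smul, hv, mul_one, Real.norm_of_nonneg (by positivity)]
    linarith
  have := le_supp hK hm v
  rwa [inner_smul_left, real_inner_self_eq_norm_sq, hv, one_pow, mul_one] at this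

theorem exists_minor {v w : Eu n} (hv : ‖v‖ = 1) (hw : ‖w‖ = 1) (h1 : v ≠ w) (h2 : v ≠ -w) :
    ∃ j k : Fin n, v j * w k - v k * w j ≠ 0 := by
  by_contra! hcon
  have hv0 : v ≠ 0 := by
    rintro rfl
    simp at hv
  obtain ⟨j, hj⟩ : ∃ j, v j ≠ 0 := by
    by_contra! h
    exact hv0 (by ext i; simp [h i])
  have hwv : w = (w j / v j) • v := by
    ext k
    have := hcon j k
    simp only [PiLp.smul_apply, smul_eq_mul]
    field_simp
    linarith
  have hab : |w j / v j| = 1 := by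
    have := congrArg norm hwv
    rw [norm_smul, hv, hw, mul_one, Real.norm_eq_abs] at this
    exact this.symm
  rcases eq_or_eq_neg_of_abs_eq hab with h | h
  · rw [h, one_smul] at hwv
    exact h1 hwv.symm
  · rw [h, neg_one_smul] at hwv
    exact h2 (by rw [hwv, neg_neg])

theorem Nsm_null (hn : 2 ≤ n) {K : Set (Eu n)} (hc : Convex ℝ K) (hK : IsCompact K)
    (h0 : (0 : Eu n) ∈ interior K) : μH[(n : ℝ) - 1] (Nsm K) = 0 := by
  obtain ⟨p, hp, hpu⟩ := exists_proj hc hK ⟨0, interior_subset h0⟩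
  have hsub : Nsm K ⊆ ⋃ (jk : {q : Fin n × Fin n // q.1 ≠ q.2}), ⋃ (q : ℚ × ℚ),
      p '' {x : Eu n | x jk.1.1 = q.1 ∧ x jk.1.2 = q.2} := by
    rintro x ⟨hx, v, w, hv, hw, hvw, hxv, hxw⟩
    have hvw' : v ≠ -w := by
      obtain ⟨r, hr, hrK⟩ := supp_pos hK h0
      intro h
      have e1 := hrK v hv
      have e2 := hrK w hw
      rw [← hxv, h, inner_neg_right] at e1
      rw [← hxw] at e2
      linarith
    obtain ⟨j, k, hD⟩ := exists_minor hv hw hvw hvw'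
    have hjk : j ≠ k := by
      rintro rfl
      exact hD (by ring)
    set D := v j * w k - v k * w j with hDdef
    let M1 : ℝ × ℝ → ℝ := fun s => ((s.1 - x j) * w k - (s.2 - x k) * w j) / D
    let M2 : ℝ × ℝ → ℝ := fun s => (v j * (s.2 - x k) - v k * (s.1 - x j)) / D
    have ho : IsOpen {s : ℝ × ℝ | 0 < M1 s ∧ 0 < M2 s} :=
      (isOpen_lt (f := fun _ => (0 : ℝ)) (g := M1) continuous_const (by fun_prop)).inter
        (isOpen_lt (f := fun _ => (0 : ℝ)) (g := M2) continuous_const (by fun_prop))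
    have hne : {s : ℝ × ℝ | 0 < M1 s ∧ 0 < M2 s}.Nonempty := by
      refine ⟨(x j + v j + w j, x k + v k + w k), ?_, ?_⟩
      · have : M1 (x j + v j + w j, x k + v k + w k) = 1 := by
          simp only [M1]
          rw [div_eq_one_iff_eq hD, hDdef]
          ring
        rw [this]
        exact one_pos
      · have : M2 (x j + v j + w j, x k + v k + w k) = 1 := by
          simp only [M2]
          rw [div_eq_one_iff_eq hD, hDdef]
          ring
        rw [this]
        exact one_pos
    have hdense : DenseRange (Prod.map ((↑) : ℚ → ℝ) ((↑) : ℚ → ℝ)) :=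
      Rat.denseRange_cast.prodMap Rat.denseRange_cast
    obtain ⟨q, hq1, hq2⟩ := hdense.exists_mem_open ho hne
    set a := M1 (Prod.map (↑) (↑) q) with ha
    set b := M2 (Prod.map (↑) (↑) q) with hb
    refine mem_iUnion.2 ⟨⟨(j, k), hjk⟩, mem_iUnion.2 ⟨q, x + (a • v + b • w), ⟨?_, ?_⟩, ?_⟩⟩
    · simp only [PiLp.add_apply, PiLp.smul_apply, smul_eq_mul, ha, hb, M1, M2, Prod.map_fst,
        Prod.map_snd]
      field_simp
      rw [hDdef]
      ring
    · simp only [PiLp.add_apply, PiLp.smul_apply, smul_eq_mul, ha, hb, M1, M2, Prod.map_fst,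
        Prod.map_snd]
      field_simp
      rw [hDdef]
      ring
    · refine hpu _ _ (hK.isClosed.frontier_subset hx) fun z hz => ?_
      rw [add_sub_cancel_left, inner_add_left, inner_smul_left, inner_smul_left]
      have e1 := inner_le_of_normal hK hxv hz
      have e2 := inner_le_of_normal hK hxw hz
      have e3 := mul_nonpos_of_nonneg_of_nonpos hq1.le e1
      have e4 := mul_nonpos_of_nonneg_of_nonpos hq2.le e2
      exact add_nonpos e3 e4
  refine measure_mono_null hsub ?_
  refine measure_iUnion_null fun jk => measure_iUnion_null fun q => ?_
  have hd : (0 : ℝ) ≤ (n : ℝ) - 1 := by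
    have : (2 : ℝ) ≤ n := by exact_mod_cast hn
    linarith
  have := hp.hausdorffMeasure_image_le hd {x : Eu n | x jk.1.1 = q.1 ∧ x jk.1.2 = q.2}
  rw [flat_null hn jk.2, mul_zero] at this
  exact le_antisymm this zero_le

/-- Convergence of normals at smooth points. -/
theorem normal_tendsto {K : Set (Eu n)} (hK : IsCompact K) (hne : K.Nonempty)
    {L : ℕ → Set (Eu n)}
    (hL : ∀ ε > 0, ∀ᶠ k in atTop, ∀ u : Eu n, ‖u‖ = 1 → |suppFun (L k) u - suppFun K u| ≤ ε)
    {x : Eu n} (hxK : x ∈ frontier K) (hx : x ∉ Nsm K) {v : Eu n} (hv : ‖v‖ = 1)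
    (hxv : ⟪x, v⟫ = suppFun K v) {y w : ℕ → Eu n} (hy : Tendsto y atTop (𝓝 x))
    (hw : ∀ k, ‖w k‖ = 1) (hyw : ∀ k, ⟪y k, w k⟫ = suppFun (L k) (w k)) :
    Tendsto w atTop (𝓝 v) := by
  refine tendsto_of_subseq_tendsto fun ns hns => ?_
  obtain ⟨v', hv', φ, hφ, hlim⟩ := (isCompact_sphere (0 : Eu n) 1).tendsto_subseq
    (x := fun k => w (ns k)) (fun k => by simp [hw])
  refine ⟨φ, ?_⟩
  have hv'1 : ‖v'‖ = 1 := by simpa using hv'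
  have hsub : Tendsto (fun k => ns (φ k)) atTop atTop := hns.comp hφ.tendsto_atTop
  have hlim' : Tendsto (fun k => w (ns (φ k))) atTop (𝓝 v') := hlim
  have hinner : Tendsto (fun k => ⟪y (ns (φ k)), w (ns (φ k))⟫) atTop (𝓝 ⟪x, v'⟫) :=
    (hy.comp hsub).inner hlim'
  have hnormal : ⟪x, v'⟫ = suppFun K v' := by
    refine le_antisymm (le_supp hK (hK.isClosed.frontier_subset hxK) v') ?_
    refine supp_le hne fun z hz => ?_
    refine le_of_forall_pos_le_add fun ε hε => ?_
    have h1 : Tendsto (fun k => ⟪z, w (ns (φ k))⟫) atTop (𝓝 ⟪z, v'⟫) :=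
      tendsto_const_nhds.inner hlim'
    refine le_of_tendsto_of_tendsto h1 (hinner.add_const ε) ?_
    filter_upwards [hsub.eventually (hL ε hε)] with k hk
    have h2 := le_supp hK hz (w (ns (φ k)))
    have h3 := (abs_le.1 (hk _ (hw (ns (φ k))))).1
    rw [hyw]
    linarith
  have : v' = v := by
    by_contra hne'
    exact hx ⟨hxK, v', v, hv'1, hv, hne', hnormal, hxv⟩
  rw [← this]
  exact hlim'

theorem sandwich {K : ℕ → Set (Eu n)} {K₀ : Set (Eu n)}
    (hc : ∀ i, Convex ℝ (K i)) (hK : ∀ i, IsCompact (K i)) (h0 : ∀ i, (0 : Eu n) ∈ interior (K i))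
    (hc₀ : Convex ℝ K₀) (hK₀ : IsCompact K₀) (h0₀ : (0 : Eu n) ∈ interior K₀)
    (hL : ∀ ε > 0, ∀ᶠ k in atTop, ∀ u : Eu n, ‖u‖ = 1 → |suppFun (K k) u - suppFun K₀ u| ≤ ε)
    {s : ℝ} (hs : 0 < s) (hs1 : s < 1) :
    ∀ᶠ i in atTop, K i ⊆ (1 + s) • K₀ ∧ (1 - s) • K₀ ⊆ K i := by
  obtain ⟨r, hr, hrK⟩ := supp_pos hK₀ h0₀
  filter_upwards [hL (s * r) (by positivity)] with i hi
  constructor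
  · intro x hx
    rw [mem_smul_set_iff_inv_smul_mem₀ (by positivity)]
    refine mem_of_supp hc₀ hK₀ ⟨0, interior_subset h0₀⟩ fun v hv => ?_
    rw [inner_smul_left, RCLike.conj_to_real, inv_mul_le_iff₀ (by positivity)]
    have h1 := le_supp (hK i) hx v
    have h2 := (abs_le.1 (hi v hv)).2
    have h3 := hrK v hv
    nlinarith
  · rintro _ ⟨x, hx, rfl⟩
    refine mem_of_supp (hc i) (hK i) ⟨0, interior_subset (h0 i)⟩ fun v hv => ?_
    simp only [inner_smul_left, RCLike.conj_to_real]
    have h1 := le_supp hK₀ hx v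
    have h2 := (abs_le.1 (hi v hv)).1
    have h3 := hrK v hv
    nlinarith

theorem frontier_smul' {K : Set (Eu n)} {c : ℝ} (hc : c ≠ 0) :
    frontier (c • K) = c • frontier K :=
  ((Homeomorph.smulOfNeZero c hc).image_frontier K).symm

theorem interior_smul' {K : Set (Eu n)} {c : ℝ} (hc : c ≠ 0) (h0 : (0 : Eu n) ∈ interior K) :
    (0 : Eu n) ∈ interior (c • K) := by
  rw [interior_smul₀ hc]
  exact ⟨0, h0, by simp⟩

theorem coef_tendsto {d : ℝ} (hd : 0 ≤ d) (σ : ℝ) :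
    Tendsto (fun s : ℝ => ((‖1 + σ * s‖₊ ^ d : ℝ≥0) : ℝ≥0∞)) (𝓝[>] 0) (𝓝 1) := by
  have h : Continuous (fun s : ℝ => ((‖1 + σ * s‖₊ ^ d : ℝ≥0) : ℝ≥0∞)) := by
    refine ENNReal.continuous_coe.comp ((NNReal.continuous_rpow_const hd).comp ?_)
    fun_prop
  have h1 := (h.tendsto 0).mono_left (nhdsWithin_le_nhds (s := Ioi 0))
  simpa using h1

/-- Surface measure. -/
def sm (K : Set (Eu n)) : Measure (Eu n) := (μH[(n : ℝ) - 1]).restrict (frontier K)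

theorem sm_apply (K F : Set (Eu n)) : sm K F = μH[(n : ℝ) - 1] (frontier K ∩ F) := by
  rw [sm, Measure.restrict_apply' isClosed_frontier.measurableSet, inter_comm]

theorem sm_univ (K : Set (Eu n)) : sm K univ = μH[(n : ℝ) - 1] (frontier K) := by
  rw [sm_apply, inter_univ]

section seq

variable {K : ℕ → Set (Eu n)} {K₀ : Set (Eu n)}

theorem limsup_closed (hn : 2 ≤ n)
    (hc : ∀ i, Convex ℝ (K i)) (hK : ∀ i, IsCompact (K i)) (h0 : ∀ i, (0 : Eu n) ∈ interior (K i))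
    (hc₀ : Convex ℝ K₀) (hK₀ : IsCompact K₀) (h0₀ : (0 : Eu n) ∈ interior K₀)
    (hL : ∀ ε > 0, ∀ᶠ k in atTop, ∀ u : Eu n, ‖u‖ = 1 → |suppFun (K k) u - suppFun K₀ u| ≤ ε)
    {F : Set (Eu n)} (hF : IsClosed F) :
    limsup (fun i => sm (K i) F) atTop ≤ sm K₀ F := by
  have hd : (0 : ℝ) ≤ (n : ℝ) - 1 := by
    have : (2 : ℝ) ≤ n := by exact_mod_cast hn
    linarith
  obtain ⟨R, hRpos, hR⟩ := hK₀.isBounded.exists_pos_norm_le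
  have hfin : sm K₀ univ < ∞ := by
    rw [sm_univ]
    exact surf_finite hn hc₀ hK₀ h0₀
  have hlim : Tendsto (fun s : ℝ => ((‖1 + 1 * s‖₊ ^ ((n : ℝ) - 1) : ℝ≥0) : ℝ≥0∞) *
      sm K₀ (cthickening (3 * s * R) F)) (𝓝[>] 0) (𝓝 (1 * sm K₀ F)) := by
    refine ENNReal.Tendsto.mul (coef_tendsto hd 1) (Or.inl one_ne_zero) ?_ (Or.inr ENNReal.one_ne_top)
    have h1 := tendsto_measure_cthickening_of_isClosed (μ := sm K₀) (s := F)
      ⟨1, one_pos, ((measure_mono (subset_univ _)).trans_lt hfin).ne⟩ hF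
    refine h1.comp (Tendsto.mono_left ?_ (nhdsWithin_le_nhds (s := Ioi 0)))
    have h2 : Continuous (fun s : ℝ => 3 * s * R) := by fun_prop
    simpa using h2.tendsto 0
  rw [one_mul] at hlim
  refine ge_of_tendsto hlim ?_
  filter_upwards [Ioo_mem_nhdsGT (one_pos : (0 : ℝ) < 1)] with s hs
  obtain ⟨hs0, hs1⟩ := hs
  refine limsup_le_of_le (by isBoundedDefault) ?_
  filter_upwards [sandwich hc hK h0 hc₀ hK₀ h0₀ hL hs0 hs1] with i hi
  have hs' : (1 + s) ≠ 0 := by positivity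
  rw [sm_apply, sm_apply]
  have h1 := surf_mono hd (hc i) (hK i) (h0 i) (hK₀.smul (1 + s)) hi.1 (δ := 2 * s * R) (by
    rintro _ ⟨x, hx, rfl⟩
    refine ⟨(1 - s) • x, hi.2 ⟨x, hx, rfl⟩, ?_⟩
    have : (1 + s) • x - (1 - s) • x = (2 * s) • x := by module
    simp only [this]
    rw [norm_smul, Real.norm_of_nonneg (by positivity)]
    exact mul_le_mul_of_nonneg_left (hR x hx) (by positivity)) F
  refine h1.trans ?_
  have hsub : frontier ((1 + s) • K₀) ∩ {y | ∃ f ∈ F, ‖y - f‖ ≤ 2 * s * R} ⊆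
      (1 + s) • (frontier K₀ ∩ cthickening (3 * s * R) F) := by
    rw [frontier_smul' hs']
    rintro _ ⟨⟨x, hx, rfl⟩, f, hf, hle⟩
    refine ⟨x, ⟨hx, ?_⟩, rfl⟩
    refine mem_cthickening_of_dist_le x f _ F hf ?_
    rw [dist_eq_norm]
    have e1 : x - f = ((1 + s) • x - f) - s • x := by module
    have e2 : ‖s • x‖ ≤ s * R := by
      rw [norm_smul, Real.norm_of_nonneg hs0.le]
      exact mul_le_mul_of_nonneg_left (hR x (hK₀.isClosed.frontier_subset hx)) hs0.le
    rw [e1]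
    have e3 := norm_sub_le ((1 + s) • x - f) (s • x)
    have hle' : ‖(1 + s) • x - f‖ ≤ 2 * s * R := hle
    linarith
  refine (measure_mono hsub).trans ?_
  rw [Measure.hausdorffMeasure_smul₀ hd hs', one_mul]
  exact le_of_eq rfl

theorem mass_tendsto (hn : 2 ≤ n)
    (hc : ∀ i, Convex ℝ (K i)) (hK : ∀ i, IsCompact (K i)) (h0 : ∀ i, (0 : Eu n) ∈ interior (K i))
    (hc₀ : Convex ℝ K₀) (hK₀ : IsCompact K₀) (h0₀ : (0 : Eu n) ∈ interior K₀)
    (hL : ∀ ε > 0, ∀ᶠ k in atTop, ∀ u : Eu n, ‖u‖ = 1 → |suppFun (K k) u - suppFun K₀ u| ≤ ε) :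
    Tendsto (fun i => sm (K i) univ) atTop (𝓝 (sm K₀ univ)) := by
  have hd : (0 : ℝ) ≤ (n : ℝ) - 1 := by
    have : (2 : ℝ) ≤ n := by exact_mod_cast hn
    linarith
  refine tendsto_of_le_liminf_of_limsup_le ?_
    (limsup_closed hn hc hK h0 hc₀ hK₀ h0₀ hL isClosed_univ)
  have hlim : Tendsto (fun s : ℝ => ((‖1 + (-1) * s‖₊ ^ ((n : ℝ) - 1) : ℝ≥0) : ℝ≥0∞) *
      sm K₀ univ) (𝓝[>] 0) (𝓝 (1 * sm K₀ univ)) :=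
    ENNReal.Tendsto.mul_const (coef_tendsto hd (-1)) (Or.inl one_ne_zero)
  rw [one_mul] at hlim
  refine le_of_tendsto hlim ?_
  filter_upwards [Ioo_mem_nhdsGT (one_pos : (0 : ℝ) < 1)] with s hs
  obtain ⟨hs0, hs1⟩ := hs
  refine le_liminf_of_le (by isBoundedDefault) ?_
  filter_upwards [sandwich hc hK h0 hc₀ hK₀ h0₀ hL hs0 hs1] with i hi
  have hs' : (1 - s) ≠ 0 := by linarith
  obtain ⟨D, hD⟩ := (hK i).isBounded.exists_norm_le
  have h1 := surf_mono hd (hc₀.smul (1 - s)) (hK₀.smul (1 - s)) (interior_smul' hs' h0₀)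
    (hK i) hi.2 (δ := D) (fun b hb => ⟨0, interior_subset (interior_smul' hs' h0₀), by
      simpa using hD b hb⟩) univ
  rw [inter_univ, frontier_smul' hs', Measure.hausdorffMeasure_smul₀ hd hs'] at h1
  rw [sm_univ, sm_univ, show 1 + -1 * s = 1 - s by ring]
  exact h1.trans (measure_mono inter_subset_left)

theorem gaussMap_aemeasurable (hn : 2 ≤ n) (hc₀ : Convex ℝ K₀) (hK₀ : IsCompact K₀)
    (h0₀ : (0 : Eu n) ∈ interior K₀) : AEMeasurable (gaussMap K₀) (sm K₀) := by
  set N := toMeasurable μH[(n : ℝ) - 1] (Nsm K₀) with hN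
  have hN0 : μH[(n : ℝ) - 1] N = 0 := by
    rw [hN, measure_toMeasurable]
    exact Nsm_null hn hc₀ hK₀ h0₀
  have hcont : ContinuousOn (gaussMap K₀) (frontier K₀ \ N) := by
    intro x hx
    have hxN : x ∉ Nsm K₀ := fun h => hx.2 (subset_toMeasurable _ _ h)
    rw [continuousWithinAt_iff_continuousAt_domRestrict _ hx, ContinuousAt, tendsto_iff_seq_tendsto]
    intro y hy
    have hspec := gaussMap_spec hc₀ hK₀ h0₀ hx.1
    refine normal_tendsto hK₀ ⟨0, interior_subset h0₀⟩ (L := fun _ => K₀) ?_ hx.1 hxN hspec.1 hspec.2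
      (y := fun k => (y k : Eu n)) ?_ ?_ ?_
    · intro ε hε
      exact Eventually.of_forall fun k u _ => by simpa using hε.le
    · exact (continuous_subtype_val.tendsto _).comp hy
    · exact fun k => (gaussMap_spec hc₀ hK₀ h0₀ (y k).2.1).1
    · exact fun k => (gaussMap_spec hc₀ hK₀ h0₀ (y k).2.1).2
  have hm : MeasurableSet (frontier K₀ \ N) :=
    isClosed_frontier.measurableSet.diff (measurableSet_toMeasurable _ _)
  have h1 : AEMeasurable (gaussMap K₀) ((μH[(n : ℝ) - 1]).restrict (frontier K₀ \ N)) :=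
    hcont.aemeasurable hm
  rwa [Measure.restrict_congr_set (sdiff_null_ae_eq_self hN0)] at h1

theorem limsup_level (hn : 2 ≤ n)
    (hc : ∀ i, Convex ℝ (K i)) (hK : ∀ i, IsCompact (K i)) (h0 : ∀ i, (0 : Eu n) ∈ interior (K i))
    (hc₀ : Convex ℝ K₀) (hK₀ : IsCompact K₀) (h0₀ : (0 : Eu n) ∈ interior K₀)
    (hL : ∀ ε > 0, ∀ᶠ k in atTop, ∀ u : Eu n, ‖u‖ = 1 → |suppFun (K k) u - suppFun K₀ u| ≤ ε)
    (G : Eu n × Eu n → ℝ) (hG : Continuous G) (t : ℝ) :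
    limsup (fun i => sm (K i) {x | t ≤ G (x, gaussMap (K i) x)}) atTop ≤
      sm K₀ {x | t ≤ G (x, gaussMap K₀ x)} := by
  set A : ℕ → Set (Eu n) := fun N =>
    closure {y | ∃ i, N ≤ i ∧ y ∈ frontier (K i) ∧ t ≤ G (y, gaussMap (K i) y)} with hA
  have hAanti : Antitone A := fun N M hNM => closure_mono fun y ⟨i, hi, h⟩ => ⟨i, hNM.trans hi, h⟩
  have hfin : sm K₀ univ < ∞ := by
    rw [sm_univ]
    exact surf_finite hn hc₀ hK₀ h0₀
  have hlim : Tendsto (sm K₀ ∘ A) atTop (𝓝 (sm K₀ (⋂ N, A N))) :=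
    tendsto_measure_iInter_atTop (fun N => isClosed_closure.measurableSet.nullMeasurableSet) hAanti
      ⟨0, ((measure_mono (subset_univ _)).trans_lt hfin).ne⟩
  have h1 : limsup (fun i => sm (K i) {x | t ≤ G (x, gaussMap (K i) x)}) atTop ≤
      sm K₀ (⋂ N, A N) := by
    refine ge_of_tendsto' hlim fun N => ?_
    refine le_trans (limsup_le_limsup ?_ (by isBoundedDefault) (by isBoundedDefault))
      (limsup_closed hn hc hK h0 hc₀ hK₀ h0₀ hL (F := A N) isClosed_closure)
    filter_upwards [eventually_ge_atTop N] with i hi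
    rw [sm_apply, sm_apply]
    refine measure_mono ?_
    rintro y ⟨hy, hty⟩
    exact ⟨hy, subset_closure ⟨i, hi, hy, hty⟩⟩
  refine h1.trans (measure_mono_ae ?_)
  have hae1 : ∀ᵐ x ∂(sm K₀), x ∈ frontier K₀ := ae_restrict_mem isClosed_frontier.measurableSet
  have hae2 : ∀ᵐ x ∂(sm K₀), x ∉ Nsm K₀ := by
    refine ae_restrict_of_ae ?_
    exact measure_eq_zero_iff_ae_notMem.1 (Nsm_null hn hc₀ hK₀ h0₀)
  filter_upwards [hae1, hae2] with x hx hxN hxA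
  have hex : ∀ k : ℕ, ∃ y : Eu n, ∃ i, k ≤ i ∧ y ∈ frontier (K i) ∧
      t ≤ G (y, gaussMap (K i) y) ∧ dist x y < 1 / ((k : ℝ) + 1) := fun k => by
    obtain ⟨y, ⟨i, hi, hy, hty⟩, hd⟩ :=
      Metric.mem_closure_iff.1 (mem_iInter.1 hxA k) (1 / ((k : ℝ) + 1)) Nat.one_div_pos_of_nat
    exact ⟨y, i, hi, hy, hty, hd⟩
  choose y i hi hy hty hd using hex
  have hilim : Tendsto i atTop atTop := tendsto_atTop_mono hi tendsto_id
  have hylim : Tendsto y atTop (𝓝 x) := by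
    rw [tendsto_iff_dist_tendsto_zero]
    refine squeeze_zero (fun _ => dist_nonneg) (fun k => ?_) tendsto_one_div_add_atTop_nhds_zero_nat
    rw [dist_comm]
    exact (hd k).le
  have hspec := gaussMap_spec hc₀ hK₀ h0₀ hx
  have hν := normal_tendsto hK₀ ⟨0, interior_subset h0₀⟩ (L := fun k => K (i k))
    (fun ε hε => hilim.eventually (hL ε hε)) hx hxN hspec.1 hspec.2 hylim
    (fun k => (gaussMap_spec (hc _) (hK _) (h0 _) (hy k)).1)
    (fun k => (gaussMap_spec (hc _) (hK _) (h0 _) (hy k)).2)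
  have hGlim := (hG.tendsto (x, gaussMap K₀ x)).comp (hylim.prodMk_nhds hν)
  exact ge_of_tendsto' hGlim hty

theorem comp_aemeasurable (hn : 2 ≤ n) (hc₀ : Convex ℝ K₀) (hK₀ : IsCompact K₀)
    (h0₀ : (0 : Eu n) ∈ interior K₀) (G : Eu n × Eu n → ℝ) (hG : Continuous G) :
    AEMeasurable (fun x => G (x, gaussMap K₀ x)) (sm K₀) :=
  hG.measurable.comp_aemeasurable (aemeasurable_id.prodMk (gaussMap_aemeasurable hn hc₀ hK₀ h0₀))

theorem limsup_lint (hn : 2 ≤ n)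
    (hc : ∀ i, Convex ℝ (K i)) (hK : ∀ i, IsCompact (K i)) (h0 : ∀ i, (0 : Eu n) ∈ interior (K i))
    (hc₀ : Convex ℝ K₀) (hK₀ : IsCompact K₀) (h0₀ : (0 : Eu n) ∈ interior K₀)
    (hL : ∀ ε > 0, ∀ᶠ k in atTop, ∀ u : Eu n, ‖u‖ = 1 → |suppFun (K k) u - suppFun K₀ u| ≤ ε)
    {D : ℝ≥0∞} (hD : D ≠ ∞) (hmass : ∀ i, sm (K i) univ ≤ D)
    (G : Eu n × Eu n → ℝ) (hG : Continuous G) (hG0 : ∀ z, 0 ≤ G z) (C : ℝ) (hGC : ∀ z, G z ≤ C) :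
    limsup (fun i => ∫⁻ x, ENNReal.ofReal (G (x, gaussMap (K i) x)) ∂(sm (K i))) atTop ≤
      ∫⁻ x, ENNReal.ofReal (G (x, gaussMap K₀ x)) ∂(sm K₀) := by
  rw [lintegral_eq_lintegral_meas_le _ (Eventually.of_forall fun x => hG0 _)
    (comp_aemeasurable hn hc₀ hK₀ h0₀ G hG)]
  have e : ∀ i, ∫⁻ x, ENNReal.ofReal (G (x, gaussMap (K i) x)) ∂(sm (K i)) =
      ∫⁻ t in Ioi (0 : ℝ), sm (K i) {x | t ≤ G (x, gaussMap (K i) x)} := fun i =>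
    lintegral_eq_lintegral_meas_le _ (Eventually.of_forall fun x => hG0 _)
      (comp_aemeasurable hn (hc i) (hK i) (h0 i) G hG)
  simp only [e]
  refine (limsup_lintegral_le ((Iic C).indicator fun _ => D) (fun i => ?_) (fun i => ?_) ?_).trans ?_
  · refine Antitone.measurable fun s t hst => measure_mono fun x hx => ?_
    exact le_trans hst hx
  · refine Eventually.of_forall fun t => ?_
    by_cases ht : t ≤ C
    · rw [indicator_of_mem (show t ∈ Iic C from ht)]
      exact (measure_mono (subset_univ _)).trans (hmass i)
    · have : {x | t ≤ G (x, gaussMap (K i) x)} = ∅ := by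
        ext x
        simp only [mem_empty_iff_false, iff_false]
        intro hx
        exact ht (le_trans hx (hGC _))
      simp only [this, measure_empty]
      exact zero_le
  · rw [lintegral_indicator measurableSet_Iic, Measure.restrict_restrict measurableSet_Iic,
      setLIntegral_const, Iic_inter_Ioi]
    exact ENNReal.mul_ne_top hD (by simp)
  · exact lintegral_mono fun t => limsup_level hn hc hK h0 hc₀ hK₀ h0₀ hL G hG t

end seq

section final

variable {K : ℕ → Set (Eu n)} {K₀ : Set (Eu n)}

theorem sm_finite (hn : 2 ≤ n) (hc₀ : Convex ℝ K₀) (hK₀ : IsCompact K₀)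
    (h0₀ : (0 : Eu n) ∈ interior K₀) : IsFiniteMeasure (sm K₀) :=
  ⟨by rw [sm_univ]; exact surf_finite hn hc₀ hK₀ h0₀⟩

theorem comp_integrable (hn : 2 ≤ n) (hc₀ : Convex ℝ K₀) (hK₀ : IsCompact K₀)
    (h0₀ : (0 : Eu n) ∈ interior K₀) (G : Eu n × Eu n → ℝ) (hG : Continuous G) (C : ℝ)
    (hGC : ∀ z, |G z| ≤ C) : Integrable (fun x => G (x, gaussMap K₀ x)) (sm K₀) := by
  have := sm_finite hn hc₀ hK₀ h0₀
  exact Integrable.of_bound (comp_aemeasurable hn hc₀ hK₀ h0₀ G hG).aestronglyMeasurable C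
    (Eventually.of_forall fun x => hGC _)

theorem upper_real (hn : 2 ≤ n)
    (hc : ∀ i, Convex ℝ (K i)) (hK : ∀ i, IsCompact (K i)) (h0 : ∀ i, (0 : Eu n) ∈ interior (K i))
    (hc₀ : Convex ℝ K₀) (hK₀ : IsCompact K₀) (h0₀ : (0 : Eu n) ∈ interior K₀)
    (hL : ∀ ε > 0, ∀ᶠ k in atTop, ∀ u : Eu n, ‖u‖ = 1 → |suppFun (K k) u - suppFun K₀ u| ≤ ε)
    {D : ℝ≥0∞} (hD : D ≠ ∞) (hmass : ∀ i, sm (K i) univ ≤ D)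
    (G : Eu n × Eu n → ℝ) (hG : Continuous G) (hG0 : ∀ z, 0 ≤ G z) (C : ℝ) (hGC : ∀ z, G z ≤ C)
    {ε : ℝ} (hε : 0 < ε) :
    ∀ᶠ i in atTop, ∫ x, G (x, gaussMap (K i) x) ∂(sm (K i)) <
      ∫ x, G (x, gaussMap K₀ x) ∂(sm K₀) + ε := by
  have hGa : ∀ z, |G z| ≤ C := fun z => by rw [abs_of_nonneg (hG0 z)]; exact hGC z
  have h1 := limsup_lint hn hc hK h0 hc₀ hK₀ h0₀ hL hD hmass G hG hG0 C hGC
  have hi0 := comp_integrable hn hc₀ hK₀ h0₀ G hG C hGa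
  rw [← ofReal_integral_eq_lintegral_ofReal hi0 (Eventually.of_forall fun x => hG0 _)] at h1
  have hnn : 0 ≤ ∫ x, G (x, gaussMap K₀ x) ∂(sm K₀) := integral_nonneg fun x => hG0 _
  have h2 : ENNReal.ofReal (∫ x, G (x, gaussMap K₀ x) ∂(sm K₀)) <
      ENNReal.ofReal (∫ x, G (x, gaussMap K₀ x) ∂(sm K₀) + ε) :=
    (ENNReal.ofReal_lt_ofReal_iff (by linarith)).2 (by linarith)
  filter_upwards [eventually_lt_of_limsup_lt (h1.trans_lt h2)] with i hi
  rw [← ofReal_integral_eq_lintegral_ofReal (comp_integrable hn (hc i) (hK i) (h0 i) G hG C hGa)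
    (Eventually.of_forall fun x => hG0 _)] at hi
  exact (ENNReal.ofReal_lt_ofReal_iff (by linarith)).1 hi

theorem core (hn : 2 ≤ n)
    (hc : ∀ i, Convex ℝ (K i)) (hK : ∀ i, IsCompact (K i)) (h0 : ∀ i, (0 : Eu n) ∈ interior (K i))
    (hc₀ : Convex ℝ K₀) (hK₀ : IsCompact K₀) (h0₀ : (0 : Eu n) ∈ interior K₀)
    (hL : ∀ ε > 0, ∀ᶠ k in atTop, ∀ u : Eu n, ‖u‖ = 1 → |suppFun (K k) u - suppFun K₀ u| ≤ ε)
    (G : Eu n × Eu n → ℝ) (hG : Continuous G) (C : ℝ) (hGC : ∀ z, |G z| ≤ C) :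
    Tendsto (fun i => ∫ x, G (x, gaussMap (K i) x) ∂(sm (K i))) atTop
      (𝓝 (∫ x, G (x, gaussMap K₀ x) ∂(sm K₀))) := by
  have hf₀ := sm_finite hn hc₀ hK₀ h0₀
  have hf := fun i => sm_finite hn (hc i) (hK i) (h0 i)
  have hmt := mass_tendsto hn hc hK h0 hc₀ hK₀ h0₀ hL
  have hmr : Tendsto (fun i => (sm (K i)).real univ) atTop (𝓝 ((sm K₀).real univ)) :=
    (ENNReal.tendsto_toReal (measure_ne_top _ _)).comp hmt
  obtain ⟨N, hN⟩ := eventually_atTop.1 (hmt.eventually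
    (gt_mem_nhds (ENNReal.lt_add_right (measure_ne_top (sm K₀) univ) one_ne_zero)))
  have hD : sm K₀ univ + 1 ≠ ∞ := by simp
  have hLN : ∀ ε > 0, ∀ᶠ k in atTop, ∀ u : Eu n, ‖u‖ = 1 →
      |suppFun (K (k + N)) u - suppFun K₀ u| ≤ ε := fun ε hε =>
    (tendsto_add_atTop_nat N).eventually (hL ε hε)
  rw [← tendsto_add_atTop_iff_nat N]
  have hmrN := hmr.comp (tendsto_add_atTop_nat N)
  have hub : ∀ (H : Eu n × Eu n → ℝ), Continuous H → (∀ z, 0 ≤ H z) → ∀ B : ℝ, (∀ z, H z ≤ B) →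
      ∀ ε > 0, ∀ᶠ i in atTop, ∫ x, H (x, gaussMap (K (i + N)) x) ∂(sm (K (i + N))) <
      ∫ x, H (x, gaussMap K₀ x) ∂(sm K₀) + ε := fun H hH hH0 B hB ε hε =>
    upper_real (K := fun i => K (i + N)) hn (fun i => hc _) (fun i => hK _) (fun i => h0 _)
      hc₀ hK₀ h0₀ hLN hD (fun i => (hN _ (by lia)).le) H hH hH0 B hB hε
  have hint₀ := comp_integrable hn hc₀ hK₀ h0₀ G hG C hGC
  have hint := fun i => comp_integrable hn (hc i) (hK i) (h0 i) G hG C hGC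
  have hplus := hub (fun z => C + G z) (by fun_prop)
    (fun z => by linarith [(abs_le.1 (hGC z)).1]) (2 * C) (fun z => by linarith [(abs_le.1 (hGC z)).2])
  have hminus := hub (fun z => C - G z) (by fun_prop)
    (fun z => by linarith [(abs_le.1 (hGC z)).2]) (2 * C) (fun z => by linarith [(abs_le.1 (hGC z)).1])
  rw [Metric.tendsto_atTop']
  intro ε hε
  have hmC : Tendsto (fun i => C * (sm (K (i + N))).real univ) atTop
      (𝓝 (C * (sm K₀).real univ)) := hmrN.const_mul C
  have hmev := Metric.tendsto_nhds.1 hmC (ε / 2) (by positivity)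
  have hall := (hplus (ε / 2) (by positivity)).and ((hminus (ε / 2) (by positivity)).and hmev)
  obtain ⟨M, hM⟩ := eventually_atTop.1 hall
  refine ⟨M, fun i hi => ?_⟩
  obtain ⟨h1, h2, h3⟩ := hM i hi.le
  rw [integral_add (integrable_const C) (hint _), integral_add (integrable_const C) hint₀,
    integral_const, integral_const, smul_eq_mul, smul_eq_mul] at h1
  rw [integral_sub (integrable_const C) (hint _), integral_sub (integrable_const C) hint₀,
    integral_const, integral_const, smul_eq_mul, smul_eq_mul] at h2
  rw [Real.dist_eq, abs_lt] at h3 ⊢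
  constructor <;> linarith [h3.1, h3.2, mul_comm C ((sm K₀).real univ),
    mul_comm C ((sm (K (i + N))).real univ)]

theorem supp_abs_le {K : Set (Eu n)} (hK : IsCompact K) (h0 : (0 : Eu n) ∈ interior K) :
    ∃ R : ℝ, ∀ v : Eu n, ‖v‖ = 1 → |suppFun K v| ≤ R := by
  obtain ⟨R, hR⟩ := hK.isBounded.exists_norm_le
  refine ⟨R, fun v hv => ?_⟩
  have h1 : suppFun K v ≤ R := supp_le ⟨0, interior_subset h0⟩ fun y hy => by
    have := real_inner_le_norm y v
    rw [hv, mul_one] at this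
    exact this.trans (hR y hy)
  have h2 := le_supp hK (interior_subset h0) v
  rw [inner_zero_left] at h2
  rwa [abs_of_nonneg h2]

theorem unif_of_conv (hK : ∀ i, IsCompact (K i)) (h0 : ∀ i, (0 : Eu n) ∈ interior (K i))
    (hK₀ : IsCompact K₀) (h0₀ : (0 : Eu n) ∈ interior K₀)
    (hconv : Tendsto
      (fun i => ⨆ v : sphere (0 : Eu n) 1, |suppFun (K i) ↑v - suppFun K₀ ↑v|) atTop (𝓝 0)) :
    ∀ ε > 0, ∀ᶠ k in atTop, ∀ u : Eu n, ‖u‖ = 1 → |suppFun (K k) u - suppFun K₀ u| ≤ ε := by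
  intro ε hε
  filter_upwards [hconv.eventually (gt_mem_nhds hε)] with i hi u hu
  obtain ⟨R, hR⟩ := supp_abs_le (hK i) (h0 i)
  obtain ⟨R', hR'⟩ := supp_abs_le hK₀ h0₀
  have hb : BddAbove (range fun v : sphere (0 : Eu n) 1 => |suppFun (K i) ↑v - suppFun K₀ ↑v|) := by
    refine ⟨R + R', ?_⟩
    rintro _ ⟨v, rfl⟩
    have hv : ‖(v : Eu n)‖ = 1 := by simp
    exact (norm_sub_le (suppFun (K i) (v : Eu n)) _).trans (add_le_add (hR _ hv) (hR' _ hv))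
  exact (le_ciSup hb ⟨u, by simpa using hu⟩).trans hi.le

end final

end GSW

/-- Weak convergence of Gaussian surface area measures along Hausdorff convergence:
if `K i → K₀` in the Hausdorff metric, then for every continuous `g` on the sphere,
`∫ g dS_{γₙ,K i} → ∫ g dS_{γₙ,K₀}`, the integrals written as boundary integrals
`(2π)^{-n/2} ∫_{∂K} g(ν_K(x)) e^{-|x|²/2} dH^{n-1}(x)`. -/
theorem gaussian_surface_weak_convergence
    (n : ℕ) (hn : 2 ≤ n) (K : ℕ → Set (Eu n)) (K₀ : Set (Eu n))
    (hKi : ∀ i, IsConvexBody (K i)) (hKi0 : ∀ i, (0 : Eu n) ∈ interior (K i))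
    (hK₀ : IsConvexBody K₀) (hK₀0 : (0 : Eu n) ∈ interior K₀)
    (hconv : Tendsto
      (fun i => ⨆ v : sphere (0 : Eu n) 1, |suppFun (K i) ↑v - suppFun K₀ ↑v|)
      atTop (𝓝 0)) :
    ∀ g : Eu n → ℝ, ContinuousOn g (sphere (0 : Eu n) 1) →
      Tendsto
        (fun i => (Real.sqrt (2 * Real.pi))⁻¹ ^ n *
          ∫ x in frontier (K i), g (gaussMap (K i) x) * Real.exp (-‖x‖ ^ 2 / 2)
            ∂μH[(n : ℝ) - 1])
        atTop
        (𝓝 ((Real.sqrt (2 * Real.pi))⁻¹ ^ n *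
          ∫ x in frontier K₀, g (gaussMap K₀ x) * Real.exp (-‖x‖ ^ 2 / 2)
            ∂μH[(n : ℝ) - 1])) := by
  intro g hg
  obtain ⟨M, hM⟩ := (isCompact_sphere (0 : Eu n) 1).exists_bound_of_continuousOn hg
  obtain ⟨g', -, hg'⟩ := BoundedContinuousFunction.exists_norm_eq_domRestrict_eq_of_closed
    (BoundedContinuousFunction.ofNormedAddCommGroup ((sphere (0 : Eu n) 1).domRestrict g)
      (continuousOn_iff_continuous_domRestrict.1 hg) M (fun x => hM x x.2)) isClosed_sphere
  have hgg : ∀ v : Eu n, ‖v‖ = 1 → g v = g' v := fun v hv => by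
    have := congrArg (fun f => f ⟨v, by simpa using hv⟩) hg'
    exact this.symm
  have hL := GSW.unif_of_conv (fun i => (hKi i).2.1) hKi0 hK₀.2.1 hK₀0 hconv
  have hexp : ∀ x : Eu n, Real.exp (-‖x‖ ^ 2 / 2) ≤ 1 := fun x => by
    rw [Real.exp_le_one_iff]
    have := sq_nonneg ‖x‖
    linarith
  have hcore := GSW.core hn (fun i => (hKi i).1) (fun i => (hKi i).2.1) hKi0 hK₀.1 hK₀.2.1 hK₀0 hL
    (fun z => g' z.2 * Real.exp (-‖z.1‖ ^ 2 / 2)) (by fun_prop) ‖g'‖ (fun z => by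
      rw [abs_mul, abs_of_pos (Real.exp_pos _)]
      calc |g' z.2| * Real.exp (-‖z.1‖ ^ 2 / 2) ≤ ‖g'‖ * 1 :=
            mul_le_mul (g'.norm_coe_le_norm z.2) (hexp _) (Real.exp_pos _).le (norm_nonneg _)
        _ = ‖g'‖ := mul_one _)
  have hEq : ∀ L : Set (Eu n), IsConvexBody L → (0 : Eu n) ∈ interior L →
      ∫ x in frontier L, g (gaussMap L x) * Real.exp (-‖x‖ ^ 2 / 2) ∂μH[(n : ℝ) - 1] =
      ∫ x, g' (gaussMap L x) * Real.exp (-‖x‖ ^ 2 / 2) ∂(GSW.sm L) := fun L hL hL0 => by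
    refine setIntegral_congr_fun isClosed_frontier.measurableSet fun x hx => ?_
    simp only [hgg _ (GSW.gaussMap_spec hL.1 hL.2.1 hL0 hx).1]
  refine Tendsto.const_mul _ ?_
  rw [hEq K₀ hK₀ hK₀0]
  simp only [fun i => hEq (K i) (hKi i) (hKi0 i)]
  exact hcore
end
end
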